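/- For every integer d ≥ 2, the optimal constant α_{1,d} equals π²/(4·j_{d/2−1,1}²); that is, inf{ μ₁(Ω₁)/μ₁(Ω₂) : Ω₁ ⊆ Ω₂ ⊂ ℝ^d nonempty bounded convex open sets } = π²/(4·j_{d/2−1,1}²), where j_{d/2−1,1} is the first positive zero of the Bessel function J_{d/2−1}. -/

import Mathlib

open MeasureTheory Real Filter

noncomputable section

/-- Euclidean space `ℝ^d`. -/
abbrev Euc (d : ℕ) := EuclideanSpace ℝ (Fin d)

/-- The Rayleigh quotient of a function `u` on a set `Ω ⊆ ℝ^d`. -/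
noncomputable def rayleigh {d : ℕ} (Ω : Set (Euc d)) (u : Euc d → ℝ) : ℝ :=
  (∫ x in Ω, ‖fderiv ℝ u x‖ ^ 2) / (∫ x in Ω, (u x) ^ 2)

/-- The `k`-th Neumann eigenvalue of `Ω ⊆ ℝ^d`, defined by the variational (min-max)
principle: the infimum, over all subspaces `V` of smooth functions `ℝ^d → ℝ` whose space of
restrictions to `Ω` is `(k+1)`-dimensional, of the supremum of the Rayleigh quotient over
the elements of `V` that are nonzero in `L²(Ω)`. -/
noncomputable def neumannEigenvalue {d : ℕ} (k : ℕ) (Ω : Set (Euc d)) : ℝ :=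
  sInf { t : ℝ | ∃ V : Submodule ℝ (Euc d → ℝ),
    (∀ u ∈ V, ContDiff ℝ (⊤ : ℕ∞) u) ∧
    Module.finrank ℝ (V.map (LinearMap.funLeft ℝ ℝ ((↑) : Ω → Euc d))) = k + 1 ∧
    t = sSup { r : ℝ | ∃ u ∈ V, (0 < ∫ x in Ω, (u x) ^ 2) ∧ r = rayleigh Ω u } }

/-- A nonempty bounded convex open subset of `ℝ^d`. -/
def IsConvexDomain {d : ℕ} (Ω : Set (Euc d)) : Prop :=
  Ω.Nonempty ∧ IsOpen Ω ∧ Bornology.IsBounded Ω ∧ Convex ℝ Ω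

/-- The optimal constant `α_{k,d}`: the infimum of `μ_k(Ω₁)/μ_k(Ω₂)` over all pairs of
nonempty bounded convex open sets `Ω₁ ⊆ Ω₂ ⊂ ℝ^d`. -/
noncomputable def alphaConst (k d : ℕ) : ℝ :=
  sInf { r : ℝ | ∃ Ω₁ Ω₂ : Set (Euc d), IsConvexDomain Ω₁ ∧ IsConvexDomain Ω₂ ∧ Ω₁ ⊆ Ω₂ ∧
    r = neumannEigenvalue k Ω₁ / neumannEigenvalue k Ω₂ }

/-- The Bessel function of the first kind of order `ν` (for `x > 0`). -/
noncomputable def besselJ (ν : ℝ) (x : ℝ) : ℝ :=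
  ∑' m : ℕ, ((-1 : ℝ) ^ m / (m.factorial * Real.Gamma (m + ν + 1))) * (x / 2) ^ (2 * (m : ℝ) + ν)

/-- The first positive zero `j_{ν,1}` of the Bessel function `J_ν`. -/
noncomputable def besselZero1 (ν : ℝ) : ℝ :=
  sInf {x : ℝ | 0 < x ∧ besselJ ν x = 0}

/-- The second positive zero `j_{ν,2}` of the Bessel function `J_ν`. -/
noncomputable def besselZero2 (ν : ℝ) : ℝ :=
  sInf {x : ℝ | besselZero1 ν < x ∧ besselJ ν x = 0}

/-! ### Bessel function -/

/-- coefficients of the normalized Bessel series -/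
def bcoef (ν : ℝ) (m : ℕ) : ℝ := (-1 : ℝ) ^ m / (4 ^ m * m.factorial * Real.Gamma (m + ν + 1))

/-- normalized Bessel series in the variable `s = r^2` -/
def bg (ν : ℝ) (s : ℝ) : ℝ := ∑' m : ℕ, bcoef ν m * s ^ m

lemma bgamma_ge {ν : ℝ} (hν : 0 ≤ ν) (m : ℕ) : Real.Gamma (ν + 1) ≤ Real.Gamma (m + ν + 1) := by
  induction m with
  | zero => simp
  | succ k ih =>
    have h : ((k + 1 : ℕ) : ℝ) + ν + 1 = (k + ν + 1) + 1 := by push_cast; ring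
    have hk : (0 : ℝ) ≤ k := Nat.cast_nonneg k
    rw [h, Real.Gamma_add_one (s := k + ν + 1) (by positivity)]
    have hp : 0 < Real.Gamma (k + ν + 1) := Real.Gamma_pos_of_pos (by positivity)
    nlinarith

lemma bcoef_abs_le {ν : ℝ} (hν : 0 ≤ ν) (m : ℕ) :
    |bcoef ν m| ≤ (Real.Gamma (ν + 1))⁻¹ * ((m.factorial : ℝ))⁻¹ := by
  have hG : 0 < Real.Gamma (ν + 1) := Real.Gamma_pos_of_pos (by positivity)
  have hG' := bgamma_ge hν m
  have hf : (0 : ℝ) < m.factorial := by exact_mod_cast m.factorial_pos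
  unfold bcoef
  rw [abs_div, abs_pow, abs_neg, abs_one, one_pow, abs_of_pos (by positivity), ← mul_inv, one_div]
  apply inv_anti₀ (by positivity)
  have h4 : (1 : ℝ) ≤ 4 ^ m := one_le_pow₀ (by norm_num)
  calc Real.Gamma (ν + 1) * m.factorial ≤ Real.Gamma (m + ν + 1) * m.factorial := by gcongr
    _ = 1 * m.factorial * Real.Gamma (m + ν + 1) := by ring
    _ ≤ _ := by gcongr

lemma bg_summable {ν : ℝ} (hν : 0 ≤ ν) (s : ℝ) : Summable (fun m => bcoef ν m * s ^ m) := by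
  have h1 : Summable (fun m : ℕ => (Real.Gamma (ν + 1))⁻¹ * (|s| ^ m / m.factorial)) :=
    (Real.summable_pow_div_factorial |s|).mul_left _
  refine Summable.of_norm_bounded h1 fun m => ?_
  rw [Real.norm_eq_abs, abs_mul, abs_pow]
  calc _ ≤ (Real.Gamma (ν + 1))⁻¹ * ((m.factorial : ℝ))⁻¹ * |s| ^ m := by
        gcongr; exact bcoef_abs_le hν m
    _ = _ := by ring

lemma bcoef_succ {ν : ℝ} (m : ℕ) :
    bcoef ν (m + 1) * (m + 1 : ℝ) = -(1/4) * bcoef (ν + 1) m := by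
  unfold bcoef
  rw [Nat.factorial_succ]
  push_cast
  have : (m : ℝ) + 1 + ν + 1 = m + (ν + 1) + 1 := by ring
  rw [this]
  have hm : (m : ℝ) + 1 ≠ 0 := by positivity
  by_cases hG : Real.Gamma (m + (ν + 1) + 1) = 0
  · simp [hG]
  field_simp
  ring

lemma bg_hasDerivAt {ν : ℝ} (hν : 0 ≤ ν) (s : ℝ) :
    HasDerivAt (bg ν) (-(1/4) * bg (ν + 1) s) s := by
  set R : ℝ := |s| + 1 with hR
  have hRpos : 0 < R := by positivity
  have h0 : Summable (fun m : ℕ => (Real.Gamma (ν + 1))⁻¹ * (R ^ m / m.factorial)) :=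
    (Real.summable_pow_div_factorial R).mul_left _
  have h1 : Summable (fun m : ℕ => (Real.Gamma (ν + 1))⁻¹ * ((m.factorial : ℝ))⁻¹ * (m * R ^ (m - 1))) := by
    rw [← summable_nat_add_iff 1]
    refine h0.congr fun m => ?_
    rw [Nat.factorial_succ]
    have : (m.factorial : ℝ) ≠ 0 := by exact_mod_cast m.factorial_ne_zero
    push_cast
    simp
    field_simp
  have := hasDerivAt_tsum_of_isPreconnected (g := fun m s => bcoef ν m * s ^ m)
    (g' := fun m s => bcoef ν m * (m * s ^ (m - 1))) (t := Metric.ball 0 R) (y₀ := s) (y := s) h1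
    Metric.isOpen_ball (convex_ball 0 R).isPreconnected ?_ ?_ (by simp [hR]) (bg_summable hν s)
    (by simp [hR])
  · have h2 : (∑' m : ℕ, bcoef ν m * (m * s ^ (m - 1))) = -(1/4) * bg (ν + 1) s := by
      have hs : Summable (fun m : ℕ => bcoef ν m * (m * s ^ (m - 1))) := by
        rw [← summable_nat_add_iff 1]
        refine ((bg_summable (ν := ν + 1) (by positivity) s).mul_left (-(1/4))).congr fun m => ?_
        have := bcoef_succ (ν := ν) m
        push_cast
        try simp only [Nat.add_sub_cancel]
        linear_combination (-s ^ m) * this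
      rw [hs.tsum_eq_zero_add, bg, ← tsum_mul_left]
      simp only [Nat.cast_zero, zero_mul, mul_zero, zero_add]
      refine tsum_congr fun m => ?_
      have := bcoef_succ (ν := ν) m
      push_cast
      try simp only [Nat.add_sub_cancel]
      linear_combination (s ^ m) * this
    rw [← h2]
    exact this
  · intro n y _
    exact (hasDerivAt_pow n y).const_mul _
  · intro n y hy
    have hy' : |y| ≤ R := by simpa using (mem_ball_zero_iff.1 hy).le
    rw [Real.norm_eq_abs, abs_mul, abs_mul, abs_pow, Nat.abs_cast]
    gcongr
    exact bcoef_abs_le hν n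

lemma bg_contDiff_nat (n : ℕ) : ∀ {ν : ℝ}, 0 ≤ ν → ContDiff ℝ n (bg ν) := by
  induction n with
  | zero =>
    intro ν hν
    have : Differentiable ℝ (bg ν) := fun s => (bg_hasDerivAt hν s).differentiableAt
    simpa using this.continuous
  | succ n ih =>
    intro ν hν
    have h : deriv (bg ν) = fun s => -(1/4) * bg (ν + 1) s := by
      funext s; exact (bg_hasDerivAt hν s).deriv
    have : ContDiff ℝ ((n : WithTop ℕ∞) + 1) (bg ν) := by
      rw [contDiff_succ_iff_deriv]
      refine ⟨fun s => (bg_hasDerivAt hν s).differentiableAt, by simp, ?_⟩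
      rw [h]
      exact contDiff_const.mul (ih (by positivity))
    exact_mod_cast this

lemma bg_contDiff {ν : ℝ} (hν : 0 ≤ ν) : ContDiff ℝ (⊤ : ℕ∞) (bg ν) :=
  contDiff_infty.2 fun n => bg_contDiff_nat n hν

lemma bg_rec {ν : ℝ} (hν : 0 ≤ ν) (s : ℝ) :
    bg ν s = (ν + 1) * bg (ν + 1) s - (s / 4) * bg (ν + 2) s := by
  have e1 := bg_summable (ν := ν + 1) (by positivity) s
  have e2 := bg_summable (ν := ν + 2) (by positivity) s
  have e0 := bg_summable hν s
  have key : ∀ m : ℕ, bcoef ν (m+1) * s ^ (m+1) =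
      (ν + 1) * (bcoef (ν+1) (m+1) * s ^ (m+1)) - (s/4) * (bcoef (ν+2) m * s ^ m) := by
    intro m
    have h2 : bcoef ν (m+1) = (ν + 1) * bcoef (ν+1) (m+1) - (1/4) * bcoef (ν+2) m := by
      unfold bcoef
      have hx : (0:ℝ) < (m:ℝ) + ν + 2 := by positivity
      have hG : Real.Gamma ((m:ℝ) + ν + 2) ≠ 0 := (Real.Gamma_pos_of_pos hx).ne'
      have a1 : ((m+1 : ℕ) : ℝ) + ν + 1 = (m:ℝ) + ν + 2 := by push_cast; ring
      have a2 : ((m+1 : ℕ) : ℝ) + (ν + 1) + 1 = ((m:ℝ) + ν + 2) + 1 := by push_cast; ring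
      have a3 : (m : ℝ) + (ν + 2) + 1 = ((m:ℝ) + ν + 2) + 1 := by ring
      rw [a1, a2, a3, Real.Gamma_add_one hx.ne', Nat.factorial_succ]
      have hf : (m.factorial : ℝ) ≠ 0 := by exact_mod_cast m.factorial_ne_zero
      push_cast
      field_simp
      ring
    rw [h2]; ring
  unfold bg
  rw [e0.tsum_eq_zero_add, e1.tsum_eq_zero_add]
  have : (∑' m : ℕ, bcoef ν (m+1) * s ^ (m+1)) =
      (ν + 1) * (∑' m : ℕ, bcoef (ν+1) (m+1) * s ^ (m+1)) - (s/4) * ∑' m : ℕ, bcoef (ν+2) m * s ^ m := by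
    rw [← tsum_mul_left, ← tsum_mul_left, ← Summable.tsum_sub]
    · exact tsum_congr key
    · exact ((summable_nat_add_iff 1).2 e1).mul_left _
    · exact e2.mul_left _
  rw [this]
  have h0 : bcoef ν 0 = (ν + 1) * bcoef (ν+1) 0 := by
    unfold bcoef
    have hx : (0:ℝ) < ν + 1 := by positivity
    simp only [Nat.cast_zero, zero_add]
    rw [Real.Gamma_add_one hx.ne']
    have hG : Real.Gamma (ν + 1) ≠ 0 := (Real.Gamma_pos_of_pos hx).ne'
    simp only [pow_zero, Nat.factorial_zero, Nat.cast_one, mul_one, one_mul]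
    field_simp
  rw [h0]; ring

lemma besselJ_eq {ν : ℝ} {x : ℝ} (hx : 0 < x) :
    besselJ ν x = (x / 2) ^ ν * bg ν (x ^ 2) := by
  unfold besselJ bg
  rw [← tsum_mul_left]
  refine tsum_congr fun m => ?_
  have h2 : (x / 2) ^ (2 * (m : ℝ) + ν) = (x/2) ^ ν * ((x ^ 2) ^ m / 4 ^ m) := by
    rw [Real.rpow_add (by positivity), Real.rpow_mul (by positivity)]
    have : (x / 2) ^ (2 : ℝ) = x ^ 2 / 4 := by
      rw [Real.rpow_two]; ring
    rw [this, Real.rpow_natCast, div_pow]; ring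
  rw [h2]
  unfold bcoef
  by_cases hG : Real.Gamma (m + ν + 1) = 0
  · simp [hG]
  have hf : (m.factorial : ℝ) ≠ 0 := by exact_mod_cast m.factorial_ne_zero
  field_simp

lemma besselJ_zero_iff {ν : ℝ} {x : ℝ} (hx : 0 < x) :
    besselJ ν x = 0 ↔ bg ν (x ^ 2) = 0 := by
  rw [besselJ_eq hx]
  have : (x/2) ^ ν ≠ 0 := (Real.rpow_pos_of_pos (by positivity) _).ne'
  simp [this]

lemma bg_zero_pos {ν : ℝ} (hν : 0 ≤ ν) : 0 < bg ν 0 := by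
  unfold bg
  rw [tsum_eq_single 0 (by intro m hm; simp [hm])]
  have : 0 < Real.Gamma (ν + 1) := Real.Gamma_pos_of_pos (by positivity)
  simp [bcoef, this]

/-- the order `d/2 - 1` for `d = n + 1` -/
def bnu (n : ℕ) : ℝ := ((n + 1 : ℕ) : ℝ) / 2 - 1

lemma bnu_nonneg {n : ℕ} (hn : 1 ≤ n) : 0 ≤ bnu n := by
  have : (1 : ℝ) ≤ n := by exact_mod_cast hn
  unfold bnu; push_cast; linarith

/-- radial profile -/
def bf (n : ℕ) (κ r : ℝ) : ℝ := bg (bnu n) ((κ * r) ^ 2)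
/-- derivative of the radial profile -/
def bf1 (n : ℕ) (κ r : ℝ) : ℝ := -(κ ^ 2 / 2) * r * bg (bnu n + 1) ((κ * r) ^ 2)

lemma bg_sq_hasDerivAt {ν : ℝ} (hν : 0 ≤ ν) (κ r : ℝ) :
    HasDerivAt (fun r => bg ν ((κ * r) ^ 2)) (-(κ ^ 2 / 2) * r * bg (ν + 1) ((κ * r) ^ 2)) r := by
  have h1 : HasDerivAt (fun r : ℝ => (κ * r) ^ 2) (2 * κ ^ 2 * r) r := by
    have := ((hasDerivAt_id r).const_mul κ).pow 2
    refine this.congr_deriv ?_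
    simp; ring
  have := (bg_hasDerivAt hν ((κ * r) ^ 2)).comp r h1
  refine this.congr_deriv ?_
  ring

lemma bf_hasDerivAt {n : ℕ} (hn : 1 ≤ n) (κ r : ℝ) : HasDerivAt (bf n κ) (bf1 n κ r) r :=
  bg_sq_hasDerivAt (bnu_nonneg hn) κ r

lemma bf1_continuous {n : ℕ} (hn : 1 ≤ n) (κ : ℝ) : Continuous (bf1 n κ) := by
  have h := (bg_contDiff (ν := bnu n + 1) (by have := bnu_nonneg hn; positivity)).continuous
  unfold bf1
  fun_prop

lemma bf_continuous {n : ℕ} (hn : 1 ≤ n) (κ : ℝ) : Continuous (bf n κ) := by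
  have h := (bg_contDiff (bnu_nonneg hn)).continuous
  unfold bf
  fun_prop

lemma bf_ode {n : ℕ} (hn : 1 ≤ n) (κ r : ℝ) :
    HasDerivAt (fun r => r ^ n * bf1 n κ r) (-κ ^ 2 * r ^ n * bf n κ r) r := by
  have hν := bnu_nonneg hn
  have h1 := bg_sq_hasDerivAt (ν := bnu n + 1) (by positivity) κ r
  have h2 : HasDerivAt (fun r : ℝ => r ^ (n + 1)) ((n + 1 : ℝ) * r ^ n) r := by
    simpa using hasDerivAt_pow (n + 1) r
  have h3 := (h2.mul h1).const_mul (-(κ ^ 2 / 2))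
  have e : (fun r => r ^ n * bf1 n κ r) = fun r => -(κ ^ 2 / 2) * (r ^ (n+1) * bg (bnu n + 1) ((κ * r) ^ 2)) := by
    funext r; unfold bf1; ring
  rw [e]
  refine h3.congr_deriv ?_
  have := bg_rec hν ((κ * r) ^ 2)
  unfold bf
  rw [this]
  have hn' : bnu n = ((n : ℝ) + 1) / 2 - 1 := by unfold bnu; push_cast; ring
  have e2 : bnu n + 1 + 1 = bnu n + 2 := by ring
  simp only [e2]
  have e3 : (n : ℝ) + 1 = 2 * (bnu n + 1) := by rw [hn']; ring
  rw [e3]; ring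

/-- Picone type inequality. -/
lemma picone_ball {n : ℕ} (hn : 1 ≤ n) {κ R : ℝ} (hR : 0 ≤ R)
    (hpos : ∀ r ∈ Set.Icc 0 R, 0 < bf n κ r) {h h1 : ℝ → ℝ}
    (hh : ∀ r, HasDerivAt h (h1 r) r) (hc : Continuous h1) (hz : h R = 0) :
    κ ^ 2 * ∫ r in (0:ℝ)..R, r ^ n * h r ^ 2 ≤ ∫ r in (0:ℝ)..R, r ^ n * h1 r ^ 2 := by
  have hhc : Continuous h := continuous_iff_continuousAt.2 fun r => (hh r).continuousAt
  have cf := bf_continuous hn κ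
  have cf1 := bf1_continuous hn κ
  set B : ℝ → ℝ := fun r => (r ^ n * bf1 n κ r) / bf n κ r * h r ^ 2
  set B' : ℝ → ℝ := fun r => -κ ^ 2 * (r ^ n * h r ^ 2) - r ^ n * (bf1 n κ r / bf n κ r * h r) ^ 2
      + 2 * r ^ n * (bf1 n κ r / bf n κ r) * h r * h1 r
  have hB : ∀ r ∈ Set.uIcc 0 R, HasDerivAt B (B' r) r := by
    intro r hr
    rw [Set.uIcc_of_le hR] at hr
    have hp := hpos r hr
    have := ((bf_ode hn κ r).div (bf_hasDerivAt hn κ r) hp.ne').mul ((hh r).pow 2)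
    refine this.congr_deriv ?_
    simp only [B', Pi.div_apply, Pi.pow_apply]
    field_simp
    ring
  have cdiv : ContinuousOn (fun r => bf1 n κ r / bf n κ r) (Set.uIcc 0 R) := by
    apply cf1.continuousOn.div cf.continuousOn
    intro r hr
    rw [Set.uIcc_of_le hR] at hr
    exact (hpos r hr).ne'
  have cB' : ContinuousOn B' (Set.uIcc 0 R) := by
    simp only [B']
    have a := hhc.continuousOn (s := Set.uIcc 0 R)
    have b := hc.continuousOn (s := Set.uIcc 0 R)
    fun_prop
  have hInteg := intervalIntegral.integral_eq_sub_of_hasDerivAt hB cB'.intervalIntegrable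
  have hn0 : n ≠ 0 := by omega
  have hzero : ∫ r in (0:ℝ)..R, B' r = 0 := by
    rw [hInteg]; simp [B, hz, hn0]
  have i1 : IntervalIntegrable (fun r => r ^ n * h r ^ 2) volume 0 R :=
    (by fun_prop : Continuous fun r => r ^ n * h r ^ 2).intervalIntegrable _ _
  have i2 : IntervalIntegrable (fun r => r ^ n * h1 r ^ 2) volume 0 R :=
    (by fun_prop : Continuous fun r => r ^ n * h1 r ^ 2).intervalIntegrable _ _
  calc κ ^ 2 * ∫ r in (0:ℝ)..R, r ^ n * h r ^ 2
      = ∫ r in (0:ℝ)..R, (κ ^ 2 * (r ^ n * h r ^ 2) + B' r) := by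
        rw [intervalIntegral.integral_add (i1.const_mul _) cB'.intervalIntegrable, hzero,
          intervalIntegral.integral_const_mul]; ring
    _ ≤ _ := by
        apply intervalIntegral.integral_mono_on hR ((i1.const_mul _).add cB'.intervalIntegrable) i2
        intro r hr
        have : 0 ≤ r ^ n := pow_nonneg hr.1 n
        simp only [B']
        nlinarith [mul_nonneg this (sq_nonneg (h1 r - bf1 n κ r / bf n κ r * h r))]

lemma exists_bf_zero {n : ℕ} (hn : 1 ≤ n) : ∃ r, 0 < r ∧ bf n 1 r = 0 := by
  by_contra hcon
  push Not at hcon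
  have h0 : 0 < bf n 1 0 := by
    unfold bf; simpa using bg_zero_pos (bnu_nonneg hn)
  have hpos : ∀ r, 0 ≤ r → 0 < bf n 1 r := by
    intro r hr
    by_contra hle
    push Not at hle
    have : (0:ℝ) ∈ Set.Icc (bf n 1 r) (bf n 1 0) := ⟨hle, h0.le⟩
    obtain ⟨x, hx, hx0⟩ := intermediate_value_Icc' hr (bf_continuous hn 1).continuousOn this
    rcases eq_or_lt_of_le hx.1 with h | h
    · rw [← h] at hx0; exact h0.ne' hx0
    · exact hcon x h hx0
  -- test with `h = R - r`
  set R : ℝ := n + 3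
  have hR : 0 < R := by positivity
  have key := picone_ball hn (κ := 1) hR.le (fun r hr => hpos r hr.1) (h := fun r => R - r)
    (h1 := fun _ => -1) (fun r => by simpa using (hasDerivAt_id r).const_sub R) continuous_const (by simp)
  have e1 : ∫ r in (0:ℝ)..R, r ^ n * (-1 : ℝ) ^ 2 = R ^ (n+1) / (n+1) := by
    simp [integral_pow]
  have e2 : ∫ r in (0:ℝ)..R, r ^ n * (R - r) ^ 2 =
      R ^ (n+1) * (R ^ 2 / (n+1) - 2 * R ^ 2 / (n+2) + R ^ 2 / (n+3)) := by
    have : ∀ r : ℝ, r ^ n * (R - r) ^ 2 = R ^ 2 * r ^ n - 2 * R * r ^ (n+1) + r ^ (n+2) := by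
      intro r; ring
    simp_rw [this]
    rw [intervalIntegral.integral_add, intervalIntegral.integral_sub,
      intervalIntegral.integral_const_mul, intervalIntegral.integral_const_mul,
      integral_pow, integral_pow, integral_pow]
    · push_cast
      simp
      ring
    all_goals exact Continuous.intervalIntegrable (by fun_prop) _ _
  rw [e1, e2] at key
  have hn1 : (1:ℝ) ≤ n := by exact_mod_cast hn
  have : R ^ 2 / (n+1) - 2 * R ^ 2 / (n+2) + R ^ 2 / ((n:ℝ)+3) = 2 * (n+3) / ((n+1) * (n+2)) := by
    simp only [R]; field_simp; ring
  rw [this] at key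
  have hRp : 0 < R ^ (n+1) := by positivity
  rw [one_pow, one_mul, div_eq_mul_inv] at key
  have := le_of_mul_le_mul_left key hRp
  rw [← div_eq_mul_inv, div_le_iff₀ (by positivity)] at this
  have e : ((n:ℝ) + 1)⁻¹ * ((n+1) * (n+2)) = n + 2 := by field_simp
  rw [e] at this
  linarith

/-- the Bessel zero -/
def bj (n : ℕ) : ℝ := besselZero1 (bnu n)

lemma bj_spec {n : ℕ} (hn : 1 ≤ n) :
    0 < bj n ∧ bf n 1 (bj n) = 0 ∧ ∀ r, 0 ≤ r → r < bj n → 0 < bf n 1 r := by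
  have h0 : 0 < bf n 1 0 := by
    unfold bf; simpa using bg_zero_pos (bnu_nonneg hn)
  set S : Set ℝ := {x : ℝ | 0 ≤ x ∧ bf n 1 x = 0}
  have hS : {x : ℝ | 0 < x ∧ besselJ (bnu n) x = 0} = S := by
    ext x
    constructor
    · rintro ⟨hx, h⟩
      refine ⟨hx.le, ?_⟩
      rw [besselJ_zero_iff hx] at h
      simpa [bf] using h
    · rintro ⟨hx, h⟩
      rcases eq_or_lt_of_le hx with e | e
      · rw [← e] at h; exact absurd h h0.ne'
      · refine ⟨e, ?_⟩
        rw [besselJ_zero_iff e]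
        simpa [bf] using h
  have hj : bj n = sInf S := by unfold bj besselZero1; rw [hS]
  have hcl : IsClosed S := isClosed_Ici.inter (isClosed_eq (bf_continuous hn 1) continuous_const)
  have hne : S.Nonempty := by
    obtain ⟨r, h1, h2⟩ := exists_bf_zero hn
    exact ⟨r, h1.le, h2⟩
  have hbd : BddBelow S := ⟨0, fun x hx => hx.1⟩
  have hmem : bj n ∈ S := hj ▸ hcl.csInf_mem hne hbd
  have hp : 0 < bj n := by
    rcases eq_or_lt_of_le hmem.1 with e | e
    · have := hmem.2; rw [← e] at this; exact absurd this h0.ne'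
    · exact e
  refine ⟨hp, hmem.2, ?_⟩
  intro r hr hlt
  by_contra hle
  push Not at hle
  have : (0:ℝ) ∈ Set.Icc (bf n 1 r) (bf n 1 0) := ⟨hle, h0.le⟩
  obtain ⟨x, hx, hx0⟩ := intermediate_value_Icc' hr (bf_continuous hn 1).continuousOn this
  have : bj n ≤ x := hj ▸ csInf_le hbd ⟨hx.1, hx0⟩
  linarith [hx.2]

lemma bf_scale (n : ℕ) (κ r : ℝ) : bf n κ r = bf n 1 (κ * r) := by simp [bf]
lemma bf1_scale (n : ℕ) (κ r : ℝ) : bf1 n κ r = κ * bf1 n 1 (κ * r) := by simp [bf1]; ring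

lemma bf1_nonpos {n : ℕ} (hn : 1 ≤ n) {r : ℝ} (hr : 0 ≤ r) (hj : r ≤ bj n) : bf1 n 1 r ≤ 0 := by
  rcases eq_or_lt_of_le hr with e | e
  · rw [← e]; simp [bf1]
  obtain ⟨h1, h2, h3⟩ := bj_spec hn
  have hanti : AntitoneOn (fun r => r ^ n * bf1 n 1 r) (Set.Icc 0 (bj n)) := by
    apply antitoneOn_of_deriv_nonpos (convex_Icc _ _)
    · have := bf1_continuous hn 1; fun_prop
    · intro x _; exact (bf_ode hn 1 x).differentiableAt.differentiableWithinAt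
    · intro x hx
      rw [interior_Icc] at hx
      rw [(bf_ode hn 1 x).deriv]
      have := h3 x hx.1.le hx.2
      have : 0 ≤ x ^ n := pow_nonneg hx.1.le n
      have : 0 ≤ x ^ n * bf n 1 x := by positivity
      linarith
  have := hanti ⟨le_refl _, h1.le⟩ ⟨hr, hj⟩ hr
  have hn0 : n ≠ 0 := by omega
  simp only [zero_pow hn0, zero_mul] at this
  have hp : 0 < r ^ n := by positivity
  by_contra hc
  push Not at hc
  nlinarith [mul_pos hp hc]

/-- radial energy inequality, Kroeger's argument. -/
lemma radial_energy {n : ℕ} (hn : 1 ≤ n) {κ R : ℝ} (hκ : 0 ≤ κ) (hR : 0 ≤ R) (hRj : κ * R ≤ bj n) :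
    ∫ r in (0:ℝ)..R, r ^ n * bf1 n κ r ^ 2 ≤ κ ^ 2 * ∫ r in (0:ℝ)..R, r ^ n * bf n κ r ^ 2 := by
  have cf := bf_continuous hn κ
  have cf1 := bf1_continuous hn κ
  have hd : ∀ r ∈ Set.uIcc 0 R, HasDerivAt (fun r => r ^ n * bf1 n κ r * bf n κ r)
      (-κ ^ 2 * (r ^ n * bf n κ r ^ 2) + r ^ n * bf1 n κ r ^ 2) r := by
    intro r _
    refine ((bf_ode hn κ r).mul (bf_hasDerivAt hn κ r)).congr_deriv ?_
    ring
  have i1 : IntervalIntegrable (fun r => r ^ n * bf n κ r ^ 2) volume 0 R :=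
    (by fun_prop : Continuous fun r => r ^ n * bf n κ r ^ 2).intervalIntegrable _ _
  have i2 : IntervalIntegrable (fun r => r ^ n * bf1 n κ r ^ 2) volume 0 R :=
    (by fun_prop : Continuous fun r => r ^ n * bf1 n κ r ^ 2).intervalIntegrable _ _
  have hInteg := intervalIntegral.integral_eq_sub_of_hasDerivAt hd ((i1.const_mul _).add i2)
  rw [intervalIntegral.integral_add (i1.const_mul _) i2, intervalIntegral.integral_const_mul] at hInteg
  obtain ⟨h1, h2, h3⟩ := bj_spec hn
  have hκR : 0 ≤ κ * R := by positivity
  have s1 : bf1 n κ R ≤ 0 := by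
    rw [bf1_scale]
    have := bf1_nonpos hn hκR hRj
    nlinarith
  have s2 : 0 ≤ bf n κ R := by
    rw [bf_scale]
    rcases eq_or_lt_of_le hRj with e | e
    · rw [e, h2]
    · exact (h3 _ hκR e).le
  have hn0 : n ≠ 0 := by omega
  have : R ^ n * bf1 n κ R * bf n κ R ≤ 0 := by
    have : 0 ≤ R ^ n := by positivity
    have := mul_nonneg (mul_nonneg this (neg_nonneg.2 s1)) s2
    linarith
  simp only [zero_pow hn0, zero_mul, sub_zero] at hInteg
  linarith

/-! ### Variational characterizations -/

lemma cont_integrableOn {d : ℕ} {Ω : Set (Euc d)} (hb : Bornology.IsBounded Ω) {f : Euc d → ℝ}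
    (hf : Continuous f) : IntegrableOn f Ω :=
  (hf.continuousOn.integrableOn_compact hb.isCompact_closure).mono_set subset_closure

lemma integral_sq_pos {d : ℕ} {Ω : Set (Euc d)} (ho : IsOpen Ω) (hb : Bornology.IsBounded Ω)
    {f : Euc d → ℝ} (hf : Continuous f) {x : Euc d} (hx : x ∈ Ω) (hfx : f x ≠ 0) :
    0 < ∫ x in Ω, f x ^ 2 := by
  rw [setIntegral_pos_iff_support_of_nonneg_ae]
  · apply IsOpen.measure_pos
    · exact (hf.pow 2).isOpen_support.inter ho
    · exact ⟨x, by simpa using hfx, hx⟩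
  · exact Eventually.of_forall fun x => sq_nonneg _
  · exact cont_integrableOn hb (hf.pow 2)

lemma smooth_fderiv_cont {d : ℕ} {u : Euc d → ℝ} (hu : ContDiff ℝ (⊤ : ℕ∞) u) :
    Continuous (fderiv ℝ u) := hu.continuous_fderiv (by simp)

lemma smooth_grad_int {d : ℕ} {Ω : Set (Euc d)} (hb : Bornology.IsBounded Ω)
    {u : Euc d → ℝ} (hu : ContDiff ℝ (⊤ : ℕ∞) u) :
    IntegrableOn (fun x => ‖fderiv ℝ u x‖ ^ 2) Ω :=
  cont_integrableOn hb ((smooth_fderiv_cont hu).norm.pow 2)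

lemma rayleigh_nonneg {d : ℕ} (Ω : Set (Euc d)) (u : Euc d → ℝ) : 0 ≤ rayleigh Ω u :=
  div_nonneg (integral_nonneg fun x => sq_nonneg _) (integral_nonneg fun x => sq_nonneg _)

lemma ne_upper {d : ℕ} {Ω : Set (Euc d)} {u v : Euc d → ℝ}
    (hu : ContDiff ℝ (⊤ : ℕ∞) u) (hv : ContDiff ℝ (⊤ : ℕ∞) v) {c : ℝ} (hc : 0 ≤ c)
    (hli : ∀ a b : ℝ, (∀ x ∈ Ω, a * u x + b * v x = 0) → a = 0 ∧ b = 0)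
    (hR : ∀ a b : ℝ, ∫ x in Ω, ‖a • fderiv ℝ u x + b • fderiv ℝ v x‖ ^ 2
      ≤ c * ∫ x in Ω, (a * u x + b * v x) ^ 2) :
    neumannEigenvalue 1 Ω ≤ c := by
  set V : Submodule ℝ (Euc d → ℝ) := Submodule.span ℝ {u, v}
  have hVmem : ∀ w ∈ V, ∃ a b : ℝ, w = fun x => a * u x + b * v x := by
    intro w hw
    obtain ⟨a, b, h⟩ := Submodule.mem_span_pair.1 hw
    exact ⟨a, b, by rw [← h]; rfl⟩
  have hbdd : BddBelow { t : ℝ | ∃ V : Submodule ℝ (Euc d → ℝ),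
    (∀ u ∈ V, ContDiff ℝ (⊤ : ℕ∞) u) ∧
    Module.finrank ℝ (V.map (LinearMap.funLeft ℝ ℝ ((↑) : Ω → Euc d))) = 1 + 1 ∧
    t = sSup { r : ℝ | ∃ u ∈ V, (0 < ∫ x in Ω, (u x) ^ 2) ∧ r = rayleigh Ω u } } := by
    refine ⟨0, ?_⟩
    rintro t ⟨V, -, -, rfl⟩
    apply Real.sSup_nonneg
    rintro r ⟨u, -, -, rfl⟩
    exact rayleigh_nonneg _ _
  refine le_trans (csInf_le hbdd ⟨V, ?_, ?_, rfl⟩) ?_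
  · intro w hw
    obtain ⟨a, b, rfl⟩ := hVmem w hw
    exact (contDiff_const.mul hu).add (contDiff_const.mul hv)
  · set L := LinearMap.funLeft ℝ ℝ ((↑) : Ω → Euc d)
    have h1 : V.map L = Submodule.span ℝ (Set.range ![L u, L v]) := by
      simp only [V, Submodule.map_span, Set.image_pair]
      simp [Matrix.range_cons, Matrix.range_empty]
      rw [Set.pair_comm]
    rw [h1, finrank_span_eq_card]
    · simp
    · rw [LinearIndependent.pair_iff]
      intro a b hab
      apply hli
      intro x hx
      have := congrFun hab ⟨x, hx⟩
      simpa [L, LinearMap.funLeft_apply] using this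
  · apply Real.sSup_le _ hc
    rintro r ⟨w, hw, hpos, rfl⟩
    obtain ⟨a, b, rfl⟩ := hVmem w hw
    unfold rayleigh
    rw [div_le_iff₀ hpos]
    refine le_trans (le_of_eq ?_) (hR a b)
    congr 1
    funext x
    congr 2
    have h1 := ((hu.differentiable (by simp)) x).hasFDerivAt.const_mul a
    have h2 := ((hv.differentiable (by simp)) x).hasFDerivAt.const_mul b
    exact (h1.add h2).fderiv

lemma ne_lower {d : ℕ} (hd : 0 < d) {Ω : Set (Euc d)} (hΩ : IsConvexDomain Ω) {c : ℝ}
    (h : ∀ u : Euc d → ℝ, ContDiff ℝ (⊤ : ℕ∞) u → ∫ x in Ω, u x = 0 →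
      c * ∫ x in Ω, u x ^ 2 ≤ ∫ x in Ω, ‖fderiv ℝ u x‖ ^ 2) :
    c ≤ neumannEigenvalue 1 Ω := by
  obtain ⟨⟨x₀, hx₀⟩, ho, hb, -⟩ := hΩ
  apply le_csInf
  · -- nonempty
    set u : Euc d → ℝ := fun _ => 1
    set v : Euc d → ℝ := fun x => x ⟨0, hd⟩
    have hu : ContDiff ℝ (⊤ : ℕ∞) u := contDiff_const
    have hv : ContDiff ℝ (⊤ : ℕ∞) v := by simp only [v]; fun_prop
    set V : Submodule ℝ (Euc d → ℝ) := Submodule.span ℝ {u, v}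
    refine ⟨_, V, ?_, ?_, rfl⟩
    · intro w hw
      obtain ⟨a, b, h⟩ := Submodule.mem_span_pair.1 hw
      rw [← h]
      exact (contDiff_const.smul hu).add (contDiff_const.smul hv)
    · set L := LinearMap.funLeft ℝ ℝ ((↑) : Ω → Euc d)
      have h1 : V.map L = Submodule.span ℝ (Set.range ![L u, L v]) := by
        simp only [V, Submodule.map_span, Set.image_pair]
        simp [Matrix.range_cons, Matrix.range_empty]
        rw [Set.pair_comm]
      rw [h1, finrank_span_eq_card]
      · simp
      · rw [LinearIndependent.pair_iff]
        intro a b hab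
        obtain ⟨ε, hε, hball⟩ := Metric.isOpen_iff.1 ho x₀ hx₀
        set y : Euc d := x₀ + (ε/2) • EuclideanSpace.single ⟨0, hd⟩ (1:ℝ)
        have hy : y ∈ Ω := by
          apply hball
          simp only [y, Metric.mem_ball, dist_self_add_left]
          rw [norm_smul, Real.norm_eq_abs, abs_of_pos (by positivity), PiLp.norm_single]
          simp; linarith
        have h1 := congrFun hab ⟨x₀, hx₀⟩
        have h2 := congrFun hab ⟨y, hy⟩
        simp [L, LinearMap.funLeft_apply, u, v, y] at h1 h2
        have : b * (ε / 2) = 0 := by linarith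
        have hb0 : b = 0 := by
          rcases mul_eq_zero.1 this with h | h
          · exact h
          · linarith
        subst hb0
        simpa using h1
  · rintro t ⟨V, hV, hrk, rfl⟩
    set L := LinearMap.funLeft ℝ ℝ ((↑) : Ω → Euc d)
    haveI : Module.Finite ℝ (V.map L) := Module.finite_of_finrank_pos (by rw [hrk]; norm_num)
    have hrk2 : Module.finrank ℝ (V.map L) = 2 := hrk
    have bs : Module.Basis (Fin 2) ℝ (V.map L) := Module.finBasisOfFinrankEq ℝ (V.map L) hrk2
    obtain ⟨u1, hu1, hL1⟩ := (bs 0).2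
    obtain ⟨u2, hu2, hL2⟩ := (bs 1).2
    have s1 := hV u1 hu1
    have s2 := hV u2 hu2
    have hrep : ∀ u ∈ V, ∃ a b : ℝ, ∀ x ∈ Ω, u x = a * u1 x + b * u2 x := by
      intro u hu
      set w : V.map L := ⟨L u, Submodule.mem_map_of_mem hu⟩
      refine ⟨bs.repr w 0, bs.repr w 1, fun x hx => ?_⟩
      have h3 := bs.sum_repr w
      have h4 : (w : Ω → ℝ) ⟨x, hx⟩ = u x := rfl
      rw [← h4]
      have f1 : (bs 0 : Ω → ℝ) ⟨x, hx⟩ = u1 x := by rw [← hL1]; rfl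
      have f2 : (bs 1 : Ω → ℝ) ⟨x, hx⟩ = u2 x := by rw [← hL2]; rfl
      rw [← f1, ← f2]
      rw [Fin.sum_univ_two] at h3
      exact (congrArg (fun z : V.map L => (z : Ω → ℝ) ⟨x, hx⟩) h3).symm
    have hind : ∀ a b : ℝ, (∀ x ∈ Ω, a * u1 x + b * u2 x = 0) → a = 0 ∧ b = 0 := by
      intro a b hab
      have hli := bs.linearIndependent
      have : a • bs 0 + b • bs 1 = 0 := by
        apply Subtype.ext
        funext ⟨x, hx⟩
        have := hab x hx
        simpa [← hL1, ← hL2, L, LinearMap.funLeft_apply] using this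
      have h2 := Fintype.linearIndependent_iff.1 hli ![a, b] (by simpa [Fin.sum_univ_two] using this)
      exact ⟨by simpa using h2 0, by simpa using h2 1⟩
    have hpos : ∀ a b : ℝ, ¬ (a = 0 ∧ b = 0) → 0 < ∫ x in Ω, (a * u1 x + b * u2 x) ^ 2 := by
      intro a b hab
      have : ¬ ∀ x ∈ Ω, a * u1 x + b * u2 x = 0 := fun hh => hab (hind a b hh)
      push Not at this
      obtain ⟨x, hx, hne⟩ := this
      exact integral_sq_pos ho hb (f := fun x => a * u1 x + b * u2 x)
        (by have := s1.continuous; have := s2.continuous; fun_prop) hx hne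
    have c1 := s1.continuous
    have c2 := s2.continuous
    set A := ∫ x in Ω, u1 x ^ 2
    set B := ∫ x in Ω, u1 x * u2 x
    set C := ∫ x in Ω, u2 x ^ 2
    have hquad : ∀ a b : ℝ, ∫ x in Ω, (a * u1 x + b * u2 x) ^ 2 = a ^ 2 * A + 2 * a * b * B + b ^ 2 * C := by
      intro a b
      have e : ∀ x, (a * u1 x + b * u2 x) ^ 2 = a ^ 2 * u1 x ^ 2 + 2 * a * b * (u1 x * u2 x) + b ^ 2 * u2 x ^ 2 := by
        intro x; ring
      simp_rw [e]
      rw [integral_add, integral_add, integral_const_mul, integral_const_mul, integral_const_mul]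
      all_goals exact cont_integrableOn hb (by fun_prop)
    have hA : 0 < A := by simpa [hquad] using hpos 1 0 (by simp)
    have hC : 0 < C := by simpa [hquad] using hpos 0 1 (by simp)
    have hΔ : 0 < A * C - B ^ 2 := by
      have := hpos (-B) A (by intro hh; exact hA.ne' hh.2)
      rw [hquad] at this
      have e : (-B) ^ 2 * A + 2 * (-B) * A * B + A ^ 2 * C = A * (A * C - B ^ 2) := by ring
      rw [e] at this
      exact (mul_pos_iff_of_pos_left hA).1 this
    set N1 := ∫ x in Ω, ‖fderiv ℝ u1 x‖ ^ 2
    set N2 := ∫ x in Ω, ‖fderiv ℝ u2 x‖ ^ 2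
    have hN1 : 0 ≤ N1 := integral_nonneg fun x => sq_nonneg _
    have hN2 : 0 ≤ N2 := integral_nonneg fun x => sq_nonneg _
    have hbdd : BddAbove { r : ℝ | ∃ u ∈ V, (0 < ∫ x in Ω, (u x) ^ 2) ∧ r = rayleigh Ω u } := by
      refine ⟨2 * (N1 + N2) * (A + C) / (A * C - B ^ 2), ?_⟩
      rintro r ⟨u, hu, hup, rfl⟩
      obtain ⟨a, b, hab⟩ := hrep u hu
      unfold rayleigh
      have e1 : ∫ x in Ω, u x ^ 2 = a ^ 2 * A + 2 * a * b * B + b ^ 2 * C := by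
        rw [← hquad]
        exact setIntegral_congr_fun ho.measurableSet fun x hx => by simp only [hab x hx]
      have e2 : ∫ x in Ω, ‖fderiv ℝ u x‖ ^ 2 ≤ 2 * (a ^ 2 * N1 + b ^ 2 * N2) := by
        have : 2 * (a ^ 2 * N1 + b ^ 2 * N2) =
            ∫ x in Ω, (2 * a ^ 2 * ‖fderiv ℝ u1 x‖ ^ 2 + 2 * b ^ 2 * ‖fderiv ℝ u2 x‖ ^ 2) := by
          rw [integral_add ((smooth_grad_int hb s1).const_mul _) ((smooth_grad_int hb s2).const_mul _),
            integral_const_mul, integral_const_mul]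
          ring
        rw [this]
        apply setIntegral_mono_on (smooth_grad_int hb (hV u hu)) _ ho.measurableSet
        · intro x hx
          have hf : fderiv ℝ u x = a • fderiv ℝ u1 x + b • fderiv ℝ u2 x := by
            have h1 := ((s1.differentiable (by simp)) x).hasFDerivAt.const_mul a
            have h2 := ((s2.differentiable (by simp)) x).hasFDerivAt.const_mul b
            rw [← (h1.add h2).fderiv]
            apply Filter.EventuallyEq.fderiv_eq
            filter_upwards [ho.mem_nhds hx] with y hy
            exact hab y hy
          rw [hf]
          have hn : ‖a • fderiv ℝ u1 x + b • fderiv ℝ u2 x‖ ≤ |a| * ‖fderiv ℝ u1 x‖ + |b| * ‖fderiv ℝ u2 x‖ := by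
            refine (norm_add_le _ _).trans ?_
            rw [norm_smul, norm_smul]; simp
          calc ‖a • fderiv ℝ u1 x + b • fderiv ℝ u2 x‖ ^ 2 ≤ (|a| * ‖fderiv ℝ u1 x‖ + |b| * ‖fderiv ℝ u2 x‖) ^ 2 := by
                gcongr
            _ ≤ 2 * (|a| ^ 2 * ‖fderiv ℝ u1 x‖ ^ 2) + 2 * (|b| ^ 2 * ‖fderiv ℝ u2 x‖ ^ 2) := by
                nlinarith [sq_nonneg (|a| * ‖fderiv ℝ u1 x‖ - |b| * ‖fderiv ℝ u2 x‖)]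
            _ = _ := by rw [sq_abs, sq_abs]; ring
        · exact ((smooth_grad_int hb s1).const_mul _).add ((smooth_grad_int hb s2).const_mul _)
      rw [div_le_div_iff₀ hup hΔ, e1]
      have e3 : (A * C - B ^ 2) * (a ^ 2 + b ^ 2) ≤ (A + C) * (a ^ 2 * A + 2 * a * b * B + b ^ 2 * C) := by
        nlinarith [sq_nonneg (a * A + b * B), sq_nonneg (a * B + b * C)]
      calc _ ≤ 2 * (a ^ 2 * N1 + b ^ 2 * N2) * (A * C - B ^ 2) := by gcongr
        _ ≤ 2 * (N1 + N2) * ((A * C - B ^ 2) * (a ^ 2 + b ^ 2)) := by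
            have : a ^ 2 * N1 + b ^ 2 * N2 ≤ (N1 + N2) * (a ^ 2 + b ^ 2) := by
              nlinarith [mul_nonneg (sq_nonneg a) hN2, mul_nonneg (sq_nonneg b) hN1]
            nlinarith
        _ ≤ 2 * (N1 + N2) * ((A + C) * (a ^ 2 * A + 2 * a * b * B + b ^ 2 * C)) := by gcongr
        _ = _ := by ring
    obtain ⟨a, b, hne, hz⟩ : ∃ a b : ℝ, ¬ (a = 0 ∧ b = 0) ∧ ∫ x in Ω, (a * u1 x + b * u2 x) = 0 := by
      have hlin : ∀ a b : ℝ, ∫ x in Ω, (a * u1 x + b * u2 x) = a * (∫ x in Ω, u1 x) + b * ∫ x in Ω, u2 x := by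
        intro a b
        rw [integral_add, integral_const_mul, integral_const_mul]
        all_goals exact cont_integrableOn hb (by fun_prop)
      by_cases hm : ∫ x in Ω, u1 x = 0
      · exact ⟨1, 0, by simp, by rw [hlin, hm]; simp⟩
      · exact ⟨∫ x in Ω, u2 x, -∫ x in Ω, u1 x, by intro hh; exact hm (neg_eq_zero.1 hh.2), by rw [hlin]; ring⟩
    have hmem : (fun x => a * u1 x + b * u2 x) ∈ V :=
      V.add_mem (V.smul_mem a hu1) (V.smul_mem b hu2)
    refine le_trans ?_ (le_csSup hbdd ⟨_, hmem, hpos a b hne, rfl⟩)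
    unfold rayleigh
    rw [le_div_iff₀ (hpos a b hne)]
    exact h _ (hV _ hmem) hz

/-! ### Polar coordinates -/

lemma polar_nonneg {n : ℕ} {g : Euc (n+1) → ℝ}
    (h : ∀ θ : Euc (n+1), ‖θ‖ = 1 → 0 ≤ ∫ r in Set.Ioi (0:ℝ), r ^ n * g (r • θ)) : 0 ≤ ∫ x, g x := by
  have hdim : Module.finrank ℝ (Euc (n+1)) - 1 = n := by simp
  have e1 : ∫ x, g x = ∫ x : ({(0)}ᶜ : Set (Euc (n+1))), g x.1 ∂(volume.comap Subtype.val) := by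
    rw [integral_subtype_comap (measurableSet_singleton _).compl fun x ↦ g x,
        restrict_compl_singleton]
  have e2 : ∫ x : ({(0)}ᶜ : Set (Euc (n+1))), g x.1 ∂(volume.comap Subtype.val) =
      ∫ z, g (z.2.1 • z.1.1) ∂((volume : Measure (Euc (n+1))).toSphere.prod (.volumeIoiPow n)) := by
    have := (volume : Measure (Euc (n+1))).measurePreserving_homeomorphUnitSphereProd.integral_comp
        (Homeomorph.measurableEmbedding _) (fun z => g (z.2.1 • z.1.1))
    rw [hdim] at this
    rw [← this]
    congr 1
    funext x
    congr 1
    have hx : ‖x.1‖ ≠ 0 := norm_ne_zero_iff.2 x.2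
    simp [smul_smul, hx]
  rw [e1, e2]
  by_cases hInteg : Integrable (fun z : Metric.sphere (0:Euc (n+1)) 1 × Set.Ioi (0:ℝ) => g (z.2.1 • z.1.1))
      ((volume : Measure (Euc (n+1))).toSphere.prod (.volumeIoiPow n))
  · rw [integral_prod _ hInteg]
    apply integral_nonneg
    intro θ
    have hθ : ‖θ.1‖ = 1 := by simpa using θ.2
    refine (h θ.1 hθ).trans (le_of_eq ?_)
    simp only [Measure.volumeIoiPow, ENNReal.ofReal]
    rw [integral_withDensity_eq_integral_smul,
        integral_subtype_comap measurableSet_Ioi fun a ↦ Real.toNNReal (a ^ n) • g (a • θ.1)]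
    · refine setIntegral_congr_fun measurableSet_Ioi fun x hx ↦ ?_
      rw [NNReal.smul_def, Real.coe_toNNReal _ (pow_nonneg hx.out.le _), smul_eq_mul]
    · exact (measurable_subtype_coe.pow_const _).real_toNNReal
  · rw [integral_undef hInteg]

lemma star_energy {n : ℕ} {K : Set (Euc (n+1))} (hK : Convex ℝ K) (h0 : (0 : Euc (n+1)) ∈ K)
    {ρ : ℝ} (hρ : ∀ x ∈ K, ‖x‖ ≤ ρ) {c : ℝ → ℝ}
    (hc : ∀ R, 0 ≤ R → R ≤ ρ → 0 ≤ ∫ r in (0:ℝ)..R, r ^ n * c r) :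
    0 ≤ ∫ x, K.indicator (fun x => c ‖x‖) x := by
  apply polar_nonneg
  intro θ hθ
  set S : Set ℝ := {r | 0 ≤ r ∧ r • θ ∈ K}
  have hS0 : (0:ℝ) ∈ S := ⟨le_refl _, by simpa using h0⟩
  have hSb : ∀ r ∈ S, r ≤ ρ := by
    intro r hr
    have := hρ _ hr.2
    rw [norm_smul, hθ, mul_one, Real.norm_eq_abs] at this
    exact (le_abs_self r).trans this
  have hbd : BddAbove S := ⟨ρ, hSb⟩
  set R := sSup S
  have hR0 : 0 ≤ R := le_csSup hbd hS0
  have hRρ : R ≤ ρ := csSup_le ⟨0, hS0⟩ hSb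
  have hin : ∀ r, 0 < r → r < R → r • θ ∈ K := by
    intro r hr hrR
    obtain ⟨t, ht, hrt⟩ := exists_lt_of_lt_csSup ⟨0, hS0⟩ hrR
    have htp : 0 < t := hr.trans hrt
    have : r • θ = (1 - r / t) • (0 : Euc (n+1)) + (r / t) • (t • θ) := by
      rw [smul_zero, zero_add, smul_smul, div_mul_cancel₀ _ htp.ne']
    rw [this]
    apply hK h0 ht.2
    · rw [sub_nonneg, div_le_one htp]; exact hrt.le
    · positivity
    · ring
  have key : ∫ r in Set.Ioi (0:ℝ), r ^ n * K.indicator (fun x => c ‖x‖) (r • θ) =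
      ∫ r in (0:ℝ)..R, r ^ n * c r := by
    rw [intervalIntegral.integral_of_le hR0, ← integral_indicator measurableSet_Ioi,
      ← integral_indicator measurableSet_Ioc]
    apply integral_congr_ae
    have hne : ∀ᵐ r : ℝ, r ≠ R := by
      simp [ae_iff, measure_singleton]
    filter_upwards [hne] with r hr
    rcases le_or_gt r 0 with h | h
    · rw [Set.indicator_of_notMem (by simpa using h), Set.indicator_of_notMem (by simp [h])]
    · rw [Set.indicator_of_mem (by simpa using h)]
      rcases lt_or_gt_of_ne hr with h' | h'
      · rw [Set.indicator_of_mem (hin r h h'), Set.indicator_of_mem (show r ∈ Set.Ioc 0 R from ⟨h, h'.le⟩), norm_smul, hθ, mul_one,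
          Real.norm_eq_abs, abs_of_pos h]
      · rw [Set.indicator_of_notMem (s := K), Set.indicator_of_notMem, mul_zero]
        · simp [h']
        · intro hmem
          have : r ≤ R := le_csSup hbd ⟨h.le, hmem⟩
          linarith
  rw [key]
  exact hc R hR0 hRρ

/-! ### Kroeger's upper bound -/

lemma smoothTransition_deriv_nonpos {t : ℝ} (ht : t ≤ 0) : deriv Real.smoothTransition t = 0 := by
  apply IsLocalMin.deriv_eq_zero
  filter_upwards with y
  rw [Real.smoothTransition.zero_of_nonpos ht]
  exact Real.smoothTransition.nonneg y

lemma smoothTransition_deriv_ge {t : ℝ} (ht : 1 ≤ t) : deriv Real.smoothTransition t = 0 := by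
  apply IsLocalMax.deriv_eq_zero
  filter_upwards with y
  rw [Real.smoothTransition.one_of_one_le ht]
  exact Real.smoothTransition.le_one y

lemma smoothTransition_bound : ∃ C, 0 ≤ C ∧ ∀ t, |t * deriv Real.smoothTransition t| ≤ C := by
  have hc : Continuous (deriv Real.smoothTransition) :=
    (Real.smoothTransition.contDiff (n := 1)).continuous_deriv le_rfl
  obtain ⟨C, hC⟩ := (isCompact_Icc (a := (0:ℝ)) (b := 1)).exists_bound_of_continuousOn
    (f := fun t => t * deriv Real.smoothTransition t) (by fun_prop)
  refine ⟨max C 0, le_max_right _ _, fun t => ?_⟩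
  rcases le_or_gt t 0 with h | h
  · rw [smoothTransition_deriv_nonpos h]; simp
  rcases le_or_gt 1 t with h' | h'
  · rw [smoothTransition_deriv_ge h']; simp
  · exact (hC t ⟨h.le, h'.le⟩).trans (le_max_left _ _)

/-- truncated profile -/
def prof (n : ℕ) (κ ρ δ s : ℝ) : ℝ :=
  bg (bnu n) (κ ^ 2 * s) * Real.smoothTransition ((ρ ^ 2 - s) / δ)

/-- derivative of the truncated profile -/
def prof1 (n : ℕ) (κ ρ δ s : ℝ) : ℝ :=
  (-(κ ^ 2 / 4) * bg (bnu n + 1) (κ ^ 2 * s)) * Real.smoothTransition ((ρ ^ 2 - s) / δ)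
   - bg (bnu n) (κ ^ 2 * s) * (deriv Real.smoothTransition ((ρ ^ 2 - s) / δ) / δ)

lemma prof_contDiff {n : ℕ} (hn : 1 ≤ n) (κ ρ δ : ℝ) : ContDiff ℝ (⊤ : ℕ∞) (prof n κ ρ δ) := by
  have h1 := bg_contDiff (bnu_nonneg hn)
  have h2 := Real.smoothTransition.contDiff (n := (⊤ : ℕ∞))
  unfold prof
  exact (h1.comp (contDiff_const.mul contDiff_id)).mul
    (h2.comp ((contDiff_const.sub contDiff_id).div_const δ))

lemma bgk_hasDerivAt {n : ℕ} (hn : 1 ≤ n) (κ s : ℝ) :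
    HasDerivAt (fun s => bg (bnu n) (κ ^ 2 * s)) (-(κ ^ 2 / 4) * bg (bnu n + 1) (κ ^ 2 * s)) s := by
  have := (bg_hasDerivAt (bnu_nonneg hn) (κ ^ 2 * s)).comp s ((hasDerivAt_id s).const_mul (κ ^ 2))
  refine this.congr_deriv ?_
  simp; ring

lemma prof_hasDerivAt {n : ℕ} (hn : 1 ≤ n) (κ ρ δ s : ℝ) :
    HasDerivAt (prof n κ ρ δ) (prof1 n κ ρ δ s) s := by
  have h2 : HasDerivAt (fun s => Real.smoothTransition ((ρ ^ 2 - s) / δ))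
      (deriv Real.smoothTransition ((ρ ^ 2 - s) / δ) * (-1 / δ)) s := by
    have hd : DifferentiableAt ℝ Real.smoothTransition ((ρ ^ 2 - s) / δ) :=
      (Real.smoothTransition.contDiff (n := 1)).differentiable (by simp) _
    exact hd.hasDerivAt.comp s (((hasDerivAt_id s).const_sub (ρ ^ 2)).div_const δ)
  refine ((bgk_hasDerivAt hn κ s).mul h2).congr_deriv ?_
  unfold prof1; ring

lemma prof_zero {n : ℕ} {κ ρ δ s : ℝ} (hδ : 0 < δ) (hs : ρ ^ 2 ≤ s) :
    prof n κ ρ δ s = 0 ∧ prof1 n κ ρ δ s = 0 := by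
  have : (ρ ^ 2 - s) / δ ≤ 0 := div_nonpos_of_nonpos_of_nonneg (by linarith) hδ.le
  simp [prof, prof1, Real.smoothTransition.zero_of_nonpos this, smoothTransition_deriv_nonpos this]

lemma prof_eq {n : ℕ} {κ ρ δ s : ℝ} (hδ : 0 < δ) (hs : δ ≤ ρ ^ 2 - s) :
    prof n κ ρ δ s = bg (bnu n) (κ ^ 2 * s) ∧
    prof1 n κ ρ δ s = -(κ ^ 2 / 4) * bg (bnu n + 1) (κ ^ 2 * s) := by
  have : 1 ≤ (ρ ^ 2 - s) / δ := by rwa [le_div_iff₀ hδ, one_mul]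
  simp [prof, prof1, Real.smoothTransition.one_of_one_le this, smoothTransition_deriv_ge this]

lemma prof_bound {n : ℕ} (hn : 1 ≤ n) {κ ρ M : ℝ} (hM : ρ ^ 2 ≤ M)
    (hz : bg (bnu n) (κ ^ 2 * ρ ^ 2) = 0) :
    ∃ C, 0 ≤ C ∧ ∀ δ s, 0 < δ → 0 ≤ s → s ≤ M → |prof n κ ρ δ s| ≤ C ∧ |prof1 n κ ρ δ s| ≤ C := by
  have c0 := (bg_contDiff (bnu_nonneg hn)).continuous
  have c1 := (bg_contDiff (ν := bnu n + 1) (by have := bnu_nonneg hn; positivity)).continuous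
  obtain ⟨C0, hC0⟩ := (isCompact_Icc (a := (0:ℝ)) (b := M)).exists_bound_of_continuousOn
    (f := fun s => bg (bnu n) (κ ^ 2 * s)) (by fun_prop)
  obtain ⟨C1, hC1⟩ := (isCompact_Icc (a := (0:ℝ)) (b := M)).exists_bound_of_continuousOn
    (f := fun s => -(κ ^ 2 / 4) * bg (bnu n + 1) (κ ^ 2 * s)) (by fun_prop)
  obtain ⟨CS, hCS0, hCS⟩ := smoothTransition_bound
  have hM0 : 0 ≤ M := (sq_nonneg ρ).trans hM
  have hC0n : 0 ≤ C0 := (norm_nonneg _).trans (hC0 0 ⟨le_rfl, hM0⟩)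
  have hC1n : 0 ≤ C1 := (norm_nonneg _).trans (hC1 0 ⟨le_rfl, hM0⟩)
  refine ⟨C0 + (C1 + C1 * CS), by positivity, ?_⟩
  intro δ s hδ hs0 hsM
  have hS0 := Real.smoothTransition.nonneg ((ρ ^ 2 - s) / δ)
  have hS1 := Real.smoothTransition.le_one ((ρ ^ 2 - s) / δ)
  have b0 := hC0 s ⟨hs0, hsM⟩
  have b1 := hC1 s ⟨hs0, hsM⟩
  rw [Real.norm_eq_abs] at b0 b1
  have hlip : |bg (bnu n) (κ ^ 2 * s)| ≤ C1 * |ρ ^ 2 - s| := by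
    have := (convex_Icc (0:ℝ) M).norm_image_sub_le_of_norm_hasDerivWithin_le
      (f := fun s => bg (bnu n) (κ ^ 2 * s)) (fun x hx => (bgk_hasDerivAt hn κ x).hasDerivWithinAt)
      hC1 ⟨sq_nonneg ρ, hM⟩ ⟨hs0, hsM⟩
    simp only [hz, sub_zero, Real.norm_eq_abs] at this
    rwa [abs_sub_comm] at this
  constructor
  · unfold prof
    rw [abs_mul, abs_of_nonneg hS0]
    have : |bg (bnu n) (κ ^ 2 * s)| * Real.smoothTransition ((ρ ^ 2 - s) / δ) ≤ C0 * 1 := by gcongr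
    have : 0 ≤ C1 + C1 * CS := by positivity
    linarith
  · unfold prof1
    refine (abs_sub _ _).trans ?_
    have e1 : |-(κ ^ 2 / 4) * bg (bnu n + 1) (κ ^ 2 * s) * Real.smoothTransition ((ρ ^ 2 - s) / δ)| ≤ C1 * 1 := by
      rw [abs_mul, abs_of_nonneg hS0]; gcongr
    have e2 : |bg (bnu n) (κ ^ 2 * s) * (deriv Real.smoothTransition ((ρ ^ 2 - s) / δ) / δ)| ≤ C1 * CS := by
      have hc := hCS ((ρ ^ 2 - s) / δ)
      rw [abs_mul, abs_div, abs_of_pos hδ] at hc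
      rw [abs_mul, abs_div, abs_of_pos hδ]
      calc _ ≤ C1 * |ρ ^ 2 - s| * (|deriv Real.smoothTransition ((ρ ^ 2 - s) / δ)| / δ) := by gcongr
        _ = C1 * (|ρ ^ 2 - s| / δ * |deriv Real.smoothTransition ((ρ ^ 2 - s) / δ)|) := by ring
        _ ≤ _ := by gcongr
    linarith

/-- truncated radial function centred at `p` -/
def kr {d : ℕ} (n : ℕ) (κ ρ δ : ℝ) (p x : Euc d) : ℝ := prof n κ ρ δ (‖x - p‖ ^ 2)

lemma kr_contDiff {d n : ℕ} (hn : 1 ≤ n) (κ ρ δ : ℝ) (p : Euc d) :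
    ContDiff ℝ (⊤ : ℕ∞) (kr n κ ρ δ p) :=
  (prof_contDiff hn κ ρ δ).comp ((contDiff_id.sub contDiff_const).norm_sq ℝ)

lemma kr_fderiv {d n : ℕ} (hn : 1 ≤ n) (κ ρ δ : ℝ) (p x : Euc d) :
    fderiv ℝ (kr n κ ρ δ p) x = (prof1 n κ ρ δ (‖x - p‖ ^ 2)) • ((2:ℝ) • innerSL ℝ (x - p)) := by
  have h1 : HasFDerivAt (fun x : Euc d => ‖x - p‖ ^ 2) ((2:ℝ) • innerSL ℝ (x - p)) x := by
    have := (hasStrictFDerivAt_norm_sq (x - p)).hasFDerivAt.comp x ((hasFDerivAt_id x).sub_const p)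
    refine this.congr_fderiv ?_
    ext y
    simp [two_smul]
    try ring
  exact ((prof_hasDerivAt hn κ ρ δ (‖x - p‖ ^ 2)).comp_hasFDerivAt x h1).fderiv

lemma kr_fderiv_norm {d n : ℕ} (hn : 1 ≤ n) (κ ρ δ : ℝ) (p x : Euc d) :
    ‖fderiv ℝ (kr n κ ρ δ p) x‖ ^ 2 = (prof1 n κ ρ δ (‖x - p‖ ^ 2) * (2 * ‖x - p‖)) ^ 2 := by
  rw [kr_fderiv hn, norm_smul, norm_smul, innerSL_apply_norm, Real.norm_eq_abs, mul_pow, sq_abs, mul_pow]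
  simp
  ring

lemma kr_base {n : ℕ} (hn : 1 ≤ n) {Ω : Set (Euc (n+1))} (hΩ : IsConvexDomain Ω)
    {p : Euc (n+1)} (hp : p ∈ Ω) {κ ρ : ℝ} (hρ : 0 < ρ) (hκ : 0 ≤ κ) (hκρ : κ * ρ = bj n) :
    ∫ x in Ω ∩ Metric.ball p ρ, (bf1 n κ ‖x - p‖) ^ 2 ≤
      κ ^ 2 * ∫ x in Ω ∩ Metric.ball p ρ, (bf n κ ‖x - p‖) ^ 2 := by
  obtain ⟨-, ho, hb, hcv⟩ := hΩ
  have hbB : Bornology.IsBounded (Ω ∩ Metric.ball p ρ) := hb.subset Set.inter_subset_left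
  have c0 := bf_continuous hn κ
  have c1 := bf1_continuous hn κ
  have i0 : IntegrableOn (fun x => (bf n κ ‖x - p‖) ^ 2) (Ω ∩ Metric.ball p ρ) :=
    cont_integrableOn hbB (by fun_prop)
  have i1 : IntegrableOn (fun x => (bf1 n κ ‖x - p‖) ^ 2) (Ω ∩ Metric.ball p ρ) :=
    cont_integrableOn hbB (by fun_prop)
  rw [← integral_const_mul, ← sub_nonneg, ← integral_sub (i0.const_mul _) i1]
  have hm : MeasurableSet (Ω ∩ Metric.ball p ρ) := ho.measurableSet.inter measurableSet_ball
  rw [← integral_indicator hm]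
  set K : Set (Euc (n+1)) := (fun y => y + p) ⁻¹' (Ω ∩ Metric.ball p ρ)
  have key : 0 ≤ ∫ x, K.indicator (fun x => (fun r => κ ^ 2 * (bf n κ r) ^ 2 - (bf1 n κ r) ^ 2) ‖x‖) x := by
    refine star_energy (K := K) (ρ := ρ) (c := fun r => κ ^ 2 * (bf n κ r) ^ 2 - (bf1 n κ r) ^ 2)
      ?_ ?_ ?_ ?_
    · exact (hcv.inter (convex_ball p ρ)).translate_preimage_left p
    · simp [K, hp, hρ]
    · intro x hx
      have := hx.2
      simp at this
      exact this.le
    · intro R hR hRρ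
      have := radial_energy hn hκ hR (by rw [← hκρ]; gcongr)
      have e : ∀ r, r ^ n * (κ ^ 2 * (bf n κ r) ^ 2 - (bf1 n κ r) ^ 2) =
          κ ^ 2 * (r ^ n * (bf n κ r) ^ 2) - r ^ n * (bf1 n κ r) ^ 2 := fun r => by ring
      simp only [e]
      rw [intervalIntegral.integral_sub, intervalIntegral.integral_const_mul]
      · linarith
      · apply Continuous.intervalIntegrable; fun_prop
      · apply Continuous.intervalIntegrable; fun_prop
  rw [← integral_add_right_eq_self _ p]
  refine key.trans_eq (integral_congr_ae (ae_of_all _ fun y => ?_))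
  symm
  by_cases hy : y + p ∈ Ω ∩ Metric.ball p ρ
  · simp only []
    rw [Set.indicator_of_mem hy, Set.indicator_of_mem (show y ∈ K from hy)]
    simp
  · simp only []
    rw [Set.indicator_of_notMem hy, Set.indicator_of_notMem (show y ∉ K from hy)]

lemma dk_tendsto : Tendsto (fun k : ℕ => (1:ℝ) / (k + 1)) atTop (nhds 0) :=
  tendsto_one_div_add_atTop_nhds_zero_nat

lemma kr_eventually {n : ℕ} (hn : 1 ≤ n) {Ω : Set (Euc (n+1))} (hΩ : IsConvexDomain Ω)
    {p : Euc (n+1)} (hp : p ∈ Ω) {κ ρ η : ℝ} (hρ : 0 < ρ) (hκ : 0 ≤ κ) (hκρ : κ * ρ = bj n)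
    (hη : 0 < η) :
    ∀ᶠ k : ℕ in atTop, (∫ x in Ω, ‖fderiv ℝ (kr n κ ρ (1 / ((k:ℝ) + 1)) p) x‖ ^ 2 ≤
      (κ ^ 2 + η) * ∫ x in Ω, (kr n κ ρ (1 / ((k:ℝ) + 1)) p x) ^ 2) ∧
      0 < kr n κ ρ (1 / ((k:ℝ) + 1)) p p := by
  have hbase := kr_base hn hΩ hp hρ hκ hκρ
  obtain ⟨-, ho, hb, hcv⟩ := hΩ
  have c0 := bf_continuous hn κ
  have c1 := bf1_continuous hn κ
  have hm : MeasurableSet (Metric.ball p ρ) := measurableSet_ball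
  obtain ⟨B, hB⟩ := hb.exists_norm_le
  set M := (B + ‖p‖ + ρ) ^ 2
  have hB0 : 0 ≤ B := (norm_nonneg _).trans (hB p hp)
  have hxB : ∀ x ∈ Ω, ‖x - p‖ ≤ B + ‖p‖ + ρ := fun x hx => by
    have := norm_sub_le x p
    have := hB x hx
    linarith
  have hxM : ∀ x ∈ Ω, ‖x - p‖ ^ 2 ≤ M := fun x hx => by
    have := hxB x hx
    exact pow_le_pow_left₀ (norm_nonneg _) this 2
  have hz : bg (bnu n) (κ ^ 2 * ρ ^ 2) = 0 := by
    have := (bj_spec hn).2.1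
    rw [← hκρ] at this
    simpa [bf, mul_pow] using this
  obtain ⟨C, hC0, hC⟩ := prof_bound (M := M) hn (by
    have : 0 ≤ B + ‖p‖ := by positivity
    show ρ ^ 2 ≤ (B + ‖p‖ + ρ) ^ 2
    gcongr; linarith) hz
  have hδ : ∀ k : ℕ, (0:ℝ) < 1 / ((k:ℝ) + 1) := fun k => by positivity
  have hvol : volume Ω ≠ ⊤ := hb.measure_lt_top.ne
  -- pointwise convergence
  have pt : ∀ x : Euc (n+1), ∀ᶠ k : ℕ in atTop,
      kr n κ ρ (1 / ((k:ℝ) + 1)) p x ^ 2 =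
        (Metric.ball p ρ).indicator (fun x => (bf n κ ‖x - p‖) ^ 2) x ∧
      ‖fderiv ℝ (kr n κ ρ (1 / ((k:ℝ) + 1)) p) x‖ ^ 2 =
        (Metric.ball p ρ).indicator (fun x => (bf1 n κ ‖x - p‖) ^ 2) x := by
    intro x
    by_cases hx : x ∈ Metric.ball p ρ
    · have hx' : ‖x - p‖ < ρ := by simpa [dist_eq_norm] using hx
      have hpos : 0 < ρ ^ 2 - ‖x - p‖ ^ 2 := by
        have := norm_nonneg (x - p)
        nlinarith
      filter_upwards [dk_tendsto.eventually_le_const hpos] with k hk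
      obtain ⟨h1, h2⟩ := prof_eq (n := n) (κ := κ) (hδ k) hk
      rw [Set.indicator_of_mem hx, Set.indicator_of_mem hx, kr_fderiv_norm hn, kr, h1, h2]
      simp only [bf, bf1, mul_pow]
      constructor
      · trivial
      · ring
    · have hx' : ρ ≤ ‖x - p‖ := by simpa [dist_eq_norm] using hx
      filter_upwards with k
      obtain ⟨h1, h2⟩ := prof_zero (n := n) (κ := κ) (hδ k) (show ρ ^ 2 ≤ ‖x - p‖ ^ 2 by gcongr)
      rw [Set.indicator_of_notMem hx, Set.indicator_of_notMem hx, kr_fderiv_norm hn, kr, h1, h2]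
      simp
  have lim0 : Tendsto (fun k : ℕ => ∫ x in Ω, (kr n κ ρ (1 / ((k:ℝ) + 1)) p x) ^ 2) atTop
      (nhds (∫ x in Ω, (Metric.ball p ρ).indicator (fun x => (bf n κ ‖x - p‖) ^ 2) x)) := by
    apply tendsto_integral_of_dominated_convergence (fun _ => C ^ 2)
    · intro k
      exact ((kr_contDiff hn κ ρ _ p).continuous.pow 2).aestronglyMeasurable
    · exact integrableOn_const hvol
    · intro k
      rw [ae_restrict_iff' ho.measurableSet]
      refine ae_of_all _ fun x hx => ?_
      rw [Real.norm_eq_abs, abs_pow]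
      have := (hC _ _ (hδ k) (sq_nonneg ‖x - p‖) (hxM x hx)).1
      unfold kr
      gcongr
    · refine ae_of_all _ fun x => ?_
      apply tendsto_const_nhds.congr'
      filter_upwards [pt x] with k hk using hk.1.symm
  have lim1 : Tendsto (fun k : ℕ => ∫ x in Ω, ‖fderiv ℝ (kr n κ ρ (1 / ((k:ℝ) + 1)) p) x‖ ^ 2) atTop
      (nhds (∫ x in Ω, (Metric.ball p ρ).indicator (fun x => (bf1 n κ ‖x - p‖) ^ 2) x)) := by
    apply tendsto_integral_of_dominated_convergence (fun _ => (C * (2 * (B + ‖p‖ + ρ))) ^ 2)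
    · intro k
      exact ((smooth_fderiv_cont (kr_contDiff hn κ ρ _ p)).norm.pow 2).aestronglyMeasurable
    · exact integrableOn_const hvol
    · intro k
      rw [ae_restrict_iff' ho.measurableSet]
      refine ae_of_all _ fun x hx => ?_
      rw [kr_fderiv_norm hn, Real.norm_eq_abs, abs_pow, abs_mul]
      have h1 := (hC _ _ (hδ k) (sq_nonneg ‖x - p‖) (hxM x hx)).2
      have h2 := hxB x hx
      have h3 : |2 * ‖x - p‖| ≤ 2 * (B + ‖p‖ + ρ) := by
        rw [abs_of_nonneg (by positivity)]; linarith
      gcongr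
    · refine ae_of_all _ fun x => ?_
      apply tendsto_const_nhds.congr'
      filter_upwards [pt x] with k hk using hk.2.symm
  rw [setIntegral_indicator hm] at lim0 lim1
  have hM : 0 < ∫ x in Ω ∩ Metric.ball p ρ, (bf n κ ‖x - p‖) ^ 2 := by
    refine integral_sq_pos (x := p) (ho.inter Metric.isOpen_ball) (hb.subset Set.inter_subset_left)
      (by fun_prop) ⟨hp, by simpa using hρ⟩ ?_
    have := (bj_spec hn).2.2 0 le_rfl (bj_spec hn).1
    rw [bf_scale]; simpa using this.ne'
  have hlt : (∫ x in Ω ∩ Metric.ball p ρ, (bf1 n κ ‖x - p‖) ^ 2) <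
      (κ ^ 2 + η) * ∫ x in Ω ∩ Metric.ball p ρ, (bf n κ ‖x - p‖) ^ 2 := by nlinarith
  have hpp : ∀ᶠ k : ℕ in atTop, 0 < kr n κ ρ (1 / ((k:ℝ) + 1)) p p := by
    filter_upwards [dk_tendsto.eventually_le_const (show 0 < ρ ^ 2 by positivity)] with k hk
    obtain ⟨h1, -⟩ := prof_eq (n := n) (κ := κ) (s := ‖p - p‖ ^ 2) (hδ k) (by simpa using hk)
    rw [kr, h1]
    have := (bj_spec hn).2.2 0 le_rfl (bj_spec hn).1
    simpa [bf] using this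
  filter_upwards [lim1.eventually_lt (lim0.const_mul _) hlt, hpp] with k hk hk2 using ⟨hk.le, hk2⟩

lemma kr_zero {d n : ℕ} (hn : 1 ≤ n) {κ ρ δ : ℝ} (hδ : 0 < δ) {p x : Euc d} (hρ : 0 ≤ ρ)
    (h : ρ ≤ ‖x - p‖) :
    kr n κ ρ δ p x = 0 ∧ fderiv ℝ (kr n κ ρ δ p) x = 0 := by
  obtain ⟨h1, h2⟩ := prof_zero (n := n) (κ := κ) hδ (show ρ ^ 2 ≤ ‖x - p‖ ^ 2 by gcongr)
  rw [kr_fderiv hn, kr, h1, h2]; simp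

theorem kroger_pair {n : ℕ} (hn : 1 ≤ n) {Ω : Set (Euc (n+1))} (hΩ : IsConvexDomain Ω)
    {p q : Euc (n+1)} (hp : p ∈ Ω) (hq : q ∈ Ω) (hpq : p ≠ q) :
    neumannEigenvalue 1 Ω ≤ 4 * bj n ^ 2 / dist p q ^ 2 := by
  have hD : 0 < dist p q := dist_pos.mpr hpq
  set ρ := dist p q / 2 with hρd
  have hρ : 0 < ρ := by positivity
  set κ := bj n / ρ with hκd
  have hκρ : κ * ρ = bj n := by rw [hκd]; field_simp
  have hκ : 0 ≤ κ := div_nonneg (bj_spec hn).1.le hρ.le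
  have e : 4 * bj n ^ 2 / dist p q ^ 2 = κ ^ 2 := by
    rw [hκd, hρd]; field_simp; norm_num; ring
  rw [e]
  apply le_of_forall_pos_le_add
  intro η hη
  obtain ⟨k, ⟨hk1, hk2⟩, hk3, hk4⟩ :=
    ((kr_eventually hn hΩ hp hρ hκ hκρ hη).and (kr_eventually hn hΩ hq hρ hκ hκρ hη)).exists
  set δ : ℝ := 1 / ((k:ℝ) + 1)
  have hδ : 0 < δ := by positivity
  have hdis : ∀ x, ρ ≤ ‖x - p‖ ∨ ρ ≤ ‖x - q‖ := by
    intro x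
    by_contra! h
    have : dist p q ≤ ‖x - p‖ + ‖x - q‖ := by
      rw [← dist_eq_norm, ← dist_eq_norm, dist_comm x p]; exact dist_triangle p x q
    linarith [h.1, h.2]
  obtain ⟨-, ho, hb, -⟩ := hΩ
  have su := kr_contDiff (d := n+1) hn κ ρ δ p
  have sv := kr_contDiff (d := n+1) hn κ ρ δ q
  have dpq : ρ ≤ ‖p - q‖ := by rw [← dist_eq_norm]; linarith
  have dqp : ρ ≤ ‖q - p‖ := by rw [← dist_eq_norm, dist_comm]; linarith
  refine ne_upper su sv (by positivity) ?_ ?_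
  · intro a b hab
    have h1 := hab p hp
    have h2 := hab q hq
    rw [(kr_zero hn hδ hρ.le dpq).1] at h1
    rw [(kr_zero hn hδ hρ.le dqp).1] at h2
    simp [hk2.ne', hk4.ne'] at h1 h2
    exact ⟨h1, h2⟩
  · intro a b
    have e1 : ∀ x, ‖a • fderiv ℝ (kr n κ ρ δ p) x + b • fderiv ℝ (kr n κ ρ δ q) x‖ ^ 2 =
        a ^ 2 * ‖fderiv ℝ (kr n κ ρ δ p) x‖ ^ 2 + b ^ 2 * ‖fderiv ℝ (kr n κ ρ δ q) x‖ ^ 2 := by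
      intro x
      rcases hdis x with h | h
      · rw [(kr_zero hn hδ hρ.le h).2]; simp [norm_smul, mul_pow]
      · rw [(kr_zero hn hδ hρ.le h).2]; simp [norm_smul, mul_pow]
    have e2 : ∀ x, (a * kr n κ ρ δ p x + b * kr n κ ρ δ q x) ^ 2 =
        a ^ 2 * kr n κ ρ δ p x ^ 2 + b ^ 2 * kr n κ ρ δ q x ^ 2 := by
      intro x
      rcases hdis x with h | h
      · rw [(kr_zero hn hδ hρ.le h).1]; simp [mul_pow]
      · rw [(kr_zero hn hδ hρ.le h).1]; simp [mul_pow]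
    simp only [e1, e2]
    rw [integral_add, integral_add, integral_const_mul, integral_const_mul, integral_const_mul, integral_const_mul]
    · nlinarith [sq_nonneg a, sq_nonneg b]
    · exact (cont_integrableOn hb (su.continuous.pow 2)).const_mul _
    · exact (cont_integrableOn hb (sv.continuous.pow 2)).const_mul _
    · exact (smooth_grad_int hb su).const_mul _
    · exact (smooth_grad_int hb sv).const_mul _

/-! ### Prekopa-Leindler (midpoint version) -/

lemma midset_compact {A B C : Set ℝ} (hA : IsCompact A) (hB : IsCompact B)
    (hAn : A.Nonempty) (hBn : B.Nonempty) (h : ∀ a ∈ A, ∀ b ∈ B, (a + b) / 2 ∈ C) :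
    volume A + volume B ≤ 2 * volume C := by
  have h0 : volume ((fun c : ℝ => 2 * c) '' C) = 2 * volume C := by
    have := Measure.addHaar_smul (volume : Measure ℝ) 2 C
    rw [← Set.image_smul] at this
    simpa using this
  rw [← h0]
  obtain ⟨α, hα, hαm⟩ := hA.exists_isGreatest hAn
  obtain ⟨β, hβ, hβm⟩ := hB.exists_isLeast hBn
  have e1 : volume A = volume ((fun x => x + β) '' A) := by
    simp [Set.image_add_right]
  have e2 : volume B = volume ((fun x => α + x) '' B) := by
    simp [Set.image_add_left]
  have hm1 : MeasurableSet ((fun x => α + x) '' B) :=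
    (hB.image (by fun_prop)).measurableSet
  rw [e1, e2, ← measure_union₀ hm1.nullMeasurableSet]
  · apply measure_mono
    rintro z (⟨a, ha, rfl⟩ | ⟨b, hb, rfl⟩)
    · exact ⟨_, h a ha β hβ, by ring⟩
    · exact ⟨_, h α hα b hb, by ring⟩
  · refine measure_mono_null (t := {α + β}) ?_ (by simp)
    rintro z ⟨⟨a, ha, rfl⟩, ⟨b, hb, hb2⟩⟩
    have h1 : a ≤ α := hαm ha
    have h2 : β ≤ b := hβm hb
    simp at hb2 ⊢
    linarith

lemma midset {A B C : Set ℝ} (hA : MeasurableSet A) (hB : MeasurableSet B)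
    (hAn : A.Nonempty) (hBn : B.Nonempty) (h : ∀ a ∈ A, ∀ b ∈ B, (a + b) / 2 ∈ C) :
    volume A + volume B ≤ 2 * volume C := by
  obtain ⟨a, ha⟩ := hAn
  obtain ⟨b, hb⟩ := hBn
  rw [hA.measure_eq_iSup_isCompact, hB.measure_eq_iSup_isCompact]
  have key : ∀ K ⊆ A, IsCompact K → ∀ L ⊆ B, IsCompact L → volume K + volume L ≤ 2 * volume C := by
    intro K hKA hK L hLB hL
    have := midset_compact (A := insert a K) (B := insert b L) (C := C) (hK.insert a) (hL.insert b)
      ⟨a, by simp⟩ ⟨b, by simp⟩ (by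
        intro x hx y hy
        exact h x (Set.insert_subset ha hKA hx) y (Set.insert_subset hb hLB hy))
    refine le_trans (add_le_add (measure_mono ?_) (measure_mono ?_)) this <;> simp
  simp only [iSup_and']
  refine ENNReal.biSup_add_biSup_le' ⟨∅, by simp⟩ ⟨∅, by simp⟩ ?_
  rintro K ⟨hK1, hK2⟩ L ⟨hL1, hL2⟩
  exact key K hK1 hK2 L hL1 hL2

lemma enn_amgm (x y : ENNReal) : 4 * (x * y) ≤ (x + y) ^ 2 := by
  rcases le_total x y with h | h
  · obtain ⟨z, rfl⟩ := exists_add_of_le h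
    have : (x + (x + z)) ^ 2 = 4 * (x * (x + z)) + z ^ 2 := by ring
    rw [this]; exact le_self_add
  · obtain ⟨z, rfl⟩ := exists_add_of_le h
    have : (y + z + y) ^ 2 = 4 * ((y + z) * y) + z ^ 2 := by ring
    rw [this]; exact le_self_add

lemma pl_norm {f g h : ℝ → ℝ} (hf : Measurable f) (hg : Measurable g) (hh : Measurable h)
    (f0 : ∀ x, 0 ≤ f x) (g0 : ∀ x, 0 ≤ g x) (h0 : ∀ x, 0 ≤ h x)
    (f1 : ∀ x, f x ≤ 1) (g1 : ∀ x, g x ≤ 1)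
    (fs : ∀ t < 1, ∃ x, t < f x) (gs : ∀ t < 1, ∃ x, t < g x)
    (H : ∀ x y, f x * g y ≤ h ((x + y) / 2) ^ 2) :
    (∫⁻ x, ENNReal.ofReal (f x)) + (∫⁻ x, ENNReal.ofReal (g x)) ≤ 2 * ∫⁻ x, ENNReal.ofReal (h x) := by
  rw [lintegral_eq_lintegral_meas_lt volume (ae_of_all _ f0) hf.aemeasurable,
    lintegral_eq_lintegral_meas_lt volume (ae_of_all _ g0) hg.aemeasurable,
    lintegral_eq_lintegral_meas_lt volume (ae_of_all _ h0) hh.aemeasurable]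
  have mm : ∀ k : ℝ → ℝ, Measurable fun t : ℝ => volume {a | t < k a} := fun k =>
    Antitone.measurable fun s t hst => measure_mono fun x hx => lt_of_le_of_lt hst hx
  rw [← lintegral_add_left (mm f), ← lintegral_const_mul _ (mm h)]
  refine setLIntegral_mono (by exact (mm h).const_mul 2) ?_
  intro t ht
  rcases lt_or_ge t 1 with h1 | h1
  · apply midset (measurableSet_lt measurable_const hf) (measurableSet_lt measurable_const hg) (fs t h1) (gs t h1)
    intro a ha b hb
    have ht0 : 0 < t := ht
    have ha' : t < f a := ha
    have hb' : t < g b := hb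
    have : t ^ 2 < h ((a + b) / 2) ^ 2 := by
      refine lt_of_lt_of_le ?_ (H a b)
      nlinarith
    exact lt_of_pow_lt_pow_left₀ 2 (h0 _) this
  · have e1 : {a | t < f a} = ∅ := by
      ext x; simp; exact (f1 x).trans h1
    have e2 : {a | t < g a} = ∅ := by
      ext x; simp; exact (g1 x).trans h1
    simp [e1, e2]

lemma pl_bdd {f g h : ℝ → ℝ} (hf : Measurable f) (hg : Measurable g) (hh : Measurable h)
    (f0 : ∀ x, 0 ≤ f x) (g0 : ∀ x, 0 ≤ g x) (h0 : ∀ x, 0 ≤ h x)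
    (fb : BddAbove (Set.range f)) (gb : BddAbove (Set.range g))
    (H : ∀ x y, f x * g y ≤ h ((x + y) / 2) ^ 2) :
    (∫⁻ x, ENNReal.ofReal (f x)) * (∫⁻ x, ENNReal.ofReal (g x)) ≤ (∫⁻ x, ENNReal.ofReal (h x)) ^ 2 := by
  set a := ⨆ x, f x
  set b := ⨆ x, g x
  have hfa : ∀ x, f x ≤ a := fun x => le_ciSup fb x
  have hgb : ∀ x, g x ≤ b := fun x => le_ciSup gb x
  rcases eq_or_lt_of_le ((f0 0).trans (hfa 0)) with ha | ha
  · have : ∀ x, f x = 0 := fun x => le_antisymm (ha ▸ hfa x) (f0 x)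
    simp [this]
  rcases eq_or_lt_of_le ((g0 0).trans (hgb 0)) with hb | hb
  · have : ∀ x, g x = 0 := fun x => le_antisymm (hb ▸ hgb x) (g0 x)
    simp [this]
  set c := √(a * b)
  have hc : 0 < c := Real.sqrt_pos.mpr (by positivity)
  have hc2 : c ^ 2 = a * b := Real.sq_sqrt (by positivity)
  have key := pl_norm (f := fun x => f x / a) (g := fun x => g x / b) (h := fun x => h x / c)
    (hf.div_const _) (hg.div_const _) (hh.div_const _)
    (fun x => div_nonneg (f0 x) ha.le) (fun x => div_nonneg (g0 x) hb.le) (fun x => div_nonneg (h0 x) hc.le)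
    (fun x => (div_le_one ha).mpr (hfa x)) (fun x => (div_le_one hb).mpr (hgb x))
    (fun t ht => by
      obtain ⟨x, hx⟩ := exists_lt_of_lt_ciSup (show t * a < ⨆ x, f x by
        show t * a < a
        nlinarith)
      exact ⟨x, (lt_div_iff₀ ha).mpr hx⟩)
    (fun t ht => by
      obtain ⟨x, hx⟩ := exists_lt_of_lt_ciSup (show t * b < ⨆ x, g x by
        show t * b < b
        nlinarith)
      exact ⟨x, (lt_div_iff₀ hb).mpr hx⟩)
    (fun x y => by
      rw [div_pow, hc2, div_mul_div_comm]
      have := H x y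
      gcongr)
  have e : ∀ (k : ℝ → ℝ) (r : ℝ), 0 < r → Measurable k → ∫⁻ x, ENNReal.ofReal (k x) =
      ENNReal.ofReal r * ∫⁻ x, ENNReal.ofReal (k x / r) := by
    intro k r hr hk
    rw [← lintegral_const_mul _ (by fun_prop)]
    congr 1; ext x
    rw [← ENNReal.ofReal_mul hr.le]
    congr 1; field_simp
  rw [e f a ha hf, e g b hb hg, e h c hc hh]
  set P := ∫⁻ x, ENNReal.ofReal (f x / a)
  set Q := ∫⁻ x, ENNReal.ofReal (g x / b)
  set R := ∫⁻ x, ENNReal.ofReal (h x / c)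
  have h4 : P * Q ≤ R ^ 2 := by
    have h5 : 4 * (P * Q) ≤ 4 * R ^ 2 := by
      calc 4 * (P * Q) ≤ (P + Q) ^ 2 := enn_amgm _ _
        _ ≤ (2 * R) ^ 2 := by gcongr
        _ = 4 * R ^ 2 := by ring
    rwa [ENNReal.mul_le_mul_iff_right (by simp) (by simp)] at h5
  calc _ = ENNReal.ofReal (a * b) * (P * Q) := by rw [ENNReal.ofReal_mul ha.le]; ring
    _ ≤ ENNReal.ofReal (a * b) * R ^ 2 := by gcongr
    _ = _ := by rw [← hc2, ENNReal.ofReal_pow hc.le]; ring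

lemma pl_one {f g h : ℝ → ENNReal} (hf : Measurable f) (hg : Measurable g) (hh : Measurable h)
    (H : ∀ x y, f x * g y ≤ h ((x + y) / 2) ^ 2) :
    (∫⁻ x, f x) * (∫⁻ x, g x) ≤ (∫⁻ x, h x) ^ 2 := by
  have trunc : ∀ k : ℝ → ENNReal, Measurable k → ∫⁻ x, k x = ⨆ N : ℕ, ∫⁻ x, min (k x) N := by
    intro k hk
    rw [← lintegral_iSup (fun n => hk.min measurable_const)]
    · congr 1; ext x
      rw [← inf_iSup_eq, ENNReal.iSup_natCast, inf_top_eq]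
    · intro m n hmn x
      show min (k x) (m : ENNReal) ≤ min (k x) (n : ENNReal)
      gcongr
  rw [trunc f hf, trunc g hg, ENNReal.iSup_mul]
  refine iSup_le fun N => ?_
  rw [ENNReal.mul_iSup]
  refine iSup_le fun M => ?_
  have fin : ∀ (k : ℝ → ENNReal) (N : ℕ) x, min (k x) (N:ENNReal) ≠ ⊤ := fun k N x =>
    ne_top_of_le_ne_top (ENNReal.natCast_ne_top N) (min_le_right _ _)
  have bd : ∀ (k : ℝ → ENNReal) (N : ℕ) x, (min (k x) (N:ENNReal)).toReal ≤ N := fun k N x => by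
    have := ENNReal.toReal_mono (ENNReal.natCast_ne_top N) (min_le_right (k x) (N:ENNReal))
    simpa using this
  have key := pl_bdd (f := fun x => (min (f x) (N:ENNReal)).toReal) (g := fun x => (min (g x) (M:ENNReal)).toReal)
    (h := fun x => (min (h x) ((N + M : ℕ):ENNReal)).toReal)
    (hf.min measurable_const).ennreal_toReal (hg.min measurable_const).ennreal_toReal
    (hh.min measurable_const).ennreal_toReal (fun x => ENNReal.toReal_nonneg) (fun x => ENNReal.toReal_nonneg)
    (fun x => ENNReal.toReal_nonneg) ⟨N, by rintro _ ⟨x, rfl⟩; exact bd _ _ _⟩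
    ⟨M, by rintro _ ⟨x, rfl⟩; exact bd _ _ _⟩ (by
      intro x y
      rw [← ENNReal.toReal_mul, ← ENNReal.toReal_pow]
      refine ENNReal.toReal_mono (ENNReal.pow_ne_top (fin _ _ _)) ?_
      rcases le_total (h ((x + y) / 2)) ((N + M : ℕ):ENNReal) with hc | hc
      · rw [min_eq_left hc]
        exact (mul_le_mul' (min_le_left _ _) (min_le_left _ _)).trans (H x y)
      · rw [min_eq_right hc, sq]
        refine mul_le_mul' ((min_le_right _ _).trans ?_) ((min_le_right _ _).trans ?_)
        · exact_mod_cast Nat.le_add_right _ _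
        · exact_mod_cast Nat.le_add_left _ _)
  simp only [ENNReal.ofReal_toReal (fin _ _ _)] at key
  refine key.trans ?_
  gcongr
  exact min_le_left _ _

lemma pl_pi (n : ℕ) {f g h : (Fin n → ℝ) → ENNReal} (hf : Measurable f) (hg : Measurable g) (hh : Measurable h)
    (H : ∀ x y, f x * g y ≤ h ((2⁻¹:ℝ) • (x + y)) ^ 2) :
    (∫⁻ x, f x) * (∫⁻ x, g x) ≤ (∫⁻ x, h x) ^ 2 := by
  induction n with
  | zero =>
    have e : ∀ k : (Fin 0 → ℝ) → ENNReal, ∫⁻ x, k x = k 0 := by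
      intro k
      rw [Measure.volume_pi_eq_dirac 0]
      simp
    rw [e, e, e]
    have := H 0 0
    simpa using this
  | succ n ih =>
    have mp := volume_preserving_piFinSuccAbove (fun _ : Fin (n + 1) => ℝ) 0
    have e : ∀ k : (Fin (n+1) → ℝ) → ENNReal, Measurable k →
        ∫⁻ x, k x = ∫⁻ s : ℝ, ∫⁻ y : Fin n → ℝ, k (Fin.cons s y) := by
      intro k hk
      rw [← mp.symm.lintegral_comp hk, Measure.volume_eq_prod, lintegral_prod]
      · refine lintegral_congr fun s => lintegral_congr fun y => ?_
        congr 1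
        simp [MeasurableEquiv.piFinSuccAbove, Fin.insertNthEquiv, Fin.insertNth_zero]
      · exact (hk.comp (MeasurableEquiv.measurable _)).aemeasurable
    have cm : Measurable fun z : ℝ × (Fin n → ℝ) => (Fin.cons z.1 z.2 : Fin (n+1) → ℝ) := by
      rw [measurable_pi_iff]
      intro i
      refine Fin.cases ?_ (fun j => ?_) i
      · simpa using measurable_fst
      · simp only [Fin.cons_succ]
        exact (measurable_pi_apply j).comp measurable_snd
    have cm2 : ∀ s : ℝ, Measurable fun y : (Fin n → ℝ) => (Fin.cons s y : Fin (n+1) → ℝ) := fun s =>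
      cm.comp (measurable_const.prodMk measurable_id)
    rw [e f hf, e g hg, e h hh]
    refine pl_one ?_ ?_ ?_ ?_
    · exact (hf.comp cm).lintegral_prod_right'
    · exact (hg.comp cm).lintegral_prod_right'
    · exact (hh.comp cm).lintegral_prod_right'
    · intro s t
      refine ih (hf.comp (cm2 s)) (hg.comp (cm2 t)) (hh.comp (cm2 _)) ?_
      intro x y
      have := H (Fin.cons s x) (Fin.cons t y)
      convert this using 3
      funext i
      refine Fin.cases ?_ (fun j => ?_) i
      · simp; ring
      · simp; ring

lemma pl_euc {n : ℕ} {f g h : Euc n → ENNReal} (hf : Measurable f) (hg : Measurable g) (hh : Measurable h)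
    (H : ∀ x y, f x * g y ≤ h ((2⁻¹:ℝ) • (x + y)) ^ 2) :
    (∫⁻ x, f x) * (∫⁻ x, g x) ≤ (∫⁻ x, h x) ^ 2 := by
  have mp := PiLp.volume_preserving_toLp (Fin n)
  rw [← mp.lintegral_comp hf, ← mp.lintegral_comp hg, ← mp.lintegral_comp hh]
  refine pl_pi n (hf.comp mp.measurable) (hg.comp mp.measurable) (hh.comp mp.measurable) ?_
  intro x y
  exact H _ _

/-! ### One-dimensional weighted Poincare inequality -/

lemma wp_dual {p p1 p2 : ℝ → ℝ} (hp : ∀ x, HasDerivAt p (p1 x) x) (hp1 : ∀ x, HasDerivAt p1 (p2 x) x)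
    (hp2 : Continuous p2) (pos : ∀ x, 0 < p x) (lc : ∀ x, p x * p2 x ≤ p1 x ^ 2)
    {a b κ : ℝ} (hab : a < b) (hκ : 0 < κ) (hκπ : κ * (b - a) < π) {F F1 : ℝ → ℝ}
    (hF : ∀ x, HasDerivAt F (F1 x) x) (hF1 : Continuous F1) (Fa : F a = 0) (Fb : F b = 0) :
    κ ^ 2 * ∫ x in a..b, F x ^ 2 * (p x)⁻¹ ≤ ∫ x in a..b, F1 x ^ 2 * (p x)⁻¹ := by
  have cp : Continuous p := continuous_iff_continuousAt.mpr fun x => (hp x).continuousAt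
  have cp1 : Continuous p1 := continuous_iff_continuousAt.mpr fun x => (hp1 x).continuousAt
  have cF : Continuous F := continuous_iff_continuousAt.mpr fun x => (hF x).continuousAt
  have cr : Continuous fun x => (p x)⁻¹ := cp.inv₀ fun x => (pos x).ne'
  set δ := (π / κ - (b - a)) / 2 with hδd
  have hδ : 0 < δ := by
    have : b - a < π / κ := by rw [lt_div_iff₀ hκ]; linarith
    rw [hδd]; linarith
  have hδ2 : κ * (b - a + δ) < π := by
    have : b - a + δ < π / κ := by
      have : b - a < π / κ := by rw [lt_div_iff₀ hκ]; linarith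
      rw [hδd]; linarith
    rwa [lt_div_iff₀ hκ, mul_comm] at this
  have hs : ∀ x ∈ Set.uIcc a b, 0 < sin (κ * (x - a + δ)) := by
    intro x hx
    rw [Set.uIcc_of_le hab.le] at hx
    apply sin_pos_of_pos_of_lt_pi
    · have := hx.1
      have : 0 < x - a + δ := by linarith
      positivity
    · refine lt_of_le_of_lt ?_ hδ2
      gcongr
      exact hx.2
  set T : ℝ → ℝ := fun x => κ * cos (κ * (x - a + δ)) / sin (κ * (x - a + δ)) with hT
  set H : ℝ → ℝ := fun x => (T x + p1 x * (p x)⁻¹ / 2) * (F x ^ 2 * (p x)⁻¹) with hH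
  set H1 : ℝ → ℝ := fun x => (-(κ ^ 2 + T x ^ 2) + (p2 x * (p x)⁻¹ + p1 x * (-(p1 x) * (p x)⁻¹ ^ 2)) / 2) * (F x ^ 2 * (p x)⁻¹)
    + (T x + p1 x * (p x)⁻¹ / 2) * (2 * F x * F1 x * (p x)⁻¹ + F x ^ 2 * (-(p1 x) * (p x)⁻¹ ^ 2)) with hH1
  have dT : ∀ x ∈ Set.uIcc a b, HasDerivAt T (-(κ ^ 2 + T x ^ 2)) x := by
    intro x hx
    have h0 := (hs x hx).ne'
    have hl : HasDerivAt (fun x => κ * (x - a + δ)) κ x := by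
      simpa using (((hasDerivAt_id x).sub_const a).add_const δ).const_mul κ
    have := ((hl.cos.const_mul κ)).div hl.sin h0
    refine this.congr_deriv ?_
    simp only [hT]
    have e := sin_sq_add_cos_sq (κ * (x - a + δ))
    field_simp
    linear_combination 0 * e
  have dr : ∀ x, HasDerivAt (fun x => (p x)⁻¹) (-(p1 x) * (p x)⁻¹ ^ 2) x := by
    intro x
    refine ((hp x).inv (pos x).ne').congr_deriv ?_
    field_simp
  have dH : ∀ x ∈ Set.uIcc a b, HasDerivAt H (H1 x) x := by
    intro x hx
    have := ((dT x hx).add (((hp1 x).mul (dr x)).div_const 2)).mul (((hF x).pow 2).mul (dr x))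
    refine this.congr_deriv ?_
    simp only [hH1]
    simp
  have cT : ContinuousOn T (Set.uIcc a b) := fun x hx => (dT x hx).continuousAt.continuousWithinAt
  have cH1 : ContinuousOn H1 (Set.uIcc a b) := by
    have := cr.continuousOn (s := Set.uIcc a b)
    have := cp1.continuousOn (s := Set.uIcc a b)
    have := hp2.continuousOn (s := Set.uIcc a b)
    have := cF.continuousOn (s := Set.uIcc a b)
    have := hF1.continuousOn (s := Set.uIcc a b)
    simp only [hH1]
    fun_prop
  have iH1 : IntervalIntegrable H1 volume a b := cH1.intervalIntegrable
  have ftc := intervalIntegral.integral_eq_sub_of_hasDerivAt dH iH1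
  have hHab : H b - H a = 0 := by simp [hH, Fa, Fb]
  rw [hHab] at ftc
  have i1 : IntervalIntegrable (fun x => F x ^ 2 * (p x)⁻¹) volume a b :=
    Continuous.intervalIntegrable (by fun_prop) _ _
  have i2 : IntervalIntegrable (fun x => F1 x ^ 2 * (p x)⁻¹) volume a b :=
    Continuous.intervalIntegrable (by fun_prop) _ _
  have main : ∫ x in a..b, (κ ^ 2 * (F x ^ 2 * (p x)⁻¹) + H1 x) ≤ ∫ x in a..b, F1 x ^ 2 * (p x)⁻¹ := by
    refine intervalIntegral.integral_mono_on hab.le ((i1.const_mul _).add iH1) i2 ?_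
    intro x hx
    have hr : 0 < (p x)⁻¹ := inv_pos.mpr (pos x)
    have hrp : p x * (p x)⁻¹ = 1 := mul_inv_cancel₀ (pos x).ne'
    simp only [hH1]
    have l2 : p2 x * (p x)⁻¹ ≤ p1 x ^ 2 * (p x)⁻¹ ^ 2 := by
      have := mul_le_mul_of_nonneg_right (lc x) (sq_nonneg (p x)⁻¹)
      calc p2 x * (p x)⁻¹ = p x * p2 x * (p x)⁻¹ ^ 2 := by
            linear_combination (-(p2 x) * (p x)⁻¹) * hrp
        _ ≤ _ := this
    generalize (p x)⁻¹ = r at *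
    have id : F1 x ^ 2 * r - (κ ^ 2 * (F x ^ 2 * r) + ((-(κ ^ 2 + T x ^ 2) + (p2 x * r + p1 x * (-(p1 x) * r ^ 2)) / 2) * (F x ^ 2 * r)
      + (T x + p1 x * r / 2) * (2 * F x * F1 x * r + F x ^ 2 * (-(p1 x) * r ^ 2))))
      = r * (F1 x - (T x + p1 x * r / 2) * F x) ^ 2 + F x ^ 2 * r * ((p1 x * r) ^ 2 / 4 + (p1 x ^ 2 * r ^ 2 - p2 x * r) / 2) := by
      ring
    have : 0 ≤ r * (F1 x - (T x + p1 x * r / 2) * F x) ^ 2 + F x ^ 2 * r * ((p1 x * r) ^ 2 / 4 + (p1 x ^ 2 * r ^ 2 - p2 x * r) / 2) := by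
      have : 0 ≤ p1 x ^ 2 * r ^ 2 - p2 x * r := by linarith
      positivity
    linarith
  rw [intervalIntegral.integral_add (i1.const_mul _) iH1, intervalIntegral.integral_const_mul, ftc] at main
  linarith

lemma wp_poincare {p p1 p2 : ℝ → ℝ} (hp : ∀ x, HasDerivAt p (p1 x) x) (hp1 : ∀ x, HasDerivAt p1 (p2 x) x)
    (hp2 : Continuous p2) (pos : ∀ x, 0 < p x) (lc : ∀ x, p x * p2 x ≤ p1 x ^ 2)
    {a b κ : ℝ} (hab : a < b) (hκ : 0 < κ) (hκπ : κ * (b - a) < π) {g g1 : ℝ → ℝ}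
    (hg : ∀ x, HasDerivAt g (g1 x) x) (hg1 : Continuous g1) :
    κ ^ 2 * ((∫ x in a..b, p x * g x ^ 2) * (∫ x in a..b, p x) - (∫ x in a..b, p x * g x) ^ 2)
      ≤ (∫ x in a..b, p x * g1 x ^ 2) * ∫ x in a..b, p x := by
  have cp : Continuous p := continuous_iff_continuousAt.mpr fun x => (hp x).continuousAt
  have cg : Continuous g := continuous_iff_continuousAt.mpr fun x => (hg x).continuousAt
  have cr : Continuous fun x => (p x)⁻¹ := cp.inv₀ fun x => (pos x).ne'
  have hP : 0 < ∫ x in a..b, p x :=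
    intervalIntegral.intervalIntegral_pos_of_pos (cp.intervalIntegrable _ _) pos hab
  set P := ∫ x in a..b, p x
  set m := (∫ x in a..b, p x * g x) / P with hm
  have hmP : ∫ x in a..b, p x * g x = m * P := by rw [hm]; field_simp
  set F : ℝ → ℝ := fun x => ∫ t in a..x, p t * (g t - m) with hF
  have cf : Continuous fun t => p t * (g t - m) := by fun_prop
  have dF : ∀ x, HasDerivAt F (p x * (g x - m)) x := fun x =>
    intervalIntegral.integral_hasDerivAt_right (cf.intervalIntegrable _ _)
      (cf.stronglyMeasurableAtFilter _ _) cf.continuousAt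
  have cF : Continuous F := continuous_iff_continuousAt.mpr fun x => (dF x).continuousAt
  have Fa : F a = 0 := by simp [hF]
  have Fb : F b = 0 := by
    simp only [hF, mul_sub]
    rw [intervalIntegral.integral_sub, intervalIntegral.integral_mul_const, hmP]
    · show m * P - P * m = 0
      ring
    · exact Continuous.intervalIntegrable (by fun_prop) _ _
    · exact Continuous.intervalIntegrable (by fun_prop) _ _
  have dual := wp_dual hp hp1 hp2 pos lc hab hκ hκπ dF cf Fa Fb
  have e1 : ∀ x, (p x * (g x - m)) ^ 2 * (p x)⁻¹ = p x * (g x - m) ^ 2 := fun x => by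
    have := (pos x).ne'
    field_simp
  simp only [e1] at dual
  set A := ∫ x in a..b, p x * (g x - m) ^ 2 with hA
  set B := ∫ x in a..b, F x ^ 2 * (p x)⁻¹ with hB
  set G := ∫ x in a..b, p x * g1 x ^ 2 with hG
  -- integration by parts
  have ibp : A = - ∫ x in a..b, g1 x * F x := by
    have := intervalIntegral.integral_mul_deriv_eq_deriv_mul (a := a) (b := b)
      (u := fun x => g x - m) (v := F) (u' := g1) (v' := fun x => p x * (g x - m))
      (fun x _ => (hg x).sub_const m) (fun x _ => dF x) (hg1.intervalIntegrable _ _) (cf.intervalIntegrable _ _)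
    rw [Fa, Fb] at this
    rw [hA]
    calc _ = ∫ x in a..b, (g x - m) * (p x * (g x - m)) := by
          congr 1; ext x; ring
      _ = _ := by rw [this]; ring
  have hAle : A ≤ 1 / (2 * κ ^ 2) * G + κ ^ 2 / 2 * B := by
    rw [ibp, ← intervalIntegral.integral_neg, hG, hB, ← intervalIntegral.integral_const_mul,
      ← intervalIntegral.integral_const_mul, ← intervalIntegral.integral_add]
    · refine intervalIntegral.integral_mono_on hab.le (Continuous.intervalIntegrable (by fun_prop) _ _)
        (Continuous.intervalIntegrable (by fun_prop) _ _) ?_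
      intro x _
      have hpx := pos x
      have : 1 / (2 * κ ^ 2) * (p x * g1 x ^ 2) + κ ^ 2 / 2 * (F x ^ 2 * (p x)⁻¹) - -(g1 x * F x)
          = (p x * g1 x + κ ^ 2 * F x) ^ 2 / (2 * κ ^ 2 * p x) := by
        field_simp; ring
      have : 0 ≤ (p x * g1 x + κ ^ 2 * F x) ^ 2 / (2 * κ ^ 2 * p x) := by positivity
      linarith
    · exact Continuous.intervalIntegrable (by fun_prop) _ _
    · exact Continuous.intervalIntegrable (by fun_prop) _ _
  have hfin : κ ^ 2 * A ≤ G := by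
    have h1 : A ≤ 1 / (2 * κ ^ 2) * G + A / 2 := by linarith
    have h2 : κ ^ 2 * A ≤ κ ^ 2 * (1 / (2 * κ ^ 2) * G + A / 2) := by gcongr
    have h3 : κ ^ 2 * (1 / (2 * κ ^ 2) * G + A / 2) = G / 2 + κ ^ 2 * A / 2 := by field_simp
    linarith
  have hAexp : A = (∫ x in a..b, p x * g x ^ 2) - m ^ 2 * P := by
    have : ∀ x, p x * (g x - m) ^ 2 = p x * g x ^ 2 - 2 * m * (p x * g x) + m ^ 2 * p x := fun x => by ring
    rw [hA]
    simp only [this]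
    rw [intervalIntegral.integral_add, intervalIntegral.integral_sub, intervalIntegral.integral_const_mul,
      intervalIntegral.integral_const_mul, hmP]
    · show _ - 2 * m * (m * P) + m ^ 2 * P = _
      ring
    all_goals exact Continuous.intervalIntegrable (by fun_prop) _ _
  rw [hmP]
  have h4 : κ ^ 2 * A * P ≤ G * P := by gcongr
  rw [hAexp] at h4
  nlinarith

/-! ### Smoothed marginals -/

/-- Gaussian kernel -/
def gk (c t : ℝ) : ℝ := c * ((√π)⁻¹ * exp (-1 * (c * t) ^ 2))

lemma gk_contDiff (c : ℝ) : ContDiff ℝ (⊤ : ℕ∞) (gk c) := by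
  unfold gk; fun_prop

lemma gk_pos {c : ℝ} (hc : 0 < c) (t : ℝ) : 0 < gk c t := by
  have := Real.pi_pos
  unfold gk; positivity

lemma gk_lc (c α β : ℝ) : gk c α * gk c β ≤ gk c ((α + β) / 2) ^ 2 := by
  have e : ∀ x y : ℝ, c * ((√π)⁻¹ * exp x) * (c * ((√π)⁻¹ * exp y)) = c ^ 2 * (√π)⁻¹ ^ 2 * exp (x + y) := by
    intro x y; rw [exp_add]; ring
  rw [sq (gk c _)]
  unfold gk
  rw [e, e]
  refine mul_le_mul_of_nonneg_left (exp_le_exp.mpr ?_) (by positivity)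
  nlinarith [sq_nonneg (c * (α - β))]

lemma gk_integral {c : ℝ} (hc : 0 < c) (τ : ℝ) :
    Integrable (fun s => gk c (s - τ)) ∧ ∫ s, gk c (s - τ) = 1 := by
  have h0 : Integrable (fun t : ℝ => (√π)⁻¹ * exp (-1 * t ^ 2)) :=
    (integrable_exp_neg_mul_sq one_pos).const_mul _
  have h1 : ∫ t : ℝ, (√π)⁻¹ * exp (-1 * t ^ 2) = 1 := by
    rw [integral_const_mul, integral_gaussian, div_one, inv_mul_cancel₀]
    exact (Real.sqrt_pos.mpr Real.pi_pos).ne'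
  constructor
  · exact ((h0.comp_mul_left' hc.ne').const_mul c).comp_sub_right τ
  · rw [integral_sub_right_eq_self (fun s => gk c s)]
    unfold gk
    rw [integral_const_mul, Measure.integral_comp_mul_left (fun t => (√π)⁻¹ * exp (-1 * t ^ 2)), h1,
      abs_of_pos (inv_pos.mpr hc)]
    simp [hc.ne']

lemma gk_peak {ψ : ℝ → ℝ} (hψ : Integrable ψ) {τ : ℝ} (hc : ContinuousAt ψ τ) :
    Tendsto (fun c : ℝ => ∫ s, gk c (s - τ) * ψ s) atTop (nhds (ψ τ)) := by
  have h := tendsto_integral_comp_smul_smul_of_integrable' (F := ℝ) (μ := volume)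
    (φ := fun t => (√π)⁻¹ * exp (-1 * t ^ 2)) (fun x => by positivity)
    (by simpa [gk] using (gk_integral one_pos 0).2)
    (by
      have h1 := (tendsto_rpow_abs_mul_exp_neg_mul_sq_cocompact (a := 1) one_pos 1)
      rw [Metric.cobounded_eq_cocompact]
      have h2 := h1.const_mul (√π)⁻¹
      simp only [mul_zero] at h2
      refine h2.congr fun x => ?_
      simp
      ring) hψ hc
  refine h.congr fun c => ?_
  congr 1
  ext s
  simp only [gk, Module.finrank_self, pow_one, smul_eq_mul]
  congr 5
  ring

lemma marg_hasDerivAt {d : ℕ} {K : Set (Euc d)} (hb : Bornology.IsBounded K) (hm : MeasurableSet K)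
    {X : Euc d → ℝ} (hX : Continuous X) {φ : ℝ → ℝ} (hφ : ContDiff ℝ (⊤ : ℕ∞) φ) (s : ℝ) :
    HasDerivAt (fun s => ∫ x in K, φ (s - X x)) (∫ x in K, deriv φ (s - X x)) s := by
  have c1 : Continuous (deriv φ) := hφ.continuous_deriv (by simp)
  obtain ⟨B, hB⟩ := hb.isCompact_closure.exists_bound_of_continuousOn hX.continuousOn
  obtain ⟨C, hC⟩ := (isCompact_Icc (a := s - 1 - B) (b := s + 1 + B)).exists_bound_of_continuousOn c1.continuousOn
  refine (hasDerivAt_integral_of_dominated_loc_of_deriv_le (F := fun s x => φ (s - X x))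
    (F' := fun s x => deriv φ (s - X x)) (bound := fun _ => C) (Metric.ball_mem_nhds s one_pos) ?_ ?_ ?_ ?_ ?_ ?_).2
  · refine Eventually.of_forall fun t => ?_
    exact Continuous.aestronglyMeasurable (hφ.continuous.comp (by fun_prop))
  · exact cont_integrableOn hb (hφ.continuous.comp (by fun_prop))
  · exact Continuous.aestronglyMeasurable (c1.comp (by fun_prop))
  · rw [ae_restrict_iff' hm]
    refine ae_of_all _ fun x hx t ht => hC _ ?_
    have h1 := hB x (subset_closure hx)
    rw [Real.norm_eq_abs, abs_le] at h1
    rw [Metric.mem_ball, Real.dist_eq, abs_lt] at ht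
    constructor <;> linarith [h1.1, h1.2, ht.1, ht.2]
  · exact integrableOn_const hb.measure_lt_top.ne
  · refine ae_of_all _ fun x t _ => ?_
    have := (hφ.differentiable (by simp) (t - X x)).hasDerivAt
    exact (this.comp t ((hasDerivAt_id t).sub_const (X x))).congr_deriv (by simp)

lemma lc_of_mid {p p1 p2 : ℝ → ℝ} (hp : ∀ x, HasDerivAt p (p1 x) x) (hp1 : ∀ x, HasDerivAt p1 (p2 x) x)
    (H : ∀ s t, p (s + t) * p (s - t) ≤ p s ^ 2) (s : ℝ) : p s * p2 s ≤ p1 s ^ 2 := by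
  by_contra! hcon
  set ψ : ℝ → ℝ := fun t => p (s + t) * p (s - t)
  set ψ1 : ℝ → ℝ := fun t => p1 (s + t) * p (s - t) - p (s + t) * p1 (s - t)
  have pl : ∀ (q q1 : ℝ → ℝ), (∀ x, HasDerivAt q (q1 x) x) → ∀ t, HasDerivAt (fun t => q (s + t)) (q1 (s + t)) t := by
    intro q q1 hq t
    exact ((hq (s + t)).comp t ((hasDerivAt_id t).const_add s)).congr_deriv (by simp)
  have mi : ∀ (q q1 : ℝ → ℝ), (∀ x, HasDerivAt q (q1 x) x) → ∀ t, HasDerivAt (fun t => q (s - t)) (-q1 (s - t)) t := by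
    intro q q1 hq t
    exact ((hq (s - t)).comp t ((hasDerivAt_id t).const_sub s)).congr_deriv (by simp)
  have d1 : ∀ t, HasDerivAt ψ (ψ1 t) t := by
    intro t
    refine ((pl p p1 hp t).mul (mi p p1 hp t)).congr_deriv ?_
    simp only [ψ1]; ring
  have d2 : HasDerivAt ψ1 (2 * (p s * p2 s - p1 s ^ 2)) 0 := by
    have := (((pl p1 p2 hp1 0).mul (mi p p1 hp 0)).sub ((pl p p1 hp 0).mul (mi p1 p2 hp1 0)))
    refine this.congr_deriv ?_
    simp; ring
  have e1 : deriv ψ = ψ1 := funext fun t => (d1 t).deriv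
  have hmin : IsLocalMin ψ 0 := by
    apply isLocalMin_of_deriv_deriv_pos
    · rw [e1, d2.deriv]; linarith
    · rw [e1]; simp [ψ1]; ring
    · exact (d1 0).continuousAt
  have heq : ψ =ᶠ[nhds 0] fun _ => ψ 0 := by
    filter_upwards [hmin] with t ht
    refine le_antisymm ?_ ht
    have := H s t
    simpa [ψ, sq] using this
  have h3 : ψ1 =ᶠ[nhds 0] fun _ => 0 := by
    have := heq.deriv
    rw [e1] at this
    simpa using this
  have h4 := h3.deriv_eq
  rw [d2.deriv] at h4
  simp at h4
  linarith

lemma marg_mid {d : ℕ} {K : Set (Euc d)} (hb : Bornology.IsBounded K) (hm : MeasurableSet K) (hK : Convex ℝ K)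
    (e : Euc d) {c : ℝ} (hc : 0 < c) (s t : ℝ) :
    (∫ x in K, gk c (s + t - inner ℝ e x)) * (∫ x in K, gk c (s - t - inner ℝ e x)) ≤
      (∫ x in K, gk c (s - inner ℝ e x)) ^ 2 := by
  have cg : ∀ s, Continuous fun x : Euc d => gk c (s - inner ℝ e x) := fun s =>
    (gk_contDiff c).continuous.comp (by fun_prop)
  have e1 : ∀ s, ENNReal.ofReal (∫ x in K, gk c (s - inner ℝ e x)) =
      ∫⁻ x, K.indicator (fun x => ENNReal.ofReal (gk c (s - inner ℝ e x))) x := by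
    intro s
    rw [lintegral_indicator hm, ofReal_integral_eq_lintegral_ofReal (cont_integrableOn hb (cg s))]
    exact ae_of_all _ fun x => (gk_pos hc _).le
  have n0 : ∀ s, 0 ≤ ∫ x in K, gk c (s - inner ℝ e x) := fun s =>
    integral_nonneg fun x => (gk_pos hc _).le
  rw [← ENNReal.ofReal_le_ofReal_iff (by positivity), ENNReal.ofReal_mul (n0 _), ENNReal.ofReal_pow (n0 _),
    e1, e1, e1]
  have ms : ∀ s, Measurable (K.indicator (fun x => ENNReal.ofReal (gk c (s - inner ℝ e x)))) := fun s =>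
    ((cg s).measurable.ennreal_ofReal).indicator hm
  refine pl_euc (ms _) (ms _) (ms _) ?_
  intro x y
  by_cases hx : x ∈ K
  · by_cases hy : y ∈ K
    · have hz : (2⁻¹:ℝ) • (x + y) ∈ K := by
        rw [smul_add]
        exact hK hx hy (by norm_num) (by norm_num) (by norm_num)
      rw [Set.indicator_of_mem hx, Set.indicator_of_mem hy, Set.indicator_of_mem hz,
        ← ENNReal.ofReal_mul (gk_pos hc _).le, ← ENNReal.ofReal_pow (gk_pos hc _).le]
      apply ENNReal.ofReal_le_ofReal
      refine (gk_lc _ _ _).trans_eq ?_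
      congr 2
      rw [inner_smul_right, inner_add_right]
      ring
    · simp [hy]
  · simp [hx]

lemma marg_limit {d : ℕ} {K : Set (Euc d)} (hb : Bornology.IsBounded K) (hm : MeasurableSet K)
    {X : Euc d → ℝ} (hX : Continuous X) {a b : ℝ} (hab : ∀ x ∈ K, X x ∈ Set.Ioo a b) (hlt : a < b)
    {ψ : ℝ → ℝ} (hψ : Continuous ψ) :
    Tendsto (fun c : ℝ => ∫ s in a..b, (∫ x in K, gk c (s - X x)) * ψ s) atTop
      (nhds (∫ x in K, ψ (X x))) := by
  obtain ⟨M, hM⟩ := (isCompact_Icc (a := a) (b := b)).exists_bound_of_continuousOn hψ.continuousOn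
  have hi : ∀ c, Continuous (gk c) := fun c => (gk_contDiff c).continuous
  have e1 : ∀ c : ℝ, ∫ s in a..b, (∫ x in K, gk c (s - X x)) * ψ s =
      ∫ x in K, ∫ s, gk c (s - X x) * (Set.Ioc a b).indicator ψ s := by
    intro c
    rw [intervalIntegral.integral_of_le hlt.le]
    have : ∀ x, ∫ s, gk c (s - X x) * (Set.Ioc a b).indicator ψ s = ∫ s in Set.Ioc a b, gk c (s - X x) * ψ s := by
      intro x
      rw [← integral_indicator measurableSet_Ioc]
      congr 1; ext s
      by_cases hs : s ∈ Set.Ioc a b <;> simp [hs]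
    simp only [this, ← integral_mul_const]
    rw [integral_integral_swap]
    have hc : Continuous (Function.uncurry fun (s : ℝ) (x : Euc d) => gk c (s - X x) * ψ s) := by
      have := hi c
      unfold Function.uncurry
      fun_prop
    rw [Measure.prod_restrict]
    have hcomp : IsCompact (Set.Icc a b ×ˢ closure K) := isCompact_Icc.prod hb.isCompact_closure
    exact (hc.continuousOn.integrableOn_compact hcomp).mono_set
      (Set.prod_mono Set.Ioc_subset_Icc_self subset_closure)
  simp only [e1]
  have hInteg : Integrable ((Set.Ioc a b).indicator ψ) := by
    rw [integrable_indicator_iff measurableSet_Ioc]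
    exact (hψ.continuousOn.integrableOn_compact isCompact_Icc).mono_set Set.Ioc_subset_Icc_self
  have hM0 : 0 ≤ M := (norm_nonneg _).trans (hM a ⟨le_rfl, hlt.le⟩)
  have hMi : ∀ s, |(Set.Ioc a b).indicator ψ s| ≤ M := by
    intro s
    by_cases hs : s ∈ Set.Ioc a b
    · rw [Set.indicator_of_mem hs]; exact hM s ⟨hs.1.le, hs.2⟩
    · rw [Set.indicator_of_notMem hs]; simpa using hM0
  apply tendsto_integral_filter_of_dominated_convergence (fun _ => M)
  · refine Eventually.of_forall fun c => ?_
    have : StronglyMeasurable (Function.uncurry fun (x : Euc d) (s : ℝ) => gk c (s - X x) * (Set.Ioc a b).indicator ψ s) := by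
      apply Measurable.stronglyMeasurable
      have := (hi c).measurable
      have h2 : Measurable ((Set.Ioc a b).indicator ψ) := hψ.measurable.indicator measurableSet_Ioc
      have h3 := hX.measurable
      unfold Function.uncurry
      fun_prop
    exact this.integral_prod_right.aestronglyMeasurable
  · filter_upwards [eventually_gt_atTop 0] with c hc
    refine ae_of_all _ fun x => ?_
    obtain ⟨g1, g2⟩ := gk_integral hc (X x)
    calc ‖∫ s, gk c (s - X x) * (Set.Ioc a b).indicator ψ s‖ ≤ ∫ s, gk c (s - X x) * M := by
          refine norm_integral_le_of_norm_le (g1.mul_const M) (ae_of_all _ fun s => ?_)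
          rw [norm_mul, Real.norm_eq_abs, Real.norm_eq_abs, abs_of_pos (gk_pos hc _)]
          have := gk_pos hc (s - X x)
          have := hMi s
          gcongr
      _ = M := by rw [integral_mul_const, g2, one_mul]
  · exact integrableOn_const hb.measure_lt_top.ne
  · rw [ae_restrict_iff' hm]
    refine ae_of_all _ fun x hx => ?_
    have hx2 := hab x hx
    have hn : (Set.Ioc a b).indicator ψ =ᶠ[nhds (X x)] ψ := by
      filter_upwards [Ioo_mem_nhds hx2.1 hx2.2] with s hs
      rw [Set.indicator_of_mem (show s ∈ Set.Ioc a b from ⟨hs.1, hs.2.le⟩)]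
    have := gk_peak hInteg (τ := X x) (hψ.continuousAt.congr hn.symm)
    rwa [hn.eq_of_nhds] at this

/-- Needle inequality. -/
lemma needle {d : ℕ} {K : Set (Euc d)} (hb : Bornology.IsBounded K) (hm : MeasurableSet K) (hK : Convex ℝ K)
    (hv : 0 < volume K)
    (e : Euc d) {a b κ : ℝ} (hab : ∀ x ∈ K, inner ℝ e x ∈ Set.Icc a b) (hlt : a ≤ b) (hκ : 0 < κ)
    (hκπ : κ * (b - a) < π) {g g1 : ℝ → ℝ}
    (hg : ∀ x, HasDerivAt g (g1 x) x) (hg1 : Continuous g1) :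
    κ ^ 2 * ((∫ x in K, g (inner ℝ e x) ^ 2) * (volume K).toReal - (∫ x in K, g (inner ℝ e x)) ^ 2)
      ≤ (∫ x in K, g1 (inner ℝ e x) ^ 2) * (volume K).toReal := by
  have cg : Continuous g := continuous_iff_continuousAt.mpr fun x => (hg x).continuousAt
  obtain ⟨δ, hδ, hδ2⟩ : ∃ δ > 0, κ * ((b + δ) - (a - δ)) < π := by
    refine ⟨(π - κ * (b - a)) / (4 * κ), by apply div_pos <;> linarith, ?_⟩
    have : κ * (b + (π - κ * (b - a)) / (4 * κ) - (a - (π - κ * (b - a)) / (4 * κ))) = κ * (b - a) + (π - κ * (b - a)) / 2 := by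
      field_simp; ring
    rw [this]; linarith
  have hX : Continuous fun x : Euc d => inner ℝ e x := by fun_prop
  have hab' : ∀ x ∈ K, inner ℝ e x ∈ Set.Ioo (a - δ) (b + δ) := fun x hx => by
    have := hab x hx
    constructor <;> linarith [this.1, this.2]
  have hl' : a - δ < b + δ := by linarith
  have L : ∀ ψ : ℝ → ℝ, Continuous ψ → _ := fun ψ h => marg_limit hb hm hX hab' hl' h
  have lim1 := L (fun s => g s ^ 2) (by fun_prop)
  have lim2 := L (fun s => 1) (by fun_prop)
  have lim3 := L (fun s => g s) (by fun_prop)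
  have lim4 := L (fun s => g1 s ^ 2) (by fun_prop)
  have hvol : ∫ x in K, (1:ℝ) = (volume K).toReal := by simp [Measure.real]
  rw [hvol] at lim2
  refine le_of_tendsto_of_tendsto ((((lim1.mul lim2).sub (lim3.pow 2))).const_mul (κ ^ 2)) (lim4.mul lim2) ?_
  filter_upwards [eventually_gt_atTop 0] with c hc
  simp only [mul_one]
  have s0 := gk_contDiff c
  have s1 : ContDiff ℝ (⊤ : ℕ∞) (deriv (gk c)) := s0.deriv'
  have s2 : ContDiff ℝ (⊤ : ℕ∞) (deriv (deriv (gk c))) := s1.deriv'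
  refine wp_poincare (p := fun s => ∫ x in K, gk c (s - inner ℝ e x))
    (fun s => marg_hasDerivAt hb hm hX s0 s) (fun s => marg_hasDerivAt hb hm hX s1 s)
    (continuous_iff_continuousAt.mpr fun s => (marg_hasDerivAt hb hm hX s2 s).continuousAt) ?_ ?_ hl' hκ hδ2 hg hg1
  · intro s
    rw [setIntegral_pos_iff_support_of_nonneg_ae]
    · have : Function.support (fun x : Euc d => gk c (s - inner ℝ e x)) = Set.univ := by
        ext x; simp [(gk_pos hc _).ne']
      rw [this, Set.univ_inter]; exact hv
    · exact ae_of_all _ fun x => (gk_pos hc _).le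
    · exact cont_integrableOn hb ((gk_contDiff c).continuous.comp (by fun_prop))
  · exact lc_of_mid (fun s => marg_hasDerivAt hb hm hX s0 s) (fun s => marg_hasDerivAt hb hm hX s1 s)
      (fun s t => marg_mid hb hm hK e hc s t)

/-! ### Thin convex sets -/

lemma thin_ineq {d : ℕ} {K : Set (Euc d)} (hb : Bornology.IsBounded K) (hm : MeasurableSet K) (hK : Convex ℝ K)
    (hv : 0 < volume K) {u : Euc d → ℝ} (hu : ContDiff ℝ (⊤ : ℕ∞) u) (h0 : ∫ x in K, u x = 0)
    {x0 e : Euc d} (he : ‖e‖ = 1) {M ω D κ : ℝ} (hω : 0 ≤ ω) (hκ : 0 < κ) (hκD : κ * D < π)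
    (hD : ∀ x ∈ K, ∀ y ∈ K, dist x y ≤ D)
    (h1 : ∀ x ∈ K, |u x - u (x0 + (inner ℝ e (x - x0)) • e)| ≤ ω)
    (h2 : ∀ x ∈ K, ‖fderiv ℝ u (x0 + (inner ℝ e (x - x0)) • e)‖ ^ 2 ≤ ‖fderiv ℝ u x‖ ^ 2 + ω)
    (h3 : ∀ x ∈ K, |u x| ≤ M) (h4 : ∀ x ∈ K, |u (x0 + (inner ℝ e (x - x0)) • e)| ≤ M) :
    κ ^ 2 * ∫ x in K, u x ^ 2 ≤ (∫ x in K, ‖fderiv ℝ u x‖ ^ 2)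
      + (κ ^ 2 * (2 * M * ω + ω ^ 2) + ω) * (volume K).toReal := by
  set γ : ℝ → Euc d := fun t => x0 + (t - inner ℝ e x0) • e
  set g : ℝ → ℝ := fun t => u (γ t)
  set g1 : ℝ → ℝ := fun t => fderiv ℝ u (γ t) e
  have cγ : Continuous γ := by fun_prop
  have cu := hu.continuous
  have cdu := smooth_fderiv_cont hu
  have dγ : ∀ t, HasDerivAt γ e t := fun t => by
    have := (((hasDerivAt_id t).sub_const (inner ℝ e x0)).smul_const e).const_add x0
    exact this.congr_deriv (by simp)
  have hg : ∀ t, HasDerivAt g (g1 t) t := fun t =>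
    ((hu.differentiable (by simp) (γ t)).hasFDerivAt).comp_hasDerivAt t (dγ t)
  have hg1 : Continuous g1 := (cdu.comp cγ).clm_apply continuous_const
  have cg : Continuous g := cu.comp cγ
  have hγ : ∀ x, γ (inner ℝ e x) = x0 + (inner ℝ e (x - x0)) • e := fun x => by
    simp only [γ, inner_sub_right]
  have hVt : volume K ≠ ⊤ := hb.measure_lt_top.ne
  set V := (volume K).toReal
  have hV : 0 < V := ENNReal.toReal_pos hv.ne' hVt
  have hVi : ∫ x in K, (1:ℝ) = V := by simp [V, Measure.real]
  obtain ⟨y0, hy0⟩ : K.Nonempty := nonempty_of_measure_ne_zero hv.ne'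
  set S := (fun x => inner ℝ e x) '' K
  have hdiff : ∀ x ∈ K, ∀ y ∈ K, inner ℝ e x - inner ℝ e y ≤ D := by
    intro x hx y hy
    rw [← inner_sub_right]
    calc inner ℝ e (x - y) ≤ ‖e‖ * ‖x - y‖ := real_inner_le_norm _ _
      _ = dist x y := by rw [he, one_mul, dist_eq_norm]
      _ ≤ D := hD x hx y hy
  have hSn : S.Nonempty := ⟨_, y0, hy0, rfl⟩
  have hbb : BddBelow S := ⟨inner ℝ e y0 - D, by
    rintro _ ⟨x, hx, rfl⟩
    have := hdiff y0 hy0 x hx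
    simp only; linarith⟩
  have hba : BddAbove S := ⟨inner ℝ e y0 + D, by
    rintro _ ⟨x, hx, rfl⟩
    have := hdiff x hx y0 hy0
    simp only; linarith⟩
  have hab : ∀ x ∈ K, inner ℝ e x ∈ Set.Icc (sInf S) (sSup S) := fun x hx =>
    ⟨csInf_le hbb ⟨x, hx, rfl⟩, le_csSup hba ⟨x, hx, rfl⟩⟩
  have hlt : sInf S ≤ sSup S := (hab y0 hy0).1.trans (hab y0 hy0).2
  have hlen : sSup S - sInf S ≤ D := by
    have : sSup S ≤ D + sInf S := by
      apply csSup_le hSn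
      rintro _ ⟨x, hx, rfl⟩
      have : inner ℝ e x - D ≤ sInf S := by
        apply le_csInf hSn
        rintro _ ⟨y, hy, rfl⟩
        have := hdiff x hx y hy
        simp only; linarith
      simp only; linarith
    linarith
  have hκ2 : κ * (sSup S - sInf S) < π := lt_of_le_of_lt (by gcongr) hκD
  have ndl := needle hb hm hK hv e hab hlt hκ hκ2 hg hg1
  have ci : Continuous fun x : Euc d => (inner ℝ e x : ℝ) := by fun_prop
  have igg : IntegrableOn (fun x => g (inner ℝ e x)) K := cont_integrableOn hb (by fun_prop)
  have igg2 : IntegrableOn (fun x => g (inner ℝ e x) ^ 2) K := cont_integrableOn hb (by fun_prop)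
  have ig1 : IntegrableOn (fun x => g1 (inner ℝ e x) ^ 2) K := cont_integrableOn hb (by fun_prop)
  have iu : IntegrableOn u K := cont_integrableOn hb cu
  have iu2 : IntegrableOn (fun x => u x ^ 2) K := cont_integrableOn hb (by fun_prop)
  have idu := smooth_grad_int hb hu
  have ic : ∀ c : ℝ, IntegrableOn (fun _ : Euc d => c) K := fun c => integrableOn_const hVt
  have vc : ∀ c : ℝ, ∫ x in K, c = c * V := fun c => by
    have := integral_const_mul (μ := volume.restrict K) c (fun _ : Euc d => (1:ℝ))
    rw [hVi] at this; simpa using this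
  have m1 : |∫ x in K, g (inner ℝ e x)| ≤ ω * V := by
    have : ∫ x in K, g (inner ℝ e x) = ∫ x in K, (g (inner ℝ e x) - u x) := by
      rw [integral_sub igg iu, h0, sub_zero]
    rw [this, ← vc, ← Real.norm_eq_abs]
    apply norm_integral_le_of_norm_le (ic ω)
    rw [ae_restrict_iff' hm]
    refine ae_of_all _ fun x hx => ?_
    rw [Real.norm_eq_abs, abs_sub_comm]
    simp only [g, hγ]
    exact h1 x hx
  have m2 : ∫ x in K, u x ^ 2 ≤ (∫ x in K, g (inner ℝ e x) ^ 2) + 2 * M * ω * V := by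
    rw [← vc, ← integral_add igg2 (ic _)]
    refine setIntegral_mono_on iu2 (igg2.add (ic _)) hm fun x hx => ?_
    simp only [g, hγ]
    have a1 := h1 x hx
    have a3 := h3 x hx
    have a4 := h4 x hx
    set y := u (x0 + (inner ℝ e (x - x0)) • e)
    have : u x ^ 2 - y ^ 2 ≤ 2 * M * ω := by
      calc u x ^ 2 - y ^ 2 = (u x + y) * (u x - y) := by ring
        _ ≤ |(u x + y) * (u x - y)| := le_abs_self _
        _ = |u x + y| * |u x - y| := abs_mul _ _
        _ ≤ (M + M) * ω := by
          have : |u x + y| ≤ M + M := (abs_add_le _ _).trans (add_le_add a3 a4)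
          have : 0 ≤ M := (abs_nonneg _).trans a3
          gcongr
        _ = 2 * M * ω := by ring
    linarith
  have m3 : ∫ x in K, g1 (inner ℝ e x) ^ 2 ≤ (∫ x in K, ‖fderiv ℝ u x‖ ^ 2) + ω * V := by
    rw [← vc, ← integral_add idu (ic _)]
    refine setIntegral_mono_on ig1 (idu.add (ic _)) hm fun x hx => ?_
    refine le_trans ?_ (h2 x hx)
    simp only [g1, hγ]
    rw [← sq_abs, ← Real.norm_eq_abs]
    gcongr
    refine (ContinuousLinearMap.le_opNorm _ _).trans_eq ?_
    rw [he, mul_one]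
  have m4 : (∫ x in K, g (inner ℝ e x)) ^ 2 ≤ (ω * V) ^ 2 := by
    rw [← sq_abs]; gcongr
  have m5 : κ ^ 2 * (∫ x in K, g (inner ℝ e x) ^ 2) ≤ (∫ x in K, g1 (inner ℝ e x) ^ 2) + κ ^ 2 * ω ^ 2 * V := by
    refine le_of_mul_le_mul_right ?_ hV
    have : κ ^ 2 * (∫ x in K, g (inner ℝ e x)) ^ 2 ≤ κ ^ 2 * (ω * V) ^ 2 := by gcongr
    nlinarith
  have m6 : κ ^ 2 * ∫ x in K, u x ^ 2 ≤ κ ^ 2 * ((∫ x in K, g (inner ℝ e x) ^ 2) + 2 * M * ω * V) := by gcongr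
  nlinarith

/-! ### Cutting -/

lemma hyperplane_null {d : ℕ} {θ : Euc d} (hθ : θ ≠ 0) (z : Euc d) :
    volume {x : Euc d | inner ℝ θ (x - z) = 0} = 0 := by
  have h := Measure.addHaar_affineSubspace (volume : Measure (Euc d))
    (AffineSubspace.mk' z (LinearMap.ker (innerSL ℝ θ : Euc d →L[ℝ] ℝ).toLinearMap)) (by
      intro htop
      have : z + θ ∈ AffineSubspace.mk' z (LinearMap.ker (innerSL ℝ θ : Euc d →L[ℝ] ℝ).toLinearMap) := by
        rw [htop]; trivial
      rw [AffineSubspace.mem_mk'] at this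
      simp at this
      exact hθ this)
  convert h using 2
  ext x
  simp [AffineSubspace.mem_mk']

/-- open half -/
def halfK {d : ℕ} (K : Set (Euc d)) (θ z : Euc d) : Set (Euc d) := K ∩ {x | 0 < inner ℝ θ (x - z)}

lemma half_meas {d : ℕ} (θ z : Euc d) : IsOpen {x : Euc d | 0 < inner ℝ θ (x - z)} :=
  isOpen_lt continuous_const (by fun_prop)

lemma half_split {d : ℕ} {K : Set (Euc d)} (hm : MeasurableSet K) {θ : Euc d} (hθ : θ ≠ 0) (z : Euc d)
    {f : Euc d → ℝ} (hf : IntegrableOn f K) :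
    ∫ x in K, f x = (∫ x in halfK K θ z, f x) + ∫ x in halfK K (-θ) z, f x := by
  have h1 : MeasurableSet (halfK K θ z) := hm.inter (half_meas θ z).measurableSet
  have h2 : MeasurableSet (halfK K (-θ) z) := hm.inter (half_meas (-θ) z).measurableSet
  have i1 : IntegrableOn f (halfK K θ z) := hf.mono_set Set.inter_subset_left
  have i2 : IntegrableOn f (halfK K (-θ) z) := hf.mono_set Set.inter_subset_left
  rw [← setIntegral_union _ h2 i1 i2]
  · apply setIntegral_congr_set
    have hsub : halfK K θ z ∪ halfK K (-θ) z ⊆ K := Set.union_subset Set.inter_subset_left Set.inter_subset_left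
    refine (HasSubset.Subset.eventuallyLE (α := Euc d) hsub).antisymm ?_ |>.symm
    rw [ae_le_set]
    refine measure_mono_null ?_ (hyperplane_null hθ z)
    rintro x ⟨hx, hx2⟩
    simp only [halfK, Set.mem_union, Set.mem_inter_iff, hx, Set.mem_setOf_eq, true_and, inner_neg_left, not_or, not_lt] at hx2
    exact le_antisymm hx2.1 (by linarith [hx2.2])
  · rw [Set.disjoint_left]
    rintro x ⟨_, hx⟩ ⟨_, hx2⟩
    simp only [Set.mem_setOf_eq, inner_neg_left] at hx hx2
    linarith

/-- rotating direction -/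
def rot {d : ℕ} (e1 e2 : Euc d) (φ : ℝ) : Euc d := cos φ • e1 + sin φ • e2

lemma rot_norm {d : ℕ} {e1 e2 : Euc d} (h1 : ‖e1‖ = 1) (h2 : ‖e2‖ = 1) (h12 : inner ℝ e1 e2 = 0) (φ : ℝ) :
    ‖rot e1 e2 φ‖ = 1 := by
  have : ‖rot e1 e2 φ‖ ^ 2 = 1 := by
    unfold rot
    rw [norm_add_sq_real, norm_smul, norm_smul, inner_smul_left, inner_smul_right, h12, h1, h2]
    simp
  nlinarith [norm_nonneg (rot e1 e2 φ)]

lemma rot_pi {d : ℕ} (e1 e2 : Euc d) (φ : ℝ) : rot e1 e2 (φ + π) = - rot e1 e2 φ := by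
  simp [rot]; abel

lemma cut_exists {d : ℕ} {K : Set (Euc d)} (hb : Bornology.IsBounded K) (hm : MeasurableSet K)
    {e1 e2 : Euc d} (h1 : ‖e1‖ = 1) (h2 : ‖e2‖ = 1) (h12 : inner ℝ e1 e2 = 0) (z : Euc d)
    {u w : Euc d → ℝ} (hu : Continuous u) (hw : Continuous w) (h0 : ∫ x in K, u x = 0)
    (hpos : 0 < ∫ x in K, w x) :
    ∃ φ, ∫ x in halfK K (rot e1 e2 φ) z, u x = 0 ∧ 0 < ∫ x in halfK K (rot e1 e2 φ) z, w x := by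
  have hne : ∀ φ, rot e1 e2 φ ≠ 0 := fun φ h => by
    have := rot_norm h1 h2 h12 φ
    rw [h] at this; simp at this
  have iu := cont_integrableOn hb hu
  have iw := cont_integrableOn hb hw
  set G : ℝ → ℝ := fun φ => ∫ x in halfK K (rot e1 e2 φ) z, u x with hG
  have hpi : ∀ φ, G φ + G (φ + π) = 0 := fun φ => by
    simp only [hG, rot_pi]
    rw [← half_split hm (hne φ) z iu, h0]
  have crot : Continuous (rot e1 e2) := by unfold rot; fun_prop
  have hc : Continuous G := by
    rw [continuous_iff_continuousAt]
    intro φ0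
    have : G = fun φ => ∫ x in K, ({x | 0 < inner ℝ (rot e1 e2 φ) (x - z)} : Set (Euc d)).indicator u x := by
      funext φ
      simp only [hG, halfK]
      rw [setIntegral_indicator (half_meas _ _).measurableSet]
    rw [this]
    apply continuousAt_of_dominated (bound := fun x => ‖u x‖)
    · refine Eventually.of_forall fun φ => ?_
      exact (hu.measurable.indicator (half_meas _ _).measurableSet).aestronglyMeasurable
    · refine Eventually.of_forall fun φ => ae_of_all _ fun x => ?_
      exact norm_indicator_le_norm_self _ _
    · exact iu.norm
    · have : ∀ᵐ x : Euc d, inner ℝ (rot e1 e2 φ0) (x - z) ≠ 0 := by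
        rw [ae_iff]; simpa using hyperplane_null (hne φ0) z
      refine ae_restrict_of_ae ?_
      filter_upwards [this] with x hx
      have cin : Continuous fun φ => inner ℝ (rot e1 e2 φ) (x - z) := by fun_prop
      rcases lt_or_gt_of_ne hx with h | h
      · have : (fun φ => ({x | 0 < inner ℝ (rot e1 e2 φ) (x - z)} : Set (Euc d)).indicator u x) =ᶠ[nhds φ0] fun _ => 0 := by
          filter_upwards [cin.continuousAt.eventually_lt_const h] with φ hφ
          rw [Set.indicator_of_notMem]
          simp only [Set.mem_setOf_eq, not_lt]; exact hφ.le
        exact continuousAt_const.congr this.symm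
      · have : (fun φ => ({x | 0 < inner ℝ (rot e1 e2 φ) (x - z)} : Set (Euc d)).indicator u x) =ᶠ[nhds φ0] fun _ => u x := by
          filter_upwards [cin.continuousAt.eventually_const_lt h] with φ hφ
          rw [Set.indicator_of_mem]
          exact hφ
        exact continuousAt_const.congr this.symm
  obtain ⟨φ, hφ⟩ : ∃ φ, G φ = 0 := by
    have h := hpi 0
    rcases le_total (G 0) 0 with hn | hn
    · exact mem_range_of_exists_le_of_exists_ge hc ⟨0, hn⟩ ⟨0 + π, by linarith⟩
    · exact mem_range_of_exists_le_of_exists_ge hc ⟨0 + π, by linarith⟩ ⟨0, hn⟩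
  have hsp := half_split hm (hne φ) z iw
  rw [← rot_pi] at hsp
  rcases lt_or_ge 0 (∫ x in halfK K (rot e1 e2 φ) z, w x) with h | h
  · exact ⟨φ, hφ, h⟩
  · refine ⟨φ + π, ?_, by linarith⟩
    have := hpi φ
    rw [hφ, zero_add] at this
    exact this

lemma cut_geom {δ l m k c s : ℝ} (hδ : 0 < δ) (hl : δ / 2 ≤ l) (hm : |m| ≤ 2 * l) (hk : δ ≤ k)
    (hcs : s ^ 2 + c ^ 2 = 1) :
    -(l * c + (m * c + k * s)) / 3 ≤ -(δ / 24) ∨ (2 * (l * c) - (m * c + k * s)) / 3 ≤ -(δ / 24) ∨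
      (2 * (m * c + k * s) - l * c) / 3 ≤ -(δ / 24) := by
  by_contra! h
  obtain ⟨h1, h2, h3⟩ := h
  have hA : |l * c| < δ / 4 := by rw [abs_lt]; constructor <;> linarith
  have hB : |m * c + k * s| < δ / 4 := by rw [abs_lt]; constructor <;> linarith
  have hl0 : 0 < l := by linarith
  rw [abs_mul, abs_of_pos hl0] at hA
  have hc0 := abs_nonneg c
  have hc : |c| < 1 / 2 := by nlinarith
  have hmc : |m * c| < δ / 2 := by
    rw [abs_mul]; nlinarith [abs_nonneg m]
  have hs : 4 / 5 < |s| := by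
    have h4 : |s| ^ 2 + |c| ^ 2 = 1 := by simpa using hcs
    nlinarith [abs_nonneg s]
  have hks : 4 / 5 * δ < |k * s| := by
    rw [abs_mul, abs_of_pos (by linarith : 0 < k)]; nlinarith
  have : |k * s| ≤ |m * c + k * s| + |m * c| := by
    have := abs_sub (m * c + k * s) (m * c)
    simpa using this
  linarith

/-- thinness -/
def Thin {d : ℕ} (K : Set (Euc d)) (δ : ℝ) : Prop :=
  ∃ x0 ∈ K, ∃ e : Euc d, ‖e‖ = 1 ∧ ∀ x ∈ K, ‖x - (x0 + (inner ℝ e (x - x0) : ℝ) • e)‖ ≤ δ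

lemma not_thin {d : ℕ} (hd : 0 < d) {K : Set (Euc d)} (hb : Bornology.IsBounded K) (hne : K.Nonempty) {δ : ℝ} (hδ : 0 < δ)
    (ht : ¬ Thin K δ) : ∃ p ∈ K, ∃ q ∈ K, ∃ r ∈ K, ∃ e1 e2 : Euc d, ∃ l m k : ℝ,
      ‖e1‖ = 1 ∧ ‖e2‖ = 1 ∧ inner ℝ e1 e2 = 0 ∧ q - p = l • e1 ∧ r - p = m • e1 + k • e2 ∧
      δ / 2 ≤ l ∧ |m| ≤ 2 * l ∧ δ ≤ k := by
  obtain ⟨x0, hx0⟩ := hne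
  have hdiam : 0 < Metric.diam K := by
    by_contra! h
    apply ht
    refine ⟨x0, hx0, EuclideanSpace.single ⟨0, hd⟩ 1, by simp, fun x hx => ?_⟩
    have : dist x x0 ≤ 0 := (Metric.dist_le_diam_of_mem hb hx hx0).trans h
    have hxx : x = x0 := dist_le_zero.mp this
    simp [hxx, hδ.le]
  obtain ⟨p, hp, q, hq, hpq⟩ : ∃ p ∈ K, ∃ q ∈ K, Metric.diam K / 2 < dist p q := by
    by_contra! h
    have := Metric.diam_le_of_forall_dist_le (by positivity : 0 ≤ Metric.diam K / 2) h
    linarith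
  have hl : 0 < ‖q - p‖ := by
    rw [← dist_eq_norm, dist_comm]; linarith
  set l := ‖q - p‖ with hld
  have hlK : ∀ x ∈ K, ‖x - p‖ ≤ 2 * l := fun x hx => by
    have h1 := Metric.dist_le_diam_of_mem hb hx hp
    rw [dist_eq_norm] at h1
    rw [dist_comm, dist_eq_norm] at hpq
    linarith
  set e1 : Euc d := l⁻¹ • (q - p) with he1
  have ne1 : ‖e1‖ = 1 := by
    rw [he1, norm_smul, norm_inv, Real.norm_eq_abs, abs_of_pos hl, ← hld, inv_mul_cancel₀ hl.ne']
  have hex : ∃ r ∈ K, δ < ‖r - (p + (inner ℝ e1 (r - p) : ℝ) • e1)‖ := by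
    by_contra! h
    exact ht ⟨p, hp, e1, ne1, h⟩
  obtain ⟨r, hr, hrk⟩ := hex
  set m : ℝ := inner ℝ e1 (r - p) with hmd
  set v := r - (p + m • e1) with hv
  set k := ‖v‖ with hkd
  have hk : 0 < k := hδ.trans hrk
  have hv' : r - p = m • e1 + v := by rw [hv]; abel
  have hortho : inner ℝ e1 v = 0 := by
    have : inner ℝ e1 (r - p) = inner ℝ e1 (m • e1 + v) := by rw [← hv']
    rw [inner_add_right, inner_smul_right, real_inner_self_eq_norm_sq, ne1, ← hmd] at this
    linarith
  have hm : |m| ≤ ‖r - p‖ := by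
    have := abs_real_inner_le_norm e1 (r - p)
    rwa [ne1, one_mul] at this
  have hpy : ‖r - p‖ ^ 2 = m ^ 2 + k ^ 2 := by
    rw [hv', norm_add_sq_real, inner_smul_left, hortho, norm_smul, ne1]
    simp [hkd]
  have hkr : k ≤ ‖r - p‖ := by nlinarith [norm_nonneg (r - p)]
  have hr2 := hlK r hr
  refine ⟨p, hp, q, hq, r, hr, e1, k⁻¹ • v, l, m, k, ne1, ?_, ?_, ?_, ?_, by linarith, by linarith, hrk.le⟩
  · rw [norm_smul, norm_inv, Real.norm_eq_abs, abs_of_pos hk, ← hkd]; field_simp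
  · rw [inner_smul_right, hortho, mul_zero]
  · rw [he1, smul_smul, mul_inv_cancel₀ hl.ne', one_smul]
  · rw [smul_inv_smul₀ hk.ne', ← hv']

lemma cut_step {d : ℕ} (hd : 0 < d) {K : Set (Euc d)} (hb : Bornology.IsBounded K) (hm : MeasurableSet K)
    {u w : Euc d → ℝ} (hu : Continuous u) (hw : Continuous w) (h0 : ∫ x in K, u x = 0)
    (hpos : 0 < ∫ x in K, w x) {δ : ℝ} (hδ : 0 < δ) (ht : ¬ Thin K δ) :
    ∃ θ z : Euc d, ∫ x in halfK K θ z, u x = 0 ∧ (0 < ∫ x in halfK K θ z, w x) ∧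
      ∃ x ∈ K, ∀ y ∈ halfK K θ z, δ / 24 ≤ dist x y := by
  have hne : K.Nonempty := by
    by_contra h
    rw [Set.not_nonempty_iff_eq_empty] at h
    rw [h] at hpos; simp at hpos
  obtain ⟨p, hp, q, hq, r, hr, e1, e2, l, m, k, n1, n2, n12, hqp, hrp, hl, hml, hk⟩ := not_thin hd hb hne hδ ht
  set z : Euc d := p + (3⁻¹:ℝ) • ((q - p) + (r - p)) with hz
  obtain ⟨φ, hφ1, hφ2⟩ := cut_exists hb hm n1 n2 n12 z hu hw h0 hpos
  refine ⟨rot e1 e2 φ, z, hφ1, hφ2, ?_⟩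
  set θ := rot e1 e2 φ with hθ
  have nθ : ‖θ‖ = 1 := rot_norm n1 n2 n12 φ
  have i1 : inner ℝ θ e1 = cos φ := by
    rw [hθ, rot, inner_add_left, inner_smul_left, inner_smul_left, real_inner_self_eq_norm_sq, n1,
      real_inner_comm, n12]; simp
  have i2 : inner ℝ θ e2 = sin φ := by
    rw [hθ, rot, inner_add_left, inner_smul_left, inner_smul_left, real_inner_self_eq_norm_sq, n2, n12]; simp
  have iq : inner ℝ θ (q - p) = l * cos φ := by rw [hqp, inner_smul_right, i1]
  have ir : inner ℝ θ (r - p) = m * cos φ + k * sin φ := by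
    rw [hrp, inner_add_right, inner_smul_right, inner_smul_right, i1, i2]
  have hsep : ∀ x, inner ℝ θ (x - z) ≤ -(δ / 24) → ∀ y ∈ halfK K θ z, δ / 24 ≤ dist x y := by
    intro x hx y hy
    have hy2 : 0 < inner ℝ θ (y - z) := hy.2
    have : inner ℝ θ (y - x) ≤ ‖θ‖ * ‖y - x‖ := real_inner_le_norm _ _
    rw [nθ, one_mul, ← dist_eq_norm, dist_comm] at this
    have e : y - x = (y - z) - (x - z) := by abel
    rw [e, inner_sub_right] at this
    linarith
  have jp : inner ℝ θ (p - z) = -(l * cos φ + (m * cos φ + k * sin φ)) / 3 := by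
    have : p - z = -((3⁻¹:ℝ) • ((q - p) + (r - p))) := by rw [hz]; abel
    rw [this, inner_neg_right, inner_smul_right, inner_add_right, iq, ir]; ring
  have jq : inner ℝ θ (q - z) = (2 * (l * cos φ) - (m * cos φ + k * sin φ)) / 3 := by
    have : q - z = (q - p) + (p - z) := by abel
    rw [this, inner_add_right, iq, jp]; ring
  have jr : inner ℝ θ (r - z) = (2 * (m * cos φ + k * sin φ) - l * cos φ) / 3 := by
    have : r - z = (r - p) + (p - z) := by abel
    rw [this, inner_add_right, ir, jp]; ring
  rcases cut_geom hδ hl hml hk (sin_sq_add_cos_sq φ) with h | h | h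
  · exact ⟨p, hp, hsep p (jp ▸ h)⟩
  · exact ⟨q, hq, hsep q (jq ▸ h)⟩
  · exact ⟨r, hr, hsep r (jr ▸ h)⟩

lemma exists_thin {d : ℕ} (hd : 0 < d) {Ω : Set (Euc d)} (hΩ : IsConvexDomain Ω)
    {u w : Euc d → ℝ} (hu : Continuous u) (hw : Continuous w) (h0 : ∫ x in Ω, u x = 0)
    (hpos : 0 < ∫ x in Ω, w x) {δ : ℝ} (hδ : 0 < δ) :
    ∃ K : Set (Euc d), (IsOpen K ∧ Convex ℝ K ∧ K ⊆ Ω ∧ ∫ x in K, u x = 0 ∧ 0 < ∫ x in K, w x) ∧ Thin K δ := by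
  by_contra! hcon
  obtain ⟨_, ho, hb, hc⟩ := hΩ
  let P : Set (Euc d) → Prop := fun K => IsOpen K ∧ Convex ℝ K ∧ K ⊆ Ω ∧ ∫ x in K, u x = 0 ∧ 0 < ∫ x in K, w x
  have step : ∀ K : {K // P K}, ∃ K' : {K // P K}, ∃ x ∈ K.1, K'.1 ⊆ K.1 ∧ ∀ y ∈ K'.1, δ / 24 ≤ dist x y := by
    rintro ⟨K, hK⟩
    have hK' := hK
    obtain ⟨k1, k2, k3, k4, k5⟩ := hK
    obtain ⟨θ, z, t1, t2, x, hx, hxy⟩ := cut_step hd (hb.subset k3) k1.measurableSet hu hw k4 k5 hδ (hcon K hK')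
    refine ⟨⟨halfK K θ z, k1.inter (half_meas θ z), k2.inter ?_, Set.inter_subset_left.trans k3, t1, t2⟩,
      x, hx, Set.inter_subset_left, hxy⟩
    have : {x : Euc d | 0 < inner ℝ θ (x - z)} = {x | inner ℝ θ z < (innerSL ℝ θ : Euc d →L[ℝ] ℝ) x} := by
      ext x; simp [inner_sub_right]
    rw [this]
    exact convex_halfSpace_gt (innerSL ℝ θ : Euc d →L[ℝ] ℝ).isLinear _
  choose nx pt hpt hsub hdist using step
  let s : ℕ → {K // P K} := fun n => nx^[n] ⟨Ω, ho, hc, le_rfl, h0, hpos⟩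
  have ss : ∀ n, s (n+1) = nx (s n) := fun n => Function.iterate_succ_apply' _ _ _
  have anti : Antitone fun n => (s n).1 := antitone_nat_of_succ_le fun n => by
    rw [ss]; exact hsub _
  let x : ℕ → Euc d := fun n => pt (s n)
  have hx : ∀ n, x n ∈ (s n).1 := fun n => hpt _
  have hd : ∀ n m, n < m → δ / 24 ≤ dist (x n) (x m) := fun n m h => by
    apply hdist (s n)
    rw [← ss]
    exact anti h (hx m)
  have hxΩ : ∀ n, x n ∈ Ω := fun n => (s n).2.2.2.1 (hx n)
  obtain ⟨a, _, φ, hφ, hlim⟩ := tendsto_subseq_of_bounded hb hxΩ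
  have hcs := hlim.cauchySeq
  rw [Metric.cauchySeq_iff] at hcs
  obtain ⟨N, hN⟩ := hcs (δ / 24) (by positivity)
  have h1 := hN N le_rfl (N+1) (by omega)
  have h2 := hd (φ N) (φ (N+1)) (hφ (by omega))
  simp only [Function.comp] at h1
  linarith

lemma pw_kappa {d : ℕ} (hd : 0 < d) {Ω : Set (Euc d)} (hΩ : IsConvexDomain Ω) {D κ : ℝ} (hκ : 0 < κ) (hκD : κ * D < π)
    (hD : ∀ x ∈ Ω, ∀ y ∈ Ω, dist x y ≤ D) {u : Euc d → ℝ} (hu : ContDiff ℝ (⊤ : ℕ∞) u) (h0 : ∫ x in Ω, u x = 0) :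
    κ ^ 2 * ∫ x in Ω, u x ^ 2 ≤ ∫ x in Ω, ‖fderiv ℝ u x‖ ^ 2 := by
  by_contra! hlt
  have hΩ' := hΩ
  obtain ⟨hne, ho, hb, hc⟩ := hΩ
  have cu := hu.continuous
  have cdu := smooth_fderiv_cont hu
  have cdu2 : Continuous fun x => ‖fderiv ℝ u x‖ ^ 2 := by fun_prop
  have hVt : volume Ω ≠ ⊤ := hb.measure_lt_top.ne
  have hV : 0 < (volume Ω).toReal := ENNReal.toReal_pos (ho.measure_pos volume hne).ne' hVt
  set V := (volume Ω).toReal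
  set I := κ ^ 2 * ∫ x in Ω, u x ^ 2
  set J := ∫ x in Ω, ‖fderiv ℝ u x‖ ^ 2
  set η := (I - J) / (2 * V) with hη
  have hηp : 0 < η := div_pos (by linarith) (by positivity)
  set w : Euc d → ℝ := fun x => (κ ^ 2 * u x ^ 2 - ‖fderiv ℝ u x‖ ^ 2) - η
  have cw : Continuous w := by fun_prop
  have intw : ∀ K ⊆ Ω, ∫ x in K, w x = κ ^ 2 * (∫ x in K, u x ^ 2) - (∫ x in K, ‖fderiv ℝ u x‖ ^ 2) - η * (volume K).toReal := by
    intro K hK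
    have hbK := hb.subset hK
    have i1 : IntegrableOn (fun x => κ ^ 2 * u x ^ 2) K := cont_integrableOn hbK (by fun_prop)
    have i2 : IntegrableOn (fun x => ‖fderiv ℝ u x‖ ^ 2) K := cont_integrableOn hbK cdu2
    have i3 : IntegrableOn (fun _ : Euc d => η) K := integrableOn_const hbK.measure_lt_top.ne
    simp only [w]
    have i12 : IntegrableOn (fun x => κ ^ 2 * u x ^ 2 - ‖fderiv ℝ u x‖ ^ 2) K := i1.sub i2
    rw [integral_sub i12 i3, integral_sub i1 i2, integral_const_mul]
    simp [Measure.real, mul_comm]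
  have hwΩ : 0 < ∫ x in Ω, w x := by
    rw [intw Ω le_rfl]
    have : η * V = (I - J) / 2 := by rw [hη]; field_simp
    change 0 < I - J - η * V
    rw [this]; linarith
  obtain ⟨R, hR0, hR⟩ : ∃ R, 0 < R ∧ Ω ⊆ Metric.closedBall (0 : Euc d) R := by
    obtain ⟨R, hR⟩ := hb.subset_closedBall 0
    exact ⟨max R 1, by positivity, hR.trans (Metric.closedBall_subset_closedBall (le_max_left _ _))⟩
  set B := Metric.closedBall (0 : Euc d) (3 * R)
  have hB : IsCompact B := isCompact_closedBall _ _
  obtain ⟨M0, hM0⟩ := hB.exists_bound_of_continuousOn cu.continuousOn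
  set M := max M0 0
  have hM : ∀ x ∈ B, |u x| ≤ M := fun x hx => (hM0 x hx).trans (le_max_left _ _)
  have hMn : 0 ≤ M := le_max_right _ _
  set Q := κ ^ 2 * (2 * M + 1) + 1
  have hQ : 0 < Q := by positivity
  set ω := min 1 (η / Q)
  have hω : 0 < ω := by positivity
  have hω1 : ω ≤ 1 := min_le_left _ _
  have hω2 : κ ^ 2 * (2 * M * ω + ω ^ 2) + ω ≤ η := by
    have h1 : ω * Q ≤ η := by
      rw [← le_div_iff₀ hQ]; exact min_le_right _ _
    have h2 : ω ^ 2 ≤ ω := by nlinarith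
    have h3 : κ ^ 2 * ω ^ 2 ≤ κ ^ 2 * ω := by gcongr
    simp only [Q] at h1
    nlinarith
  have uc1 := hB.uniformContinuousOn_of_continuous cu.continuousOn
  have uc2 := hB.uniformContinuousOn_of_continuous cdu2.continuousOn
  rw [Metric.uniformContinuousOn_iff] at uc1 uc2
  obtain ⟨δ1, hδ1, uc1⟩ := uc1 ω hω
  obtain ⟨δ2, hδ2, uc2⟩ := uc2 ω hω
  set δ := min δ1 δ2 / 2
  have hδ : 0 < δ := by positivity
  have hδ1' : δ < δ1 := by
    have := min_le_left δ1 δ2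
    have : 0 < min δ1 δ2 := by positivity
    simp only [δ]; linarith
  have hδ2' : δ < δ2 := by
    have := min_le_right δ1 δ2
    have : 0 < min δ1 δ2 := by positivity
    simp only [δ]; linarith
  obtain ⟨K, ⟨k1, k2, k3, k4, k5⟩, x0, hx0, e, he, hth⟩ := exists_thin hd hΩ' cu cw h0 hwΩ hδ
  have hnorm : ∀ x ∈ K, ‖x‖ ≤ R := fun x hx => by simpa using hR (k3 hx)
  have hxB : ∀ x ∈ K, x ∈ B := fun x hx => by
    simp only [B, mem_closedBall_zero_iff]; linarith [hnorm x hx]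
  have hpB : ∀ x ∈ K, x0 + (inner ℝ e (x - x0) : ℝ) • e ∈ B := fun x hx => by
    simp only [B, mem_closedBall_zero_iff]
    have h1 : |inner ℝ e (x - x0)| ≤ ‖x - x0‖ := by
      have := abs_real_inner_le_norm e (x - x0)
      rwa [he, one_mul] at this
    have h2 : ‖x - x0‖ ≤ ‖x‖ + ‖x0‖ := norm_sub_le _ _
    calc ‖x0 + (inner ℝ e (x - x0) : ℝ) • e‖ ≤ ‖x0‖ + ‖(inner ℝ e (x - x0) : ℝ) • e‖ := norm_add_le _ _
      _ = ‖x0‖ + |inner ℝ e (x - x0)| := by rw [norm_smul, he, mul_one, Real.norm_eq_abs]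
      _ ≤ 3 * R := by linarith [hnorm x hx, hnorm x0 hx0]
  have hdd : ∀ x ∈ K, dist x (x0 + (inner ℝ e (x - x0) : ℝ) • e) ≤ δ := fun x hx => by
    rw [dist_eq_norm]; exact hth x hx
  have hKv : 0 < volume K := by
    rcases eq_or_ne (volume K) 0 with h | h
    · rw [Measure.restrict_eq_zero.mpr h] at k5; simp at k5
    · exact pos_iff_ne_zero.mpr h
  have key := thin_ineq (hb.subset k3) k1.measurableSet k2 hKv hu k4 he hω.le hκ hκD
    (fun x hx y hy => hD x (k3 hx) y (k3 hy))
    (M := M) (x0 := x0)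
    (fun x hx => by
      have := uc1 x (hxB x hx) _ (hpB x hx) ((hdd x hx).trans_lt hδ1')
      rw [Real.dist_eq] at this; exact this.le)
    (fun x hx => by
      have := uc2 x (hxB x hx) _ (hpB x hx) ((hdd x hx).trans_lt hδ2')
      rw [Real.dist_eq, abs_lt] at this; linarith [this.1])
    (fun x hx => hM x (hxB x hx)) (fun x hx => hM _ (hpB x hx))
  rw [intw K k3] at k5
  have : (κ ^ 2 * (2 * M * ω + ω ^ 2) + ω) * (volume K).toReal ≤ η * (volume K).toReal := by gcongr
  linarith

/-- Payne–Weinberger -/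
lemma pw_ineq {d : ℕ} (hd : 0 < d) {Ω : Set (Euc d)} (hΩ : IsConvexDomain Ω) {D : ℝ} (hD0 : 0 < D)
    (hD : ∀ x ∈ Ω, ∀ y ∈ Ω, dist x y ≤ D) {u : Euc d → ℝ} (hu : ContDiff ℝ (⊤ : ℕ∞) u) (h0 : ∫ x in Ω, u x = 0) :
    (π / D) ^ 2 * ∫ x in Ω, u x ^ 2 ≤ ∫ x in Ω, ‖fderiv ℝ u x‖ ^ 2 := by
  have hp : 0 < π / D := by positivity
  have ht : Tendsto (fun κ : ℝ => κ ^ 2 * ∫ x in Ω, u x ^ 2) (nhdsWithin (π / D) (Set.Iio (π / D)))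
      (nhds ((π / D) ^ 2 * ∫ x in Ω, u x ^ 2)) := by
    apply Tendsto.mono_left _ nhdsWithin_le_nhds
    exact Continuous.tendsto (by fun_prop) _
  refine le_of_tendsto ht ?_
  filter_upwards [self_mem_nhdsWithin, mem_nhdsWithin_of_mem_nhds (lt_mem_nhds hp)] with κ h1 h2
  exact pw_kappa hd hΩ h2 ((lt_div_iff₀ hD0).mp h1) hD hu h0

lemma pw_mu {d : ℕ} (hd : 0 < d) {Ω : Set (Euc d)} (hΩ : IsConvexDomain Ω) {D : ℝ} (hD0 : 0 < D)
    (hD : ∀ x ∈ Ω, ∀ y ∈ Ω, dist x y ≤ D) : (π / D) ^ 2 ≤ neumannEigenvalue 1 Ω :=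
  ne_lower hd hΩ fun _ hu h0 => pw_ineq hd hΩ hD0 hD hu h0

/-! ### Lower bound for the ratio -/

lemma dom_diam_pos {n : ℕ} {Ω : Set (Euc (n+1))} (hΩ : IsConvexDomain Ω) : 0 < Metric.diam Ω := by
  obtain ⟨⟨x, hx⟩, ho, hb, -⟩ := hΩ
  obtain ⟨r, hr, hB⟩ := Metric.isOpen_iff.mp ho x hx
  have h1 : x + (r/2) • (EuclideanSpace.single 0 1 : Euc (n+1)) ∈ Ω := by
    apply hB
    rw [Metric.mem_ball, dist_eq_norm]
    simp only [add_sub_cancel_left, norm_smul, EuclideanSpace.norm_single, norm_one, mul_one, Real.norm_eq_abs]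
    rw [abs_of_pos (by positivity)]; linarith
  have h2 := Metric.dist_le_diam_of_mem hb h1 hx
  refine lt_of_lt_of_le ?_ h2
  rw [dist_eq_norm]
  simp only [add_sub_cancel_left, norm_smul, EuclideanSpace.norm_single, norm_one, mul_one, Real.norm_eq_abs]
  rw [abs_of_pos (by positivity)]; linarith

lemma ratio_lower {n : ℕ} (hn : 1 ≤ n) {Ω₁ Ω₂ : Set (Euc (n+1))} (h1 : IsConvexDomain Ω₁) (h2 : IsConvexDomain Ω₂)
    (hs : Ω₁ ⊆ Ω₂) : π ^ 2 / (4 * bj n ^ 2) ≤ neumannEigenvalue 1 Ω₁ / neumannEigenvalue 1 Ω₂ := by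
  have hb := h2.2.2.1
  have hD := dom_diam_pos h2
  set D := Metric.diam Ω₂ with hDd
  have hDD : ∀ x ∈ Ω₂, ∀ y ∈ Ω₂, dist x y ≤ D := fun x hx y hy => Metric.dist_le_diam_of_mem hb hx hy
  have p1 := pw_mu (by omega) h1 hD (fun x hx y hy => hDD x (hs hx) y (hs hy))
  have p2 := pw_mu (by omega) h2 hD hDD
  have hp : 0 < (π / D) ^ 2 := by positivity
  set μ1 := neumannEigenvalue 1 Ω₁
  set μ2 := neumannEigenvalue 1 Ω₂
  have hμ2 : 0 < μ2 := hp.trans_le p2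
  have hj := (bj_spec hn).1
  have key : μ2 * D ^ 2 ≤ 4 * bj n ^ 2 := by
    have ht : Tendsto (fun t : ℝ => μ2 * t ^ 2) (nhdsWithin D (Set.Iio D)) (nhds (μ2 * D ^ 2)) :=
      Tendsto.mono_left (Continuous.tendsto (by fun_prop) _) nhdsWithin_le_nhds
    refine le_of_tendsto ht ?_
    filter_upwards [self_mem_nhdsWithin, mem_nhdsWithin_of_mem_nhds (lt_mem_nhds hD)] with t h1 h3
    obtain ⟨p, hp, q, hq, hpq⟩ : ∃ p ∈ Ω₂, ∃ q ∈ Ω₂, t < dist p q := by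
      by_contra! h
      have := Metric.diam_le_of_forall_dist_le (h3 : 0 < t).le h
      have h1' : t < D := h1
      linarith
    have h3' : 0 < t := h3
    have hne : p ≠ q := fun h => by
      rw [h, dist_self] at hpq; linarith
    have hk := kroger_pair hn h2 hp hq hne
    rw [le_div_iff₀ (by have := h3'.trans hpq; positivity)] at hk
    refine le_trans ?_ hk
    gcongr
  rw [div_le_div_iff₀ (by positivity) hμ2]
  have : π ^ 2 ≤ μ1 * D ^ 2 := by
    rw [div_pow, div_le_iff₀ (by positivity)] at p1; exact p1
  have h3 : π ^ 2 * μ2 ≤ μ1 * D ^ 2 * μ2 := by gcongr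
  have hμ1 : 0 < μ1 := hp.trans_le p1
  have h4 : μ1 * (μ2 * D ^ 2) ≤ μ1 * (4 * bj n ^ 2) := by gcongr
  linarith

/-! ### Coordinates -/

/-- cons coordinates -/
def cn {n : ℕ} : (ℝ × Euc n) →L[ℝ] Euc (n+1) :=
  LinearMap.toContinuousLinearMap
    { toFun := fun p => WithLp.toLp 2 (Fin.cons p.1 p.2.ofLp)
      map_add' := fun p q => by
        ext i; refine Fin.cases ?_ (fun j => ?_) i <;> simp
      map_smul' := fun c p => by
        ext i; refine Fin.cases ?_ (fun j => ?_) i <;> simp }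

lemma cn_apply {n : ℕ} (p : ℝ × Euc n) : cn p = WithLp.toLp 2 (Fin.cons p.1 p.2.ofLp) := rfl

@[simp] lemma cn_zero {n : ℕ} (p : ℝ × Euc n) : cn p 0 = p.1 := by simp [cn_apply]
@[simp] lemma cn_succ {n : ℕ} (p : ℝ × Euc n) (i : Fin n) : cn p i.succ = p.2 i := by simp [cn_apply]

lemma cn_norm {n : ℕ} (p : ℝ × Euc n) : ‖cn p‖ ^ 2 = p.1 ^ 2 + ‖p.2‖ ^ 2 := by
  rw [EuclideanSpace.norm_sq_eq, EuclideanSpace.norm_sq_eq, Fin.sum_univ_succ]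
  simp

/-- tail -/
def tl {n : ℕ} : Euc (n+1) →L[ℝ] Euc n :=
  LinearMap.toContinuousLinearMap
    { toFun := fun x => WithLp.toLp 2 (fun i => x i.succ)
      map_add' := fun p q => by ext i; simp
      map_smul' := fun c p => by ext i; simp }

@[simp] lemma tl_apply {n : ℕ} (x : Euc (n+1)) (i : Fin n) : tl x i = x i.succ := rfl

@[simp] lemma tl_cn {n : ℕ} (p : ℝ × Euc n) : tl (cn p) = p.2 := by ext i; simp

lemma cn_tl {n : ℕ} (x : Euc (n+1)) : cn (x 0, tl x) = x := by
  ext i; refine Fin.cases ?_ (fun j => ?_) i <;> simp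

lemma cn_inj {n : ℕ} : Function.Injective (cn (n := n)) := fun p q h => by
  have h1 : cn p 0 = cn q 0 := by rw [h]
  have h2 : tl (cn p) = tl (cn q) := by rw [h]
  simp at h1 h2
  exact Prod.ext h1 h2

lemma cn_mp {n : ℕ} : MeasurePreserving (cn (n := n)) (volume.prod volume) volume := by
  have h1 := (PiLp.volume_preserving_ofLp (ι := Fin n))
  have h2 := (volume_preserving_piFinSuccAbove (fun _ : Fin (n+1) => ℝ) 0).symm
  have h3 := (PiLp.volume_preserving_toLp (ι := Fin (n+1)))
  have h4 := h3.comp (h2.comp ((MeasurePreserving.id (volume : Measure ℝ)).prod h1))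
  have heq : (cn (n := n) : ℝ × Euc n → Euc (n+1)) = WithLp.toLp 2 ∘
      ⇑(MeasurableEquiv.piFinSuccAbove (fun _ : Fin (n+1) => ℝ) 0).symm ∘ Prod.map id WithLp.ofLp := by
    funext p
    rw [cn_apply]
    simp [MeasurableEquiv.piFinSuccAbove, Fin.insertNthEquiv, Fin.insertNth_zero]
  rw [heq]
  exact h4

lemma cn_emb {n : ℕ} : MeasurableEmbedding (cn (n := n)) := cn.continuous.measurableEmbedding cn_inj

lemma cn_integral {n : ℕ} (S : Set (Euc (n+1))) (F : Euc (n+1) → ℝ) :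
    ∫ x in S, F x = ∫ p in cn ⁻¹' S, F (cn p) ∂(volume.prod volume) :=
  (cn_mp.setIntegral_preimage_emb cn_emb F S).symm

/-! ### Cylinder -/

/-- cylinder -/
def cyl (n : ℕ) (l ρ : ℝ) : Set (Euc (n+1)) := {x | |x 0| < l ∧ ‖tl x‖ < ρ}

lemma cyl_dom {n : ℕ} {l ρ : ℝ} (hl : 0 < l) (hρ : 0 < ρ) : IsConvexDomain (cyl n l ρ) := by
  have c0 : Continuous fun x : Euc (n+1) => x 0 := by fun_prop
  refine ⟨⟨0, by simp [cyl, hl, hρ]⟩, ?_, ?_, ?_⟩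
  · exact (isOpen_lt c0.abs continuous_const).inter (isOpen_lt tl.continuous.norm continuous_const)
  · rw [isBounded_iff_forall_norm_le]
    refine ⟨l + ρ, fun x hx => ?_⟩
    have h := cn_norm (x 0, tl x)
    rw [cn_tl] at h
    obtain ⟨h1, h2⟩ := hx
    simp only at h
    rw [← sq_abs (x 0)] at h
    nlinarith [norm_nonneg x, norm_nonneg (tl x), abs_nonneg (x 0)]
  · rintro x ⟨hx1, hx2⟩ y ⟨hy1, hy2⟩ a b ha hb hab
    refine ⟨?_, ?_⟩
    · have : (a • x + b • y : Euc (n+1)) 0 = a * x 0 + b * y 0 := by simp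
      rw [this]
      rw [abs_lt] at hx1 hy1 ⊢
      exact (convex_Ioo (-l) l) hx1 hy1 ha hb hab
    · rw [map_add, map_smul, map_smul]
      have := (convex_ball (0 : Euc n) ρ) (by simpa using hx2 : tl x ∈ _) (by simpa using hy2 : tl y ∈ _) ha hb hab
      simpa using this

lemma cyl_int {n : ℕ} {l ρ : ℝ} (hl : 0 < l) (F : ℝ → ℝ) :
    ∫ x in cyl n l ρ, F (x 0) = (∫ s in -l..l, F s) * (volume (Metric.ball (0 : Euc n) ρ)).toReal := by
  rw [cn_integral]
  have : cn ⁻¹' (cyl n l ρ) = (Set.Ioo (-l) l) ×ˢ (Metric.ball (0 : Euc n) ρ) := by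
    ext p; simp [cyl, abs_lt]
  rw [this, ← Measure.prod_restrict]
  have := integral_prod_mul (μ := volume.restrict (Set.Ioo (-l) l)) (ν := volume.restrict (Metric.ball (0 : Euc n) ρ))
    F (fun _ => (1:ℝ))
  simp only [mul_one, cn_zero] at this ⊢
  rw [this, intervalIntegral.integral_of_le (by linarith), integral_Ioc_eq_integral_Ioo]
  simp [Measure.real]

lemma cyl_upper {n : ℕ} {l ρ : ℝ} (hl : 0 < l) (hρ : 0 < ρ) :
    neumannEigenvalue 1 (cyl n l ρ) ≤ (π / (2 * l)) ^ 2 := by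
  set k := π / (2 * l) with hk
  have hk0 : 0 < k := by positivity
  have hkl : k * l = π / 2 := by rw [hk]; field_simp
  set L : Euc (n+1) →L[ℝ] ℝ := EuclideanSpace.proj 0 with hL
  have hLn : ‖L‖ ≤ 1 := by
    apply ContinuousLinearMap.opNorm_le_bound _ zero_le_one
    intro x
    rw [one_mul]
    exact PiLp.norm_apply_le x 0
  have hLx : ∀ x, L x = x 0 := fun x => rfl
  set v : Euc (n+1) → ℝ := fun x => sin (k * L x)
  have hv : ContDiff ℝ (⊤ : ℕ∞) v := by fun_prop
  have hvd : ∀ x, fderiv ℝ v x = (k * cos (k * x 0)) • L := fun x => by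
    have h1 : HasFDerivAt (fun x => k * L x) (k • L) x := L.hasFDerivAt.const_mul k
    have h2 := h1.sin
    rw [show fderiv ℝ v x = _ from h2.fderiv, smul_smul, mul_comm]
    rfl
  apply ne_upper (u := fun _ => 1) (v := v) contDiff_const hv (sq_nonneg k)
  · intro a b h
    have m0 : (0 : Euc (n+1)) ∈ cyl n l ρ := by simp [cyl, hl, hρ]
    have m1 : EuclideanSpace.single 0 (l / 2) ∈ cyl n l ρ := by
      refine ⟨?_, ?_⟩
      · have : (EuclideanSpace.single 0 (l / 2) : Euc (n+1)) 0 = l / 2 := by simp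
        rw [this, abs_of_pos (by positivity)]; linarith
      · have : tl (EuclideanSpace.single 0 (l/2) : Euc (n+1)) = 0 := by ext i; simp
        rw [this]; simpa using hρ
    have e0 := h _ m0
    have e1 := h _ m1
    simp only [v, hLx] at e0 e1
    simp at e0
    rw [e0] at e1
    simp at e1
    refine ⟨e0, e1.resolve_right ?_⟩
    have : 0 < sin (k * (l / 2)) := by
      apply sin_pos_of_pos_of_lt_pi
      · positivity
      · nlinarith [pi_pos]
    exact this.ne'
  · intro a b
    set V := (volume (Metric.ball (0 : Euc n) ρ)).toReal
    have hV : 0 ≤ V := ENNReal.toReal_nonneg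
    have R : ∫ x in cyl n l ρ, (a * 1 + b * v x) ^ 2 = (∫ s in -l..l, (a + b * sin (k * s)) ^ 2) * V := by
      rw [← cyl_int hl]; simp [v, hLx]
    have Lf : ∫ x in cyl n l ρ, ‖a • fderiv ℝ (fun _ : Euc (n+1) => (1:ℝ)) x + b • fderiv ℝ v x‖ ^ 2
        ≤ (∫ s in -l..l, (b * (k * cos (k * s))) ^ 2) * V := by
      rw [← cyl_int hl]
      have hb := (cyl_dom (n := n) hl hρ).2.2.1
      have hm := (cyl_dom (n := n) hl hρ).2.1.measurableSet
      refine setIntegral_mono_on ?_ ?_ hm fun x _ => ?_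
      · apply cont_integrableOn hb
        have := smooth_fderiv_cont hv
        simp only [fderiv_fun_const]
        fun_prop
      · apply cont_integrableOn hb
        fun_prop
      · rw [hvd]
        simp only [fderiv_fun_const, Pi.zero_apply, smul_zero, zero_add, norm_smul]
        rw [← mul_assoc, mul_pow, ← sq_abs (b * (k * cos (k * x 0))), abs_mul]
        simp only [Real.norm_eq_abs]
        have : ‖L‖ ^ 2 ≤ 1 := by nlinarith [norm_nonneg L]
        have h2 := mul_le_mul_of_nonneg_left this (sq_nonneg (|b| * |k * cos (k * x 0)|))
        linarith
    refine Lf.trans ?_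
    have Rg := R
    simp only [mul_one] at Rg
    simp only [mul_one]
    rw [Rg, ← mul_assoc]
    gcongr
    -- one-dimensional integrals
    have hkl' : k⁻¹ * (π / 2) = l := by rw [← hkl]; field_simp
    have c1 : Continuous fun s => sin (k * s) := by fun_prop
    have iS : ∫ s in -l..l, sin (k * s) = 0 := by
      rw [intervalIntegral.integral_comp_mul_left (fun t => sin t) hk0.ne']
      simp
    have iS2 : ∫ s in -l..l, sin (k * s) ^ 2 = l := by
      rw [intervalIntegral.integral_comp_mul_left (fun t => sin t ^ 2) hk0.ne', integral_sin_sq, mul_neg, hkl]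
      rw [sin_neg, cos_neg, sin_pi_div_two, cos_pi_div_two, smul_eq_mul]
      linear_combination hkl'
    have iC2 : ∫ s in -l..l, cos (k * s) ^ 2 = l := by
      rw [intervalIntegral.integral_comp_mul_left (fun t => cos t ^ 2) hk0.ne', integral_cos_sq, mul_neg, hkl]
      rw [sin_neg, cos_neg, sin_pi_div_two, cos_pi_div_two, smul_eq_mul]
      linear_combination hkl'
    have e1 : ∫ s in -l..l, (b * (k * cos (k * s))) ^ 2 = (b * k) ^ 2 * l := by
      have : ∀ s, (b * (k * cos (k * s))) ^ 2 = (b * k) ^ 2 * cos (k * s) ^ 2 := fun s => by ring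
      simp only [this]
      rw [intervalIntegral.integral_const_mul, iC2]
    have e2 : ∫ s in -l..l, (a + b * sin (k * s)) ^ 2 = a ^ 2 * (2 * l) + b ^ 2 * l := by
      have : ∀ s, (a + b * sin (k * s)) ^ 2 = (a ^ 2 + (2 * a * b) * sin (k * s)) + b ^ 2 * sin (k * s) ^ 2 :=
        fun s => by ring
      simp only [this]
      rw [intervalIntegral.integral_add (Continuous.intervalIntegrable (by fun_prop) _ _)
        (Continuous.intervalIntegrable (by fun_prop) _ _), intervalIntegral.integral_add (Continuous.intervalIntegrable (by fun_prop) _ _)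
        (Continuous.intervalIntegrable (by fun_prop) _ _), intervalIntegral.integral_const_mul, intervalIntegral.integral_const_mul,
        iS, iS2]
      simp; ring
    rw [e1, e2]
    have : 0 ≤ k ^ 2 * (a ^ 2 * (2 * l)) := by positivity
    nlinarith

/-! ### Efron–Stein -/

lemma efron_stein {S T : Type*} [MeasurableSpace S] [MeasurableSpace T] (μ : Measure S) (ν : Measure T)
    [IsFiniteMeasure μ] [IsFiniteMeasure ν] {w : S → ℝ} {f : S → T → ℝ} {b : T → ℝ} {M : ℝ}
    (hw : Measurable w) (hw0 : ∀ s, 0 ≤ w s) (hw1 : ∀ s, w s ≤ 1) (hf : Measurable (Function.uncurry f))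
    (hfM : ∀ s z, |f s z| ≤ M) (hb : Measurable b) (hbM : ∀ z, |b z| ≤ M) (ha : 0 < ∫ s, w s ∂μ)
    (hV : 0 < ν.real Set.univ)
    (h0 : ∫ s, w s * ∫ z, f s z ∂ν ∂μ = 0) :
    ∫ s, w s * ∫ z, f s z ^ 2 ∂ν ∂μ ≤ (∫ z, ∫ s, w s * (f s z - b z) ^ 2 ∂μ ∂ν)
      + ∫ s, w s * ∫ z, (f s z - (∫ y, f s y ∂ν) / ν.real Set.univ) ^ 2 ∂ν ∂μ := by
  set a := ∫ s, w s ∂μ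
  set V := ν.real Set.univ
  set m : S → ℝ := fun s => (∫ y, f s y ∂ν) / V with hm
  have mf : Measurable fun p : S × T => f p.1 p.2 := hf
  have mfs : ∀ z, Measurable fun s => f s z := fun z => hf.comp (measurable_id.prodMk measurable_const)
  have mfz : ∀ s, Measurable fun z => f s z := fun s => hf.comp (measurable_const.prodMk measurable_id)
  have mm : Measurable m := by
    have := (hf.stronglyMeasurable.integral_prod_right (ν := ν)).measurable
    exact this.div_const V
  have hM0 : ∀ s z, f s z ^ 2 ≤ M ^ 2 := fun s z => sq_le_sq' (by linarith [(abs_le.mp (hfM s z)).1]) (abs_le.mp (hfM s z)).2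
  have hmM : ∀ s, |m s| ≤ M := fun s => by
    simp only [hm]
    rw [abs_div, abs_of_pos hV, div_le_iff₀ hV, ← Real.norm_eq_abs]
    exact norm_integral_le_of_norm_le_const (ae_of_all _ fun z => hfM s z)
  have sqb : ∀ x y : ℝ, |x| ≤ M → |y| ≤ M → (x - y) ^ 2 ≤ (2 * M) ^ 2 := fun x y hx hy => by
    rw [abs_le] at hx hy
    apply sq_le_sq' <;> linarith
  have wabs : ∀ s (x C : ℝ), |x| ≤ C → ‖w s * x‖ ≤ C := fun s x C hx => by
    rw [Real.norm_eq_abs, abs_mul, abs_of_nonneg (hw0 s)]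
    calc w s * |x| ≤ 1 * |x| := by gcongr; exact hw1 s
      _ ≤ C := by rwa [one_mul]
  -- integrability
  have iw : Integrable w μ := Integrable.of_bound hw.aestronglyMeasurable 1
    (ae_of_all _ fun s => by rw [Real.norm_eq_abs, abs_of_nonneg (hw0 s)]; exact hw1 s)
  have iwf : ∀ z, Integrable (fun s => w s * f s z) μ := fun z =>
    Integrable.of_bound (hw.mul (mfs z)).aestronglyMeasurable M (ae_of_all _ fun s => wabs _ _ _ (hfM s z))
  have iwm : Integrable (fun s => w s * m s) μ :=
    Integrable.of_bound (hw.mul mm).aestronglyMeasurable M (ae_of_all _ fun s => wabs _ _ _ (hmM s))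
  have iwf2 : ∀ z, Integrable (fun s => w s * f s z ^ 2) μ := fun z =>
    Integrable.of_bound (hw.mul ((mfs z).pow_const 2)).aestronglyMeasurable (M ^ 2)
      (ae_of_all _ fun s => wabs _ _ _ (by rw [abs_of_nonneg (sq_nonneg _)]; exact hM0 s z))
  have iwfm2 : ∀ z, Integrable (fun s => w s * (f s z - m s) ^ 2) μ := fun z =>
    Integrable.of_bound (hw.mul (((mfs z).sub mm).pow_const 2)).aestronglyMeasurable ((2 * M) ^ 2)
      (ae_of_all _ fun s => wabs _ _ _ (by rw [abs_of_nonneg (sq_nonneg _)]; exact sqb _ _ (hfM s z) (hmM s)))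
  have J1 : Integrable (fun p : S × T => w p.1 * f p.1 p.2 ^ 2) (μ.prod ν) :=
    Integrable.of_bound ((hw.comp measurable_fst).mul (mf.pow_const 2)).aestronglyMeasurable (M ^ 2)
      (ae_of_all _ fun p => wabs _ _ _ (by rw [abs_of_nonneg (sq_nonneg _)]; exact hM0 _ _))
  have J2 : Integrable (fun p : S × T => w p.1 * (f p.1 p.2 - b p.2) ^ 2) (μ.prod ν) :=
    Integrable.of_bound ((hw.comp measurable_fst).mul ((mf.sub (hb.comp measurable_snd)).pow_const 2)).aestronglyMeasurable ((2 * M) ^ 2)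
      (ae_of_all _ fun p => wabs _ _ _ (by rw [abs_of_nonneg (sq_nonneg _)]; exact sqb _ _ (hfM _ _) (hbM _)))
  have J3 : Integrable (fun p : S × T => w p.1 * (f p.1 p.2 - m p.1) ^ 2) (μ.prod ν) :=
    Integrable.of_bound ((hw.comp measurable_fst).mul ((mf.sub (mm.comp measurable_fst)).pow_const 2)).aestronglyMeasurable ((2 * M) ^ 2)
      (ae_of_all _ fun p => wabs _ _ _ (by rw [abs_of_nonneg (sq_nonneg _)]; exact sqb _ _ (hfM _ _) (hmM _)))
  have hwm : ∫ s, w s * m s ∂μ = 0 := by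
    have : ∀ s, w s * m s = (w s * ∫ z, f s z ∂ν) / V := fun s => by simp only [hm]; ring
    simp only [this]
    rw [integral_div, h0, zero_div]
  -- pointwise inequality
  have pw : ∀ z, ∫ s, w s * f s z ^ 2 ∂μ ≤ (∫ s, w s * (f s z - b z) ^ 2 ∂μ) + ∫ s, w s * (f s z - m s) ^ 2 ∂μ := by
    intro z
    set A := ∫ s, w s * f s z ∂μ with hA
    have q1 : ∀ g : S → ℝ, ∀ c : ℝ, Integrable (fun s => w s * g s) μ → Integrable (fun s => w s * g s ^ 2) μ →
        ∫ s, w s * (g s - c) ^ 2 ∂μ = (∫ s, w s * g s ^ 2 ∂μ) - 2 * c * (∫ s, w s * g s ∂μ) + c ^ 2 * a := by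
      intro g c i1 i2
      have : ∀ s, w s * (g s - c) ^ 2 = (w s * g s ^ 2 - (2 * c) * (w s * g s)) + c ^ 2 * w s := fun s => by ring
      simp only [this]
      have i3 : Integrable (fun s => w s * g s ^ 2 - (2 * c) * (w s * g s)) μ := i2.sub (i1.const_mul _)
      rw [integral_add i3 (iw.const_mul _), integral_sub i2 (i1.const_mul _), integral_const_mul,
        integral_const_mul]
    have i1 : Integrable (fun s => w s * (f s z - m s)) μ := by
      refine ((iwf z).sub iwm).congr (ae_of_all _ fun s => ?_)
      simp only [Pi.sub_apply]; ring
    have hA2 : ∫ s, w s * (f s z - m s) ∂μ = A := by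
      have : ∀ s, w s * (f s z - m s) = w s * f s z - w s * m s := fun s => by ring
      simp only [this]
      rw [integral_sub (iwf z) iwm, hwm, sub_zero]
    have r1 := q1 (fun s => f s z) (b z) (iwf z) (iwf2 z)
    have r2 := q1 (fun s => f s z - m s) (A / a) i1 (iwfm2 z)
    have r3 : 0 ≤ ∫ s, w s * ((f s z - m s) - A / a) ^ 2 ∂μ :=
      integral_nonneg fun s => mul_nonneg (hw0 s) (sq_nonneg _)
    simp only [hA2] at r2
    simp only [← hA] at r1
    rw [r2] at r3
    rw [r1]
    have e : (A / a) ^ 2 * a = A ^ 2 / a := by field_simp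
    have e' : 2 * (A / a) * A = 2 * (A ^ 2 / a) := by field_simp
    rw [e, e'] at r3
    have : 0 ≤ (A - b z * a) ^ 2 / a := by positivity
    have e2 : (A - b z * a) ^ 2 / a = A ^ 2 / a - 2 * b z * A + b z ^ 2 * a := by field_simp; ring
    rw [e2] at this
    linarith
  have sw1 : ∫ s, w s * ∫ z, f s z ^ 2 ∂ν ∂μ = ∫ z, ∫ s, w s * f s z ^ 2 ∂μ ∂ν := by
    rw [← integral_integral_swap J1]
    simp only [integral_const_mul]
  have sw3 : ∫ s, w s * ∫ z, (f s z - m s) ^ 2 ∂ν ∂μ = ∫ z, ∫ s, w s * (f s z - m s) ^ 2 ∂μ ∂ν := by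
    rw [← integral_integral_swap J3]
    simp only [integral_const_mul]
  rw [sw1]
  change _ ≤ _ + ∫ s, w s * ∫ z, (f s z - m s) ^ 2 ∂ν ∂μ
  rw [sw3, ← integral_add J2.integral_prod_right J3.integral_prod_right]
  exact integral_mono J1.integral_prod_right (J2.integral_prod_right.add J3.integral_prod_right) pw

lemma efron_stein_on {S T : Type*} [MeasurableSpace S] [MeasurableSpace T] (μ : Measure S) (ν : Measure T)
    {S0 : Set S} {T0 : Set T} (hS : MeasurableSet S0) (hT : MeasurableSet T0) (hμ : μ S0 ≠ ⊤) (hν : ν T0 ≠ ⊤)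
    {w : S → ℝ} {f : S → T → ℝ} {b : T → ℝ} {M : ℝ} (hM : 0 ≤ M)
    (hw : Measurable w) (hw0 : ∀ s, 0 ≤ w s) (hw1 : ∀ s, w s ≤ 1) (hf : Measurable (Function.uncurry f))
    (hfM : ∀ s ∈ S0, ∀ z ∈ T0, |f s z| ≤ M) (hb : Measurable b) (hbM : ∀ z ∈ T0, |b z| ≤ M)
    (ha : 0 < ∫ s in S0, w s ∂μ) (hV : 0 < (ν T0).toReal)
    (h0 : ∫ s in S0, w s * ∫ z in T0, f s z ∂ν ∂μ = 0) :
    ∫ s in S0, w s * ∫ z in T0, f s z ^ 2 ∂ν ∂μ ≤ (∫ z in T0, ∫ s in S0, w s * (f s z - b z) ^ 2 ∂μ ∂ν)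
      + ∫ s in S0, w s * ∫ z in T0, (f s z - (∫ y in T0, f s y ∂ν) / (ν T0).toReal) ^ 2 ∂ν ∂μ := by
  haveI : IsFiniteMeasure (μ.restrict S0) := isFiniteMeasure_restrict.mpr hμ
  haveI : IsFiniteMeasure (ν.restrict T0) := isFiniteMeasure_restrict.mpr hν
  let cl : ℝ → ℝ := fun x => max (-M) (min M x)
  have ccl : Continuous cl := by fun_prop
  have clM : ∀ x, |cl x| ≤ M := fun x => by
    rw [abs_le]; exact ⟨le_max_left _ _, max_le (by linarith) (min_le_left _ _)⟩
  have cle : ∀ x, |x| ≤ M → cl x = x := fun x hx => by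
    rw [abs_le] at hx
    simp only [cl]
    rw [min_eq_right hx.2, max_eq_right hx.1]
  have hr : (ν.restrict T0).real Set.univ = (ν T0).toReal := by simp [Measure.real]
  have ef : ∀ s ∈ S0, ∀ z ∈ T0, cl (f s z) = f s z := fun s hs z hz => cle _ (hfM s hs z hz)
  have eb : ∀ z ∈ T0, cl (b z) = b z := fun z hz => cle _ (hbM z hz)
  have em : ∀ s ∈ S0, ∫ z in T0, cl (f s z) ∂ν = ∫ z in T0, f s z ∂ν := fun s hs =>
    setIntegral_congr_fun hT fun z hz => ef s hs z hz
  have key := efron_stein (μ.restrict S0) (ν.restrict T0) (f := fun s z => cl (f s z)) (b := fun z => cl (b z)) (M := M)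
    hw hw0 hw1 (ccl.measurable.comp hf) (fun s z => clM _) (ccl.measurable.comp hb) (fun z => clM _) ha (by rw [hr]; exact hV)
    (by
      rw [← h0]
      refine setIntegral_congr_fun hS fun s hs => ?_
      rw [em s hs])
  rw [hr] at key
  have e1 : ∫ s in S0, w s * ∫ z in T0, cl (f s z) ^ 2 ∂ν ∂μ = ∫ s in S0, w s * ∫ z in T0, f s z ^ 2 ∂ν ∂μ := by
    refine setIntegral_congr_fun hS fun s hs => ?_
    congr 1
    refine setIntegral_congr_fun hT fun z hz => ?_
    simp only [ef s hs z hz]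
  have e2 : ∫ z in T0, ∫ s in S0, w s * (cl (f s z) - cl (b z)) ^ 2 ∂μ ∂ν = ∫ z in T0, ∫ s in S0, w s * (f s z - b z) ^ 2 ∂μ ∂ν := by
    refine setIntegral_congr_fun hT fun z hz => ?_
    refine setIntegral_congr_fun hS fun s hs => ?_
    simp only [ef s hs z hz, eb z hz]
  have e3 : ∫ s in S0, w s * ∫ z in T0, (cl (f s z) - (∫ y in T0, cl (f s y) ∂ν) / (ν T0).toReal) ^ 2 ∂ν ∂μ
      = ∫ s in S0, w s * ∫ z in T0, (f s z - (∫ y in T0, f s y ∂ν) / (ν T0).toReal) ^ 2 ∂ν ∂μ := by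
    refine setIntegral_congr_fun hS fun s hs => ?_
    congr 1
    rw [em s hs]
    refine setIntegral_congr_fun hT fun z hz => ?_
    simp only [ef s hs z hz]
  rw [e1, e2, e3] at key
  exact key

/-! ### Double cone -/

/-- double cone -/
def dcone (n : ℕ) (ε : ℝ) : Set (Euc (n+1)) := {x | ‖tl x‖ + ε * |x 0| < ε}

lemma dcone_dom {n : ℕ} {ε : ℝ} (hε : 0 < ε) : IsConvexDomain (dcone n ε) := by
  have c0 : Continuous fun x : Euc (n+1) => x 0 := by fun_prop
  refine ⟨⟨0, by simp [dcone, hε]⟩, ?_, ?_, ?_⟩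
  · exact isOpen_lt (tl.continuous.norm.add (c0.abs.const_mul ε)) continuous_const
  · rw [isBounded_iff_forall_norm_le]
    refine ⟨ε + 1, fun x hx => ?_⟩
    have h := cn_norm (x 0, tl x)
    rw [cn_tl] at h
    have hx' : ‖tl x‖ + ε * |x 0| < ε := hx
    simp only at h
    rw [← sq_abs (x 0)] at h
    have h1 : |x 0| < 1 := by
      by_contra! h1
      nlinarith [norm_nonneg (tl x)]
    have h2 : ‖tl x‖ < ε := by nlinarith [abs_nonneg (x 0)]
    nlinarith [norm_nonneg x, norm_nonneg (tl x), abs_nonneg (x 0)]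
  · rintro x hx y hy a b ha hb hab
    have key := (convex_Iio ε) (show ‖tl x‖ + ε * |x 0| ∈ Set.Iio ε from hx) (show ‖tl y‖ + ε * |y 0| ∈ Set.Iio ε from hy) ha hb hab
    refine lt_of_le_of_lt ?_ (Set.mem_Iio.mp key)
    have h1 : ‖tl (a • x + b • y)‖ ≤ a * ‖tl x‖ + b * ‖tl y‖ := by
      rw [map_add, map_smul, map_smul]
      refine (norm_add_le _ _).trans_eq ?_
      rw [norm_smul, norm_smul, Real.norm_eq_abs, Real.norm_eq_abs, abs_of_nonneg ha, abs_of_nonneg hb]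
    have h2 : |(a • x + b • y : Euc (n+1)) 0| ≤ a * |x 0| + b * |y 0| := by
      have : (a • x + b • y : Euc (n+1)) 0 = a * x 0 + b * y 0 := by simp
      rw [this]
      refine (abs_add_le _ _).trans_eq ?_
      rw [abs_mul, abs_mul, abs_of_nonneg ha, abs_of_nonneg hb]
    simp only [smul_eq_mul]
    nlinarith

lemma cyl_sub_dcone {n : ℕ} {ε δ : ℝ} (hε : 0 < ε) : cyl n (1 - δ) (ε * δ) ⊆ dcone n ε := by
  rintro x ⟨h1, h2⟩
  change ‖tl x‖ + ε * |x 0| < ε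
  nlinarith

/-- radius -/
def rr (s : ℝ) : ℝ := max 0 (1 - |s|)

lemma rr_cont : Continuous rr := by unfold rr; fun_prop
lemma rr_nonneg (s : ℝ) : 0 ≤ rr s := le_max_left _ _
lemma rr_le (s : ℝ) : rr s ≤ 1 := max_le zero_le_one (by linarith [abs_nonneg s])
lemma rr_eq {s : ℝ} (h : |s| ≤ 1) : rr s = 1 - |s| := max_eq_right (by linarith)

/-- parametrisation -/
def Ph {n : ℕ} (s : ℝ) (z : Euc n) : Euc (n+1) := cn (s, rr s • z)

lemma Ph_cont {n : ℕ} : Continuous fun p : ℝ × Euc n => Ph p.1 p.2 := by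
  unfold Ph
  have := rr_cont
  fun_prop

lemma cone_int {n : ℕ} {ε : ℝ} (hε : 0 < ε) {F : Euc (n+1) → ℝ} (hF : Continuous F) :
    ∫ x in dcone n ε, F x = ∫ s in Set.Ioo (-1) 1, rr s ^ n * ∫ z in Metric.ball (0 : Euc n) ε, F (Ph s z) := by
  rw [cn_integral]
  set E := cn ⁻¹' (dcone n ε) with hE
  have hEm : MeasurableSet E := (dcone_dom (n := n) hε).2.1.measurableSet.preimage cn.continuous.measurable
  have hEx : ∀ p : ℝ × Euc n, p ∈ E ↔ ‖p.2‖ + ε * |p.1| < ε := fun p => by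
    simp [hE, dcone]
  have hInteg : IntegrableOn (fun p => F (cn p)) E (volume.prod volume) :=
    (cn_mp.integrableOn_comp_preimage cn_emb).mpr (cont_integrableOn (dcone_dom hε).2.2.1 hF)
  rw [← integral_indicator hEm, integral_prod _ (hInteg.integrable_indicator hEm)]
  rw [← setIntegral_eq_integral_of_forall_compl_eq_zero (s := Set.Ioo (-1) 1)]
  · refine setIntegral_congr_fun measurableSet_Ioo fun s hs => ?_
    have hs' : |s| < 1 := abs_lt.mpr hs
    have hr : rr s = 1 - |s| := rr_eq hs'.le
    have hr0 : 0 < rr s := by rw [hr]; linarith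
    have h1 : (fun y : Euc n => E.indicator (fun p => F (cn p)) (s, y))
        = (Metric.ball (0 : Euc n) (rr s * ε)).indicator (fun y => F (cn (s, y))) := by
      funext y
      have : (s, y) ∈ E ↔ y ∈ Metric.ball (0 : Euc n) (rr s * ε) := by
        rw [hEx, hr, mem_ball_zero_iff]
        constructor <;> intro h <;> simp only at * <;> linarith
      by_cases h : (s, y) ∈ E
      · rw [Set.indicator_of_mem h, Set.indicator_of_mem (this.mp h)]
      · rw [Set.indicator_of_notMem h, Set.indicator_of_notMem (mt this.mpr h)]
    rw [h1, integral_indicator Metric.isOpen_ball.measurableSet]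
    have h2 := Measure.setIntegral_comp_smul_of_pos (volume : Measure (Euc n)) (fun y => F (cn (s, y)))
      (Metric.ball (0 : Euc n) ε) hr0
    rw [smul_ball hr0.ne', smul_zero, Real.norm_eq_abs, abs_of_pos hr0] at h2
    simp only [Ph]
    rw [h2]
    simp only [finrank_euclideanSpace, Fintype.card_fin, smul_eq_mul]
    rw [mul_inv_cancel_left₀ (pow_pos hr0 n).ne']
  · intro s hs
    have : ∀ y : Euc n, E.indicator (fun p => F (cn p)) (s, y) = 0 := fun y => by
      rw [Set.indicator_of_notMem]
      rw [hEx]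
      intro h
      apply hs
      rw [Set.mem_Ioo, ← abs_lt]
      by_contra! h1
      simp only at h
      nlinarith [norm_nonneg y]
    simp [this]

lemma half_int {g : ℝ → ℝ} (hg : Continuous g) :
    ∫ s in Set.Ioo (-1) 1, g s = (∫ r in (0:ℝ)..1, g (1 * (1 - r))) + ∫ r in (0:ℝ)..1, g ((-1) * (1 - r)) := by
  rw [← integral_Ioc_eq_integral_Ioo, ← intervalIntegral.integral_of_le (by norm_num),
    ← intervalIntegral.integral_add_adjacent_intervals (hg.intervalIntegrable (-1) 0) (hg.intervalIntegrable 0 1)]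
  have h1 : ∫ r in (0:ℝ)..1, g (1 * (1 - r)) = ∫ s in (0:ℝ)..1, g s := by
    have := intervalIntegral.integral_comp_sub_left (a := 0) (b := 1) g 1
    simpa using this
  have h2 : ∫ r in (0:ℝ)..1, g ((-1) * (1 - r)) = ∫ s in (-1:ℝ)..0, g s := by
    have := intervalIntegral.integral_comp_sub_right (a := 0) (b := 1) g 1
    simpa using this
  rw [h1, h2]; ring

lemma long_half {n : ℕ} (hn : 1 ≤ n) {κ ε σ : ℝ} (hκ : 0 < κ) (hκj : κ < bj n) (hσ : |σ| = 1)
    {u : Euc (n+1) → ℝ} (hu : ContDiff ℝ (⊤ : ℕ∞) u) {z : Euc n} (hz : ‖z‖ ≤ ε) :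
    κ ^ 2 * ∫ r in (0:ℝ)..1, rr (σ * (1 - r)) ^ n * (u (Ph (σ * (1 - r)) z) - u (Ph 0 z)) ^ 2
      ≤ (1 + ε ^ 2) * ∫ r in (0:ℝ)..1, rr (σ * (1 - r)) ^ n * ‖fderiv ℝ u (Ph (σ * (1 - r)) z)‖ ^ 2 := by
  have hrr : ∀ r ∈ Set.uIcc (0:ℝ) 1, rr (σ * (1 - r)) = r := fun r hr => by
    rw [Set.uIcc_of_le zero_le_one] at hr
    have : |σ * (1 - r)| = 1 - r := by rw [abs_mul, hσ, one_mul, abs_of_nonneg (by linarith [hr.2])]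
    rw [rr_eq (by rw [this]; linarith [hr.1]), this]; ring
  have hP0 : Ph 0 z = cn (0, z) := by simp [Ph, rr]
  set γ : ℝ → Euc (n+1) := fun r => cn (σ * (1 - r), r • z) with hγ
  set τ : Euc (n+1) := cn (-σ, z)
  have dγ : ∀ r, HasDerivAt γ τ r := fun r => by
    have h1 : HasDerivAt (fun r : ℝ => σ * (1 - r)) (-σ) r :=
      (((hasDerivAt_id r).const_sub 1).const_mul σ).congr_deriv (by simp)
    have h2 : HasDerivAt (fun r : ℝ => r • z) z r :=
      ((hasDerivAt_id r).smul_const z).congr_deriv (by simp)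
    exact (cn (n := n)).hasFDerivAt.comp_hasDerivAt r (h1.prodMk h2)
  have cdu := smooth_fderiv_cont hu
  have cγ : Continuous γ := continuous_iff_continuousAt.2 fun r => (dγ r).continuousAt
  set h : ℝ → ℝ := fun r => u (γ r) - u (cn (0, z))
  set h1 : ℝ → ℝ := fun r => fderiv ℝ u (γ r) τ
  have hh : ∀ r, HasDerivAt h (h1 r) r := fun r =>
    (((hu.differentiable (by simp) (γ r)).hasFDerivAt).comp_hasDerivAt r (dγ r)).sub_const _
  have ch1 : Continuous h1 := (cdu.comp cγ).clm_apply continuous_const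
  have hz1 : h 1 = 0 := by simp [h, hγ]
  have hpos : ∀ r ∈ Set.Icc (0:ℝ) 1, 0 < bf n κ r := fun r hr => by
    rw [bf_scale]
    refine (bj_spec hn).2.2 _ (mul_nonneg hκ.le hr.1) ?_
    nlinarith [hr.2]
  have pic := picone_ball hn zero_le_one hpos hh ch1 hz1
  have e1 : ∫ r in (0:ℝ)..1, rr (σ * (1 - r)) ^ n * (u (Ph (σ * (1 - r)) z) - u (Ph 0 z)) ^ 2
      = ∫ r in (0:ℝ)..1, r ^ n * h r ^ 2 := by
    refine intervalIntegral.integral_congr fun r hr => ?_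
    simp only [Ph, hrr r hr, h, hγ]
    simp [rr]
  have e2 : ∫ r in (0:ℝ)..1, rr (σ * (1 - r)) ^ n * ‖fderiv ℝ u (Ph (σ * (1 - r)) z)‖ ^ 2
      = ∫ r in (0:ℝ)..1, r ^ n * ‖fderiv ℝ u (γ r)‖ ^ 2 := by
    refine intervalIntegral.integral_congr fun r hr => ?_
    simp only [Ph, hrr r hr, hγ]
  rw [e1, e2]
  refine pic.trans ?_
  rw [← intervalIntegral.integral_const_mul]
  refine intervalIntegral.integral_mono_on zero_le_one (Continuous.intervalIntegrable (by fun_prop) _ _)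
    (Continuous.intervalIntegrable (by fun_prop) _ _) fun r hr => ?_
  have hτ : ‖τ‖ ^ 2 ≤ 1 + ε ^ 2 := by
    rw [cn_norm]
    simp only [neg_sq]
    rw [← sq_abs, hσ, one_pow]
    gcongr
  have hb : h1 r ^ 2 ≤ (1 + ε ^ 2) * ‖fderiv ℝ u (γ r)‖ ^ 2 := by
    have := (fderiv ℝ u (γ r)).le_opNorm τ
    calc h1 r ^ 2 = ‖fderiv ℝ u (γ r) τ‖ ^ 2 := by rw [Real.norm_eq_abs, sq_abs]
      _ ≤ (‖fderiv ℝ u (γ r)‖ * ‖τ‖) ^ 2 := by gcongr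
      _ = ‖τ‖ ^ 2 * ‖fderiv ℝ u (γ r)‖ ^ 2 := by ring
      _ ≤ _ := by gcongr
  have hrn : 0 ≤ r ^ n := pow_nonneg hr.1 n
  calc r ^ n * h1 r ^ 2 ≤ r ^ n * ((1 + ε ^ 2) * ‖fderiv ℝ u (γ r)‖ ^ 2) := by gcongr
    _ = _ := by ring

lemma long_full {n : ℕ} (hn : 1 ≤ n) {κ ε : ℝ} (hκ : 0 < κ) (hκj : κ < bj n)
    {u : Euc (n+1) → ℝ} (hu : ContDiff ℝ (⊤ : ℕ∞) u) {z : Euc n} (hz : ‖z‖ ≤ ε) :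
    κ ^ 2 * ∫ s in Set.Ioo (-1) 1, rr s ^ n * (u (Ph s z) - u (Ph 0 z)) ^ 2
      ≤ (1 + ε ^ 2) * ∫ s in Set.Ioo (-1) 1, rr s ^ n * ‖fderiv ℝ u (Ph s z)‖ ^ 2 := by
  have cu := hu.continuous
  have cdu := smooth_fderiv_cont hu
  have cP : Continuous fun s => Ph s z := Ph_cont.comp (continuous_id.prodMk continuous_const)
  have cr := rr_cont
  rw [half_int (g := fun s => rr s ^ n * (u (Ph s z) - u (Ph 0 z)) ^ 2) (by fun_prop),
    half_int (g := fun s => rr s ^ n * ‖fderiv ℝ u (Ph s z)‖ ^ 2) (by fun_prop), mul_add, mul_add]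
  exact add_le_add (long_half hn hκ hκj (by simp) hu hz) (long_half hn hκ hκj (by simp) hu hz)

lemma trans_ineq {n : ℕ} (hn : 1 ≤ n) {ε : ℝ} (hε : 0 < ε) {u : Euc (n+1) → ℝ} (hu : ContDiff ℝ (⊤ : ℕ∞) u) (s : ℝ) :
    ∫ z in Metric.ball (0 : Euc n) ε, (u (Ph s z) - (∫ y in Metric.ball (0 : Euc n) ε, u (Ph s y)) /
        (volume (Metric.ball (0 : Euc n) ε)).toReal) ^ 2
      ≤ (2 * ε / π) ^ 2 * ∫ z in Metric.ball (0 : Euc n) ε, ‖fderiv ℝ u (Ph s z)‖ ^ 2 := by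
  have hΩ : IsConvexDomain (Metric.ball (0 : Euc n) ε) :=
    ⟨⟨0, by simpa using hε⟩, Metric.isOpen_ball, Metric.isBounded_ball, convex_ball _ _⟩
  have hVt : volume (Metric.ball (0 : Euc n) ε) ≠ ⊤ := measure_ball_lt_top.ne
  have hV : 0 < (volume (Metric.ball (0 : Euc n) ε)).toReal :=
    ENNReal.toReal_pos (Metric.measure_ball_pos _ _ hε).ne' hVt
  set B := Metric.ball (0 : Euc n) ε
  set V := (volume B).toReal
  set c := (∫ y in B, u (Ph s y)) / V with hc
  set L : Euc n →L[ℝ] Euc (n+1) := cn.comp (rr s • ContinuousLinearMap.inr ℝ ℝ (Euc n)) with hL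
  have hLz : ∀ z, Ph s z = cn (s, 0) + L z := fun z => by
    simp only [Ph, hL, ContinuousLinearMap.comp_apply, ContinuousLinearMap.smul_apply, ContinuousLinearMap.inr_apply]
    rw [← map_add]; congr 1; ext <;> simp
  have hLn : ‖L‖ ≤ 1 := by
    apply ContinuousLinearMap.opNorm_le_bound _ zero_le_one
    intro z
    have h1 : ‖L z‖ ^ 2 = (rr s * ‖z‖) ^ 2 := by
      simp only [hL, ContinuousLinearMap.comp_apply, ContinuousLinearMap.smul_apply, ContinuousLinearMap.inr_apply]
      rw [cn_norm]
      simp [norm_smul, abs_of_nonneg (rr_nonneg s)]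
    have h2 : ‖L z‖ = rr s * ‖z‖ := (sq_eq_sq₀ (norm_nonneg _) (mul_nonneg (rr_nonneg s) (norm_nonneg _))).mp h1
    rw [h2]
    gcongr
    exact rr_le s
  set f : Euc n → ℝ := fun z => u (Ph s z) - c with hf
  have hfs : ContDiff ℝ (⊤ : ℕ∞) f := by
    have : f = fun z => u (cn (s, 0) + L z) - c := by funext z; simp only [hf, hLz]
    rw [this]; fun_prop
  have hfd : ∀ z, fderiv ℝ f z = (fderiv ℝ u (Ph s z)).comp L := fun z => by
    have h1 : HasFDerivAt (fun z => cn (s, 0) + L z) L z := L.hasFDerivAt.const_add _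
    have h2 : HasFDerivAt (fun z => Ph s z) L z := by
      have : (fun z => Ph s z) = fun z => cn (s, 0) + L z := by funext z; exact hLz z
      rw [this]; exact h1
    have h3 := ((hu.differentiable (by simp) (Ph s z)).hasFDerivAt.comp z h2).sub_const c
    exact h3.fderiv
  have cu := hu.continuous
  have cdu := smooth_fderiv_cont hu
  have cP : Continuous fun z : Euc n => Ph s z := Ph_cont.comp (continuous_const.prodMk continuous_id)
  have iu : IntegrableOn (fun z => u (Ph s z)) B := cont_integrableOn hΩ.2.2.1 (by fun_prop)
  have h0 : ∫ z in B, f z = 0 := by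
    simp only [hf]
    rw [integral_sub iu (integrableOn_const hVt)]
    simp only [integral_const, smul_eq_mul, Measure.real, Measure.restrict_apply_univ]
    change _ - V * c = 0
    rw [hc]; field_simp; ring
  have key := pw_ineq (by omega) hΩ (by positivity : 0 < 2 * ε) (fun x hx y hy => by
    have hx' : ‖x‖ < ε := by simpa [B] using hx
    have hy' : ‖y‖ < ε := by simpa [B] using hy
    rw [dist_eq_norm]
    linarith [norm_sub_le x y]) hfs h0
  have k2 : ∫ z in B, ‖fderiv ℝ f z‖ ^ 2 ≤ ∫ z in B, ‖fderiv ℝ u (Ph s z)‖ ^ 2 := by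
    refine integral_mono (smooth_grad_int hΩ.2.2.1 hfs) (cont_integrableOn hΩ.2.2.1 (by fun_prop)) fun z => ?_
    simp only [hfd]
    gcongr
    refine (ContinuousLinearMap.opNorm_comp_le _ _).trans ?_
    exact mul_le_of_le_one_right (norm_nonneg _) hLn
  have k3 := key.trans k2
  have e : (2 * ε / π) ^ 2 * (π / (2 * ε)) ^ 2 = 1 := by field_simp
  calc ∫ z in B, f z ^ 2 = (2 * ε / π) ^ 2 * ((π / (2 * ε)) ^ 2 * ∫ z in B, f z ^ 2) := by
        rw [← mul_assoc, e, one_mul]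
    _ ≤ _ := by gcongr

lemma cont_prod_int {n : ℕ} (ε : ℝ) {g : ℝ × Euc n → ℝ} (hg : Continuous g) :
    Integrable g ((volume.restrict (Set.Ioo (-1) 1)).prod (volume.restrict (Metric.ball (0 : Euc n) ε))) := by
  rw [Measure.prod_restrict]
  have hK : IsCompact (Set.Icc (-1:ℝ) 1 ×ˢ Metric.closedBall (0 : Euc n) ε) :=
    isCompact_Icc.prod (isCompact_closedBall _ _)
  have : IntegrableOn g (Set.Icc (-1:ℝ) 1 ×ˢ Metric.closedBall (0 : Euc n) ε) (volume.prod volume) :=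
    hg.continuousOn.integrableOn_compact hK
  exact this.mono_set (Set.prod_mono Set.Ioo_subset_Icc_self Metric.ball_subset_closedBall)

lemma dcone_ineq {n : ℕ} (hn : 1 ≤ n) {κ ε : ℝ} (hε : 0 < ε) (hκ : 0 < κ) (hκj : κ < bj n)
    {u : Euc (n+1) → ℝ} (hu : ContDiff ℝ (⊤ : ℕ∞) u) (h0 : ∫ x in dcone n ε, u x = 0) :
    ∫ x in dcone n ε, u x ^ 2 ≤ ((1 + ε ^ 2) / κ ^ 2 + (2 * ε / π) ^ 2) * ∫ x in dcone n ε, ‖fderiv ℝ u x‖ ^ 2 := by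
  have cu := hu.continuous
  have cdu := smooth_fderiv_cont hu
  have cG : Continuous fun x => ‖fderiv ℝ u x‖ ^ 2 := by fun_prop
  have cr := rr_cont
  have cP : Continuous fun p : ℝ × Euc n => Ph p.1 p.2 := Ph_cont
  have cPz : ∀ z : Euc n, Continuous fun s => Ph s z := fun z => Ph_cont.comp (continuous_id.prodMk continuous_const)
  rw [cone_int hε (F := fun x => u x ^ 2) (by fun_prop), cone_int hε cG]
  rw [cone_int hε cu] at h0
  have hVt : volume (Metric.ball (0 : Euc n) ε) ≠ ⊤ := measure_ball_lt_top.ne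
  have hV : 0 < (volume (Metric.ball (0 : Euc n) ε)).toReal :=
    ENNReal.toReal_pos (Metric.measure_ball_pos _ _ hε).ne' hVt
  set B := Metric.ball (0 : Euc n) ε with hB
  set I := Set.Ioo (-1:ℝ) 1 with hI
  have hK : IsCompact (Set.Icc (-1:ℝ) 1 ×ˢ Metric.closedBall (0 : Euc n) ε) :=
    isCompact_Icc.prod (isCompact_closedBall _ _)
  obtain ⟨M0, hM0⟩ := hK.exists_bound_of_continuousOn (f := fun p : ℝ × Euc n => u (Ph p.1 p.2))
    (by fun_prop : Continuous fun p : ℝ × Euc n => u (Ph p.1 p.2)).continuousOn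
  have hM : ∀ s ∈ I, ∀ z ∈ B, |u (Ph s z)| ≤ max M0 0 := fun s hs z hz =>
    (hM0 (s, z) ⟨Set.Ioo_subset_Icc_self hs, Metric.ball_subset_closedBall hz⟩).trans (le_max_left _ _)
  have ha : 0 < ∫ s in I, rr s ^ n := by
    rw [hI, ← integral_Ioc_eq_integral_Ioo, ← intervalIntegral.integral_of_le (by norm_num)]
    refine intervalIntegral.integral_pos (by norm_num) (by fun_prop) (fun s _ => pow_nonneg (rr_nonneg s) n)
      ⟨0, by norm_num, ?_⟩
    simp [rr]
  have es := efron_stein_on (volume : Measure ℝ) (volume : Measure (Euc n)) (S0 := I) (T0 := B)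
    measurableSet_Ioo Metric.isOpen_ball.measurableSet (by simp [hI]) hVt (w := fun s => rr s ^ n)
    (f := fun s z => u (Ph s z)) (b := fun z => u (Ph 0 z)) (M := max M0 0) (le_max_right _ _)
    (by fun_prop : Continuous fun s => rr s ^ n).measurable (fun s => pow_nonneg (rr_nonneg s) n)
    (fun s => pow_le_one₀ (rr_nonneg s) (rr_le s))
    (by fun_prop : Continuous fun p : ℝ × Euc n => u (Ph p.1 p.2)).measurable hM
    (cu.comp (Ph_cont.comp (continuous_const.prodMk continuous_id))).measurable
    (fun z hz => hM 0 (by simp [hI]) z hz) ha hV h0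
  refine es.trans ?_
  rw [add_mul]
  have iG : Integrable (fun p : ℝ × Euc n => rr p.1 ^ n * ‖fderiv ℝ u (Ph p.1 p.2)‖ ^ 2)
      ((volume.restrict I).prod (volume.restrict B)) := cont_prod_int ε (by fun_prop)
  have iD : Integrable (fun p : ℝ × Euc n => rr p.1 ^ n * (u (Ph p.1 p.2) - u (Ph 0 p.2)) ^ 2)
      ((volume.restrict I).prod (volume.restrict B)) := by
    apply cont_prod_int ε
    have : Continuous fun p : ℝ × Euc n => Ph 0 p.2 := Ph_cont.comp (continuous_const.prodMk continuous_snd)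
    fun_prop
  have sw : ∫ s in I, rr s ^ n * ∫ z in B, ‖fderiv ℝ u (Ph s z)‖ ^ 2
      = ∫ z in B, ∫ s in I, rr s ^ n * ‖fderiv ℝ u (Ph s z)‖ ^ 2 := by
    rw [← integral_integral_swap iG]
    simp only [integral_const_mul]
  apply add_le_add
  · rw [sw, ← integral_const_mul]
    refine setIntegral_mono_on iD.integral_prod_right (iG.integral_prod_right.const_mul _) Metric.isOpen_ball.measurableSet fun z hz => ?_
    have hz' : ‖z‖ ≤ ε := (by simpa [hB] using hz : ‖z‖ < ε).le
    have := long_full hn hκ hκj hu hz'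
    rw [div_mul_eq_mul_div, le_div_iff₀ (by positivity), mul_comm]
    exact this
  · rw [← integral_const_mul]
    refine integral_mono_of_nonneg (ae_of_all _ fun s => ?_) ?_ (ae_of_all _ fun s => ?_)
    · exact mul_nonneg (pow_nonneg (rr_nonneg s) n) (integral_nonneg fun z => sq_nonneg _)
    · have := iG.integral_prod_left
      simp only [integral_const_mul] at this
      exact this.const_mul _
    · have := mul_le_mul_of_nonneg_left (trans_ineq hn hε hu s) (pow_nonneg (rr_nonneg s) n)
      refine this.trans_eq ?_
      ring

lemma dcone_lower {n : ℕ} (hn : 1 ≤ n) {κ ε : ℝ} (hε : 0 < ε) (hκ : 0 < κ) (hκj : κ < bj n) :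
    ((1 + ε ^ 2) / κ ^ 2 + (2 * ε / π) ^ 2)⁻¹ ≤ neumannEigenvalue 1 (dcone n ε) := by
  refine ne_lower (by omega) (dcone_dom hε) fun u hu h0 => ?_
  have hC : 0 < (1 + ε ^ 2) / κ ^ 2 + (2 * ε / π) ^ 2 := by positivity
  rw [inv_mul_le_iff₀ hC]
  exact dcone_ineq hn hε hκ hκj hu h0

lemma ratio_sharp {n : ℕ} (hn : 1 ≤ n) {t : ℝ} (ht : 0 < t) (ht1 : t < 1) :
    ∃ Ω₁ Ω₂ : Set (Euc (n+1)), IsConvexDomain Ω₁ ∧ IsConvexDomain Ω₂ ∧ Ω₁ ⊆ Ω₂ ∧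
      neumannEigenvalue 1 Ω₁ / neumannEigenvalue 1 Ω₂ ≤
        (π / (2 * (1 - t))) ^ 2 * ((1 + t ^ 2) / (bj n * (1 - t)) ^ 2 + (2 * t / π) ^ 2) := by
  have hj := (bj_spec hn).1
  have h1t : 0 < 1 - t := by linarith
  refine ⟨cyl n (1 - t) (t * t), dcone n t, cyl_dom h1t (by positivity), dcone_dom ht, cyl_sub_dcone ht, ?_⟩
  have hκ : 0 < bj n * (1 - t) := by positivity
  have up := cyl_upper (n := n) (l := 1 - t) (ρ := t * t) h1t (by positivity)
  have lo := dcone_lower hn ht hκ (by nlinarith)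
  have hC : 0 < (1 + t ^ 2) / (bj n * (1 - t)) ^ 2 + (2 * t / π) ^ 2 := by positivity
  have hμ : 0 < neumannEigenvalue 1 (dcone n t) := (inv_pos.mpr hC).trans_le lo
  rw [div_le_iff₀ hμ]
  refine up.trans ?_
  rw [mul_assoc]
  have h1 := (inv_le_iff_one_le_mul₀ hC).mp lo
  rw [mul_comm] at h1
  exact le_mul_of_one_le_right (sq_nonneg _) h1

lemma alpha_main {n : ℕ} (hn : 1 ≤ n) : alphaConst 1 (n+1) = π ^ 2 / (4 * bj n ^ 2) := by
  have hj := (bj_spec hn).1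
  have hlow : ∀ r ∈ { r : ℝ | ∃ Ω₁ Ω₂ : Set (Euc (n+1)), IsConvexDomain Ω₁ ∧ IsConvexDomain Ω₂ ∧ Ω₁ ⊆ Ω₂ ∧
    r = neumannEigenvalue 1 Ω₁ / neumannEigenvalue 1 Ω₂ }, π ^ 2 / (4 * bj n ^ 2) ≤ r := by
    rintro _ ⟨Ω₁, Ω₂, h1, h2, hs, rfl⟩
    exact ratio_lower hn h1 h2 hs
  have hup : ∀ t : ℝ, 0 < t → t < 1 → alphaConst 1 (n+1) ≤
      (π / (2 * (1 - t))) ^ 2 * ((1 + t ^ 2) / (bj n * (1 - t)) ^ 2 + (2 * t / π) ^ 2) := by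
    intro t ht ht1
    obtain ⟨Ω₁, Ω₂, h1, h2, hs, hr⟩ := ratio_sharp hn ht ht1
    exact (csInf_le ⟨_, hlow⟩ ⟨Ω₁, Ω₂, h1, h2, hs, rfl⟩).trans hr
  apply le_antisymm
  · have hc : ContinuousAt (fun t : ℝ => (π / (2 * (1 - t))) ^ 2 * ((1 + t ^ 2) / (bj n * (1 - t)) ^ 2 + (2 * t / π) ^ 2)) 0 := by
      refine ContinuousAt.mul (ContinuousAt.pow (ContinuousAt.div (by fun_prop) (by fun_prop) (by norm_num)) 2)
        (ContinuousAt.add (ContinuousAt.div (by fun_prop) (by fun_prop) (by simpa using hj.ne')) (by fun_prop))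
    have ht := hc.tendsto.mono_left (nhdsWithin_le_nhds (s := Set.Ioi 0))
    have e : (π / (2 * (1 - 0))) ^ 2 * ((1 + (0:ℝ) ^ 2) / (bj n * (1 - 0)) ^ 2 + (2 * 0 / π) ^ 2) = π ^ 2 / (4 * bj n ^ 2) := by
      simp; field_simp; norm_num
    rw [e] at ht
    refine ge_of_tendsto ht ?_
    filter_upwards [self_mem_nhdsWithin, mem_nhdsWithin_of_mem_nhds (Iio_mem_nhds (zero_lt_one' ℝ))] with t h1 h2
    exact hup t h1 h2
  · obtain ⟨Ω₁, Ω₂, h1, h2, hs, -⟩ := ratio_sharp hn (t := 1/2) (by norm_num) (by norm_num)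
    exact le_csInf ⟨_, Ω₁, Ω₂, h1, h2, hs, rfl⟩ hlow

lemma alpha_final (d : ℕ) (hd : 2 ≤ d) :
    alphaConst 1 d = Real.pi ^ 2 / (4 * besselZero1 ((d : ℝ) / 2 - 1) ^ 2) := by
  obtain ⟨n, rfl⟩ : ∃ n, d = n + 1 := ⟨d - 1, by omega⟩
  rw [alpha_main (by omega), bj]
  have : bnu n = ((n + 1 : ℕ) : ℝ) / 2 - 1 := by unfold bnu; push_cast; ring
  rw [this]

/-- the optimal constant `α_{1,d}` equals `π²/(4 j_{d/2-1,1}²)`. -/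
theorem alpha_one_eq
    (d : ℕ) (hd : 2 ≤ d) :
    alphaConst 1 d = Real.pi ^ 2 / (4 * besselZero1 ((d : ℝ) / 2 - 1) ^ 2) := by
  exact alpha_final d hd

end
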